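/- arXiv:1501.03976 — 14 statements merged into one kernel-verified Lean document; each statement's English description precedes it below -/
import Mathlib

section
/- Let L > 0 and let γ : [0,L] → ℝ² be a twice continuously differentiable unit-speed curve with curvature κ(s) := det(γ'(s), γ''(s)). Then there exist an orthogonal 2×2 matrix P with det P = −1 and a constant vector c ∈ ℝ² such that γ(L−s) + P·γ(s) = c for all s ∈ [0,L] if and only if κ(L−s) = κ(s) for all s ∈ [0,L]. (That is, γ is axially symmetric if and only if its curvature function is symmetric.) -/
open Set

/-- A function that is constant on `[a, b]` has zero derivative there, endpoints included. -/
theorem HasDerivAt.eq_zero_of_const_on_Icc {f : ℝ → ℝ} {f' a b c s : ℝ} (hab : a < b)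
    (hs : s ∈ Icc a b) (hf : HasDerivAt f f' s) (hc : ∀ t ∈ Icc a b, f t = c) : f' = 0 :=
  (uniqueDiffOn_Icc hab s hs).eq_deriv _ hf.hasDerivWithinAt
    ((hasDerivWithinAt_const s _ c).congr hc (hc s hs))

/-- A function with zero derivative on `[a, b]` is constant there. -/
theorem eq_left_of_hasDerivAt_zero_on_Icc {f : ℝ → ℝ} {a b : ℝ}
    (hf : ∀ t ∈ Icc a b, HasDerivAt f 0 t) : ∀ t ∈ Icc a b, f t = f a :=
  constant_of_has_deriv_right_zero (fun t ht => (hf t ht).continuousAt.continuousWithinAt)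
    fun t ht => (hf t (Ico_subset_Icc_self ht)).hasDerivWithinAt

/-- Coordinates of the product `z(L - s) z(s)`, for `z = x + i y`, have derivative proportional
to the difference `k s - k (L - s)`, where `z' = i k z`. -/
theorem hasDerivAt_reflected_product {x y k : ℝ → ℝ} {L s : ℝ}
    (hx : HasDerivAt x (-(k s * y s)) s) (hy : HasDerivAt y (k s * x s) s)
    (hx' : HasDerivAt x (-(k (L - s) * y (L - s))) (L - s))
    (hy' : HasDerivAt y (k (L - s) * x (L - s)) (L - s)) :
    HasDerivAt (fun t => x (L - t) * x t - y (L - t) * y t)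
      (-((k s - k (L - s)) * (x (L - s) * y s + y (L - s) * x s))) s ∧
    HasDerivAt (fun t => x (L - t) * y t + y (L - t) * x t)
      ((k s - k (L - s)) * (x (L - s) * x s - y (L - s) * y s)) s := by
  have hX := hx'.comp_const_sub L s
  have hY := hy'.comp_const_sub L s
  constructor
  · exact ((hX.mul hx).sub (hY.mul hy)).congr_deriv (by ring)
  · exact ((hX.mul hy).add (hY.mul hx)).congr_deriv (by ring)

/-- The reflection of the plane with matrix `!![a, b; b, -a]`, where `a ^ 2 + b ^ 2 = 1`. -/
theorem exists_planar_reflection {a b : ℝ} (h : a ^ 2 + b ^ 2 = 1) :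
    ∃ P : EuclideanSpace ℝ (Fin 2) ≃ₗᵢ[ℝ] EuclideanSpace ℝ (Fin 2),
      LinearMap.det (P.toLinearEquiv :
        EuclideanSpace ℝ (Fin 2) →ₗ[ℝ] EuclideanSpace ℝ (Fin 2)) = -1 ∧
      ∀ v, P v 0 = a * v 0 + b * v 1 ∧ P v 1 = b * v 0 - a * v 1 := by
  set f := Matrix.toLpLin 2 2 !![a, b; b, -a] with hf
  have h0 : ∀ v, f v 0 = a * v 0 + b * v 1 := fun v => by
    simp [hf, Matrix.toLpLin_apply, dotProduct, Fin.sum_univ_two]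
  have h1 : ∀ v, f v 1 = b * v 0 - a * v 1 := fun v => by
    simp [hf, Matrix.toLpLin_apply, dotProduct, Fin.sum_univ_two]
    ring
  have hinv : Function.Involutive f := fun v => by
    ext i
    fin_cases i
    · simp only [Fin.zero_eta, h0, h1]
      linear_combination v 0 * h
    · simp only [Fin.mk_one, h0, h1]
      linear_combination v 1 * h
  refine ⟨⟨LinearEquiv.ofInvolutive f hinv, fun v => ?_⟩, ?_, fun v => ⟨h0 v, h1 v⟩⟩
  · change ‖f v‖ = ‖v‖
    rw [EuclideanSpace.norm_eq, EuclideanSpace.norm_eq]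
    simp only [Fin.sum_univ_two, h0, h1, Real.norm_eq_abs, sq_abs]
    congr 1
    linear_combination (v 0 ^ 2 + v 1 ^ 2) * h
  · change LinearMap.det f = -1
    rw [hf, Matrix.toLpLin_eq_toLin, LinearMap.det_toLin, Matrix.det_fin_two_of]
    linear_combination -h

/-- An isometry of the plane with determinant `-1` has matrix `!![a, b; b, -a]`, where
`a ^ 2 + b ^ 2 = 1`. -/
theorem LinearIsometryEquiv.exists_reflection_coords
    (P : EuclideanSpace ℝ (Fin 2) ≃ₗᵢ[ℝ] EuclideanSpace ℝ (Fin 2))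
    (hP : LinearMap.det (P.toLinearEquiv :
      EuclideanSpace ℝ (Fin 2) →ₗ[ℝ] EuclideanSpace ℝ (Fin 2)) = -1) :
    ∃ a b : ℝ, a ^ 2 + b ^ 2 = 1 ∧
      ∀ v, P v 0 = a * v 0 + b * v 1 ∧ P v 1 = b * v 0 - a * v 1 := by
  set e₀ : EuclideanSpace ℝ (Fin 2) := EuclideanSpace.single 0 1 with he₀
  set e₁ : EuclideanSpace ℝ (Fin 2) := EuclideanSpace.single 1 1 with he₁
  have hsq : ∀ v : EuclideanSpace ℝ (Fin 2), ‖v‖ = 1 → v 0 ^ 2 + v 1 ^ 2 = 1 := fun v hv => by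
    have := EuclideanSpace.norm_sq_eq v
    simpa [hv, Fin.sum_univ_two] using this.symm
  have h0 := hsq (P e₀) (by simp [he₀])
  have h1 := hsq (P e₁) (by simp [he₁])
  have hdet : P e₀ 0 * P e₁ 1 - P e₁ 0 * P e₀ 1 = -1 := by
    rw [← hP, ← LinearMap.det_toMatrix (EuclideanSpace.basisFun (Fin 2) ℝ).toBasis,
      Matrix.det_fin_two]
    simp [LinearMap.toMatrix_apply, he₀, he₁]
  have hb : P e₁ 0 = P e₀ 1 := by
    nlinarith [sq_nonneg (P e₁ 0 - P e₀ 1), sq_nonneg (P e₁ 1 + P e₀ 0)]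
  have ha : P e₁ 1 = -P e₀ 0 := by
    nlinarith [sq_nonneg (P e₁ 0 - P e₀ 1), sq_nonneg (P e₁ 1 + P e₀ 0)]
  refine ⟨P e₀ 0, P e₀ 1, h0, fun v => ?_⟩
  have hv : v = v 0 • e₀ + v 1 • e₁ := by
    ext i
    fin_cases i <;> simp [he₀, he₁]
  have hPv : P v = v 0 • P e₀ + v 1 • P e₁ := by
    conv_lhs => rw [hv]
    simp only [map_add, map_smul]
  constructor
  · simp only [hPv, PiLp.add_apply, PiLp.smul_apply, smul_eq_mul, hb]
    ring
  · simp only [hPv, PiLp.add_apply, PiLp.smul_apply, smul_eq_mul, ha]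
    ring

/-- A coordinate of a differentiable curve has the coordinate of the derivative as derivative. -/
theorem DifferentiableAt.hasDerivAt_euclidean_coord {n : ℕ} {f : ℝ → EuclideanSpace ℝ (Fin n)}
    {s : ℝ} (hf : DifferentiableAt ℝ f s) (i : Fin n) :
    HasDerivAt (fun t => f t i) (deriv f s i) s :=
  (EuclideanSpace.proj (𝕜 := ℝ) i).hasFDerivAt.comp_hasDerivAt s
    hf.hasDerivAt


/-- The signed curvature of a planar curve `γ`, given by
`κ(s) = det(γ'(s), γ''(s)) = γ₁'(s)γ₂''(s) − γ₂'(s)γ₁''(s)`. -/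
noncomputable def signedCurvature (γ : ℝ → EuclideanSpace ℝ (Fin 2)) (s : ℝ) : ℝ :=
  deriv γ s 0 * deriv (deriv γ) s 1 - deriv γ s 1 * deriv (deriv γ) s 0

/-- A twice continuously differentiable unit-speed planar curve on `[0,L]` is axially
symmetric (i.e. `s ↦ γ(L−s) + Pγ(s)` is constant for some orthogonal `P` with `det P = −1`)
if and only if its curvature is symmetric, `κ(L−s) = κ(s)`. -/
theorem axially_symmetric_iff_curvature_symmetric
    (L : ℝ) (hL : 0 < L) (γ : ℝ → EuclideanSpace ℝ (Fin 2))
    (hγ : ContDiff ℝ 2 γ)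
    (hunit : ∀ s ∈ Set.Icc (0 : ℝ) L, ‖deriv γ s‖ = 1)
    (κ : ℝ → ℝ) (hκ : ∀ s, κ s = signedCurvature γ s) :
    (∃ (P : EuclideanSpace ℝ (Fin 2) ≃ₗᵢ[ℝ] EuclideanSpace ℝ (Fin 2))
       (c : EuclideanSpace ℝ (Fin 2)),
        LinearMap.det (P.toLinearEquiv :
          EuclideanSpace ℝ (Fin 2) →ₗ[ℝ] EuclideanSpace ℝ (Fin 2)) = -1 ∧
        ∀ s ∈ Set.Icc (0 : ℝ) L, γ (L - s) + P (γ s) = c) ↔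
      (∀ s ∈ Set.Icc (0 : ℝ) L, κ (L - s) = κ s) := by
  have hd : Differentiable ℝ γ := hγ.differentiable (by norm_num)
  have hd' : Differentiable ℝ (deriv γ) := by
    have : ContDiff ℝ (1 + 1) γ := by simpa [one_add_one_eq_two] using hγ
    exact (contDiff_succ_iff_deriv.1 this).2.2.differentiable (by norm_num)
  have hγ' : ∀ s i, HasDerivAt (fun t => γ t i) (deriv γ s i) s :=
    fun s i => (hd s).hasDerivAt_euclidean_coord i
  have hsq : ∀ s ∈ Icc 0 L, deriv γ s 0 ^ 2 + deriv γ s 1 ^ 2 = 1 := fun s hs => by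
    have := EuclideanSpace.norm_sq_eq (deriv γ s)
    simpa [hunit s hs, Fin.sum_univ_two] using this.symm
  have horth : ∀ s ∈ Icc 0 L,
      deriv γ s 0 * deriv (deriv γ) s 0 + deriv γ s 1 * deriv (deriv γ) s 1 = 0 := fun s hs => by
    have := (((hd' s).hasDerivAt_euclidean_coord 0).pow 2).add
      (((hd' s).hasDerivAt_euclidean_coord 1).pow 2)
    have := this.eq_zero_of_const_on_Icc hL hs hsq
    norm_num at this
    linarith
  have hx : ∀ s ∈ Icc 0 L, HasDerivAt (fun t => deriv γ t 0) (-(κ s * deriv γ s 1)) s :=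
    fun s hs => by
      convert (hd' s).hasDerivAt_euclidean_coord 0 using 1
      rw [hκ, signedCurvature]
      linear_combination (deriv (deriv γ) s 0) * hsq s hs - deriv γ s 0 * horth s hs
  have hy : ∀ s ∈ Icc 0 L, HasDerivAt (fun t => deriv γ t 1) (κ s * deriv γ s 0) s :=
    fun s hs => by
      convert (hd' s).hasDerivAt_euclidean_coord 1 using 1
      rw [hκ, signedCurvature]
      linear_combination (deriv (deriv γ) s 1) * hsq s hs - deriv γ s 1 * horth s hs
  have hmem : ∀ s ∈ Icc 0 L, L - s ∈ Icc 0 L := fun s hs => ⟨by linarith [hs.2], by linarith [hs.1]⟩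
  have hprod := fun s (hs : s ∈ Icc 0 L) => hasDerivAt_reflected_product
    (x := fun t => deriv γ t 0) (y := fun t => deriv γ t 1) (k := κ)
    (hx s hs) (hy s hs) (hx _ (hmem s hs)) (hy _ (hmem s hs))
  have hsum : ∀ (a b : ℝ) (i : Fin 2) (s : ℝ),
      HasDerivAt (fun t => γ (L - t) i + (a * γ t 0 + b * γ t 1))
        (-deriv γ (L - s) i + (a * deriv γ s 0 + b * deriv γ s 1)) s := fun a b i s =>
    ((hγ' (L - s) i).comp_const_sub L s).add
      (((hγ' s 0).const_mul a).add ((hγ' s 1).const_mul b))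
  constructor
  · rintro ⟨P, c, hdet, hP⟩ s hs
    obtain ⟨a, b, hab, hcoord⟩ := P.exists_reflection_coords hdet
    have h0 : ∀ t ∈ Icc 0 L, -deriv γ (L - t) 0 + (a * deriv γ t 0 + b * deriv γ t 1) = 0 :=
      fun t ht => (hsum a b 0 t).eq_zero_of_const_on_Icc (c := c 0) hL ht fun r hr => by
        rw [← (hcoord _).1, ← hP r hr, PiLp.add_apply]
    have h1 : ∀ t ∈ Icc 0 L, -deriv γ (L - t) 1 + (b * deriv γ t 0 + -a * deriv γ t 1) = 0 :=
      fun t ht => (hsum b (-a) 1 t).eq_zero_of_const_on_Icc (c := c 1) hL ht fun r hr => by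
        rw [neg_mul, ← sub_eq_add_neg, ← (hcoord _).2, ← hP r hr, PiLp.add_apply]
    have hA : ∀ t ∈ Icc 0 L,
        deriv γ (L - t) 0 * deriv γ t 0 - deriv γ (L - t) 1 * deriv γ t 1 = a := fun t ht => by
      linear_combination -deriv γ t 0 * h0 t ht + deriv γ t 1 * h1 t ht + a * hsq t ht
    have hB : ∀ t ∈ Icc 0 L,
        deriv γ (L - t) 0 * deriv γ t 1 + deriv γ (L - t) 1 * deriv γ t 0 = b := fun t ht => by
      linear_combination -deriv γ t 1 * h0 t ht - deriv γ t 0 * h1 t ht + b * hsq t ht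
    have hA' := (hprod s hs).1.eq_zero_of_const_on_Icc hL hs hA
    have hB' := (hprod s hs).2.eq_zero_of_const_on_Icc hL hs hB
    rw [hB s hs] at hA'
    rw [hA s hs] at hB'
    linear_combination b * hA' - a * hB' + (κ s - κ (L - s)) * hab
  · intro hsymm
    have hA := eq_left_of_hasDerivAt_zero_on_Icc fun s hs => by
      simpa only [hsymm s hs, sub_self, zero_mul, neg_zero] using (hprod s hs).1
    have hB := eq_left_of_hasDerivAt_zero_on_Icc fun s hs => by
      simpa only [hsymm s hs, sub_self, zero_mul] using (hprod s hs).2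
    set a := deriv γ (L - 0) 0 * deriv γ 0 0 - deriv γ (L - 0) 1 * deriv γ 0 1
    set b := deriv γ (L - 0) 0 * deriv γ 0 1 + deriv γ (L - 0) 1 * deriv γ 0 0
    have hmem0 : (0 : ℝ) ∈ Icc 0 L := left_mem_Icc.2 hL.le
    have hab : a ^ 2 + b ^ 2 = 1 := by
      linear_combination (deriv γ 0 0 ^ 2 + deriv γ 0 1 ^ 2) * hsq _ (hmem 0 hmem0) + hsq 0 hmem0
    obtain ⟨P, hdet, hcoord⟩ := exists_planar_reflection hab
    refine ⟨P, γ (L - 0) + P (γ 0), hdet, fun s hs => ?_⟩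
    have h0 := eq_left_of_hasDerivAt_zero_on_Icc (fun t ht => by
      convert hsum a b 0 t using 1
      linear_combination deriv γ t 0 * hA t ht - deriv γ (L - t) 0 * hsq t ht
        + deriv γ t 1 * hB t ht) s hs
    have h1 := eq_left_of_hasDerivAt_zero_on_Icc (fun t ht => by
      convert hsum b (-a) 1 t using 1
      linear_combination deriv γ t 0 * hB t ht - deriv γ (L - t) 1 * hsq t ht
        - deriv γ t 1 * hA t ht) s hs
    ext i
    fin_cases i
    · simpa only [Fin.zero_eta, PiLp.add_apply, (hcoord _).1] using h0
    · simpa only [Fin.mk_one, PiLp.add_apply, (hcoord _).2, neg_mul, ← sub_eq_add_neg] using h1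
end

section
/- Let L > 0 and let γ : [0,L] → ℝ² be a twice continuously differentiable unit-speed curve with curvature κ(s) := det(γ'(s), γ''(s)). Then there exists a constant vector c ∈ ℝ² such that γ(L−s) + γ(s) = c for all s ∈ [0,L] if and only if κ(L−s) = −κ(s) for all s ∈ [0,L]. (That is, γ is pointwise symmetric if and only if its curvature function is antisymmetric about the midpoint.) -/
/-- Two functions that agree on a nondegenerate closed interval have the same derivative there,
including at the endpoints. -/
lemma HasDerivAt.unique_of_eqOn_Icc {E : Type*} [NormedAddCommGroup E] [NormedSpace ℝ E]
    {a b s : ℝ} {f g : ℝ → E} {f' g' : E} (hab : a < b) (hs : s ∈ Set.Icc a b)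
    (hfg : Set.EqOn f g (Set.Icc a b)) (hf : HasDerivAt f f' s) (hg : HasDerivAt g g' s) :
    f' = g' :=
  (uniqueDiffOn_Icc hab s hs).eq_deriv _ hf.hasDerivWithinAt
    (hg.hasDerivWithinAt.congr hfg (hfg hs))

/-- A function with vanishing derivative on a closed interval is constant there. -/
lemma eq_of_hasDerivAt_zero_Icc {E : Type*} [NormedAddCommGroup E] [NormedSpace ℝ E]
    {a b s t : ℝ} {f : ℝ → E} (hf : ∀ x ∈ Set.Icc a b, HasDerivAt f 0 x)
    (hs : s ∈ Set.Icc a b) (ht : t ∈ Set.Icc a b) : f s = f t := by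
  have h := constant_of_has_deriv_right_zero
    (fun x hx => (hf x hx).continuousAt.continuousWithinAt)
    (fun x hx => (hf x (Set.Ico_subset_Icc_self hx)).hasDerivWithinAt)
  rw [h s hs, h t ht]

/-- The coordinates of a differentiable curve in Euclidean space are differentiable. -/
lemma HasDerivAt.euclidean_apply {ι : Type*} [Fintype ι] {f : ℝ → EuclideanSpace ℝ ι}
    {f' : EuclideanSpace ℝ ι} {s : ℝ} (hf : HasDerivAt f f' s) (i : ι) :
    HasDerivAt (fun x => f x i) (f' i) s :=
  (EuclideanSpace.proj (𝕜 := ℝ) i).hasFDerivAt.comp_hasDerivAt s hf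

/-- A twice continuously differentiable unit-speed planar curve on `[0,L]` is pointwise
symmetric (i.e. `s ↦ γ(L−s) + γ(s)` is constant) if and only if its curvature is
antisymmetric about the midpoint, `κ(L−s) = −κ(s)`. -/
theorem pointwise_symmetric_iff_curvature_antisymmetric
    (L : ℝ) (hL : 0 < L) (γ : ℝ → EuclideanSpace ℝ (Fin 2))
    (hγ : ContDiff ℝ 2 γ)
    (hunit : ∀ s ∈ Set.Icc (0 : ℝ) L, ‖deriv γ s‖ = 1)
    (κ : ℝ → ℝ) (hκ : ∀ s, κ s = signedCurvature γ s) :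
    (∃ c : EuclideanSpace ℝ (Fin 2),
        ∀ s ∈ Set.Icc (0 : ℝ) L, γ (L - s) + γ s = c) ↔
      (∀ s ∈ Set.Icc (0 : ℝ) L, κ (L - s) = -κ s) := by
  have hd1 : ∀ s, HasDerivAt γ (deriv γ s) s := fun s =>
    (hγ.differentiable (by norm_num) s).hasDerivAt
  have hγ' : ContDiff ℝ 1 (deriv γ) :=
    ((contDiff_succ_iff_deriv (n := 1)).1 (by simpa [one_add_one_eq_two] using hγ)).2.2
  have hd2 : ∀ s, HasDerivAt (deriv γ) (deriv (deriv γ) s) s := fun s =>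
    (hγ'.differentiable (by norm_num) s).hasDerivAt
  have hrefl : ∀ s ∈ Set.Icc (0 : ℝ) L, L - s ∈ Set.Icc (0 : ℝ) L := fun s hs =>
    ⟨by linarith [hs.2], by linarith [hs.1]⟩
  simp only [hκ, signedCurvature]
  constructor
  · rintro ⟨c, hc⟩
    have h1 : ∀ s ∈ Set.Icc (0 : ℝ) L, deriv γ (L - s) = deriv γ s := fun s hs =>
      neg_add_eq_zero.1 (HasDerivAt.unique_of_eqOn_Icc hL hs hc
        (((hd1 (L - s)).comp_const_sub L s).add (hd1 s)) (hasDerivAt_const s c))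
    intro s hs
    have h2 : -deriv (deriv γ) (L - s) = deriv (deriv γ) s :=
      HasDerivAt.unique_of_eqOn_Icc hL hs h1 ((hd2 (L - s)).comp_const_sub L s) (hd2 s)
    rw [h1 s hs, ← h2]
    simp only [PiLp.neg_apply]
    ring
  · intro hanti
    have hsq : ∀ s ∈ Set.Icc (0 : ℝ) L, deriv γ s 0 ^ 2 + deriv γ s 1 ^ 2 = 1 := fun s hs => by
      have h := EuclideanSpace.real_norm_sq_eq (deriv γ s)
      rw [hunit s hs, Fin.sum_univ_two] at h
      linarith
    have horth : ∀ s ∈ Set.Icc (0 : ℝ) L,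
        deriv γ s 0 * deriv (deriv γ) s 0 + deriv γ s 1 * deriv (deriv γ) s 1 = 0 := fun s hs => by
      have h := HasDerivAt.unique_of_eqOn_Icc hL hs hsq
        ((((hd2 s).euclidean_apply 0).pow 2).add (((hd2 s).euclidean_apply 1).pow 2))
        (hasDerivAt_const s 1)
      norm_num at h
      linarith
    have hfrenet : ∀ s ∈ Set.Icc (0 : ℝ) L,
        deriv (deriv γ) s 0 = -signedCurvature γ s * deriv γ s 1 ∧
          deriv (deriv γ) s 1 = signedCurvature γ s * deriv γ s 0 := fun s hs => by
      have h := hsq s hs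
      have h' := horth s hs
      unfold signedCurvature
      constructor
      · linear_combination (-deriv (deriv γ) s 0) * h + deriv γ s 0 * h'
      · linear_combination (-deriv (deriv γ) s 1) * h + deriv γ s 1 * h'
    have hmid : L / 2 ∈ Set.Icc (0 : ℝ) L := ⟨by linarith, by linarith⟩
    have hinner : ∀ s ∈ Set.Icc (0 : ℝ) L,
        deriv γ (L - s) 0 * deriv γ s 0 + deriv γ (L - s) 1 * deriv γ s 1 = 1 := fun s hs => by
      have h := eq_of_hasDerivAt_zero_Icc
        (f := fun s => deriv γ (L - s) 0 * deriv γ s 0 + deriv γ (L - s) 1 * deriv γ s 1)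
        (fun x hx => ?_) hs hmid
      · simp only [sub_half] at h
        rw [h, ← hsq _ hmid]
        ring
      · have hr := (hd2 (L - x)).comp_const_sub L x
        refine (((hr.euclidean_apply 0).mul ((hd2 x).euclidean_apply 0)).add
          ((hr.euclidean_apply 1).mul ((hd2 x).euclidean_apply 1))).congr_deriv ?_
        have hk : signedCurvature γ (L - x) = -signedCurvature γ x := hanti x hx
        simp only [PiLp.neg_apply]
        rw [(hfrenet x hx).1, (hfrenet x hx).2, (hfrenet _ (hrefl x hx)).1,
          (hfrenet _ (hrefl x hx)).2, hk]
        ring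
    have htangent : ∀ s ∈ Set.Icc (0 : ℝ) L, deriv γ (L - s) = deriv γ s := fun s hs => by
      have h0 := hsq s hs
      have h1 := hsq _ (hrefl s hs)
      have h2 := hinner s hs
      ext i
      fin_cases i
      · simp only [Fin.zero_eta]
        nlinarith [sq_nonneg (deriv γ (L - s) 0 - deriv γ s 0),
          sq_nonneg (deriv γ (L - s) 1 - deriv γ s 1)]
      · simp only [Fin.mk_one]
        nlinarith [sq_nonneg (deriv γ (L - s) 0 - deriv γ s 0),
          sq_nonneg (deriv γ (L - s) 1 - deriv γ s 1)]
    refine ⟨γ (L - 0) + γ 0, fun s hs => ?_⟩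
    refine eq_of_hasDerivAt_zero_Icc (f := fun s => γ (L - s) + γ s) (fun x hx => ?_) hs
      (Set.left_mem_Icc.2 hL.le)
    refine (((hd1 (L - x)).comp_const_sub L x).add (hd1 x)).congr_deriv ?_
    rw [htangent x hx, neg_add_cancel]
end

section
/- Let L > 0 and let κ : [0,L] → ℝ be twice differentiable with 2κ''(s) = −κ(s)³ for all s ∈ [0,L], and suppose a⁴ := κ'(0)² + κ(0)⁴/4 > 0. Then for all s ∈ [0,L]: cos(∫₀ˢ κ(r) dr) = (κ(0)²·κ(s)²/4 + κ'(0)·κ'(s)) / a⁴. -/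
/-- A planar vector `(u, v)` obeying `u' = -κ v`, `v' = κ u` with `κ = θ'` is constant after
rotating by the angle `-θ`; this is its first rotated coordinate. -/
lemma rotated_coordinate_eq_of_hasDerivAt {L : ℝ} {u v κ θ : ℝ → ℝ}
    (hu : ∀ s ∈ Set.Icc 0 L, HasDerivAt u (-(κ s * v s)) s)
    (hv : ∀ s ∈ Set.Icc 0 L, HasDerivAt v (κ s * u s) s)
    (hθ : ∀ s ∈ Set.Icc 0 L, HasDerivAt θ (κ s) s) {s : ℝ} (hs : s ∈ Set.Icc 0 L) :
    u s * Real.cos (θ s) + v s * Real.sin (θ s) =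
      u 0 * Real.cos (θ 0) + v 0 * Real.sin (θ 0) := by
  have hder : ∀ t ∈ Set.Icc 0 L,
      HasDerivAt (fun t => u t * Real.cos (θ t) + v t * Real.sin (θ t)) 0 t := by
    intro t ht
    have h := ((hu t ht).mul (hθ t ht).cos).add ((hv t ht).mul (hθ t ht).sin)
    exact h.congr_deriv (by ring)
  exact constant_of_has_deriv_right_zero
    (fun t ht => (hder t ht).continuousAt.continuousWithinAt)
    (fun t ht => (hder t (Set.Ico_subset_Icc_self ht)).hasDerivWithinAt) s hs

/-- For a twice differentiable solution `κ` of the Willmore ODE `2κ'' = −κ³` on `[0,L]`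
with `a⁴ := κ'(0)² + κ(0)⁴/4 > 0`, one has
`cos(∫₀ˢ κ) = (κ(0)²κ(s)²/4 + κ'(0)κ'(s)) / a⁴` for all `s ∈ [0,L]`. -/
theorem willmore_ode_cos_formula
    (L : ℝ) (hL : 0 < L) (κ : ℝ → ℝ)
    (hκ1 : Differentiable ℝ κ) (hκ2 : Differentiable ℝ (deriv κ))
    (hode : ∀ s ∈ Set.Icc (0 : ℝ) L, 2 * deriv (deriv κ) s = -(κ s) ^ 3)
    (a : ℝ) (ha : a ^ 4 = deriv κ 0 ^ 2 + κ 0 ^ 4 / 4) (hapos : 0 < a ^ 4) :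
    ∀ s ∈ Set.Icc (0 : ℝ) L,
      Real.cos (∫ r in (0 : ℝ)..s, κ r)
        = (κ 0 ^ 2 * κ s ^ 2 / 4 + deriv κ 0 * deriv κ s) / a ^ 4 := by
  intro s hs
  set θ : ℝ → ℝ := fun t => ∫ r in (0 : ℝ)..t, κ r with hθdef
  have hθ : ∀ t ∈ Set.Icc 0 L, HasDerivAt θ (κ t) t := fun t _ =>
    hκ1.continuous.integral_hasStrictDerivAt 0 t |>.hasDerivAt
  have hθ0 : θ 0 = 0 := intervalIntegral.integral_same
  have hu : ∀ t ∈ Set.Icc 0 L, HasDerivAt (deriv κ) (-(κ t * (κ t ^ 2 / 2))) t :=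
    fun t ht => (hκ2 t).hasDerivAt.congr_deriv (by linear_combination hode t ht / 2)
  have hv : ∀ t ∈ Set.Icc 0 L, HasDerivAt (fun t => κ t ^ 2 / 2) (κ t * deriv κ t) t :=
    fun t _ => (((hκ1 t).hasDerivAt.pow 2).div_const 2).congr_deriv (by norm_num; ring)
  have hP := rotated_coordinate_eq_of_hasDerivAt hu hv hθ hs
  have hQ := rotated_coordinate_eq_of_hasDerivAt (u := fun t => κ t ^ 2 / 2)
    (v := fun t => -deriv κ t) (fun t ht => (hv t ht).congr_deriv (by ring))
    (fun t ht => (hu t ht).neg.congr_deriv (by ring)) hθ hs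
  simp only [hθ0, Real.cos_zero, Real.sin_zero, mul_one, mul_zero, add_zero] at hP hQ
  change Real.cos (θ s) = _
  have hcs := Real.sin_sq_add_cos_sq (θ s)
  have henergy : a ^ 4 = deriv κ s ^ 2 + κ s ^ 4 / 4 := by
    have hsq : κ 0 ^ 4 / 4 = (κ 0 ^ 2 / 2) ^ 2 := by ring
    rw [ha, hsq, ← hP, ← hQ]
    linear_combination (deriv κ s ^ 2 + κ s ^ 4 / 4) * hcs
  rw [eq_div_iff hapos.ne', henergy]
  linear_combination deriv κ s * hP + κ s ^ 2 / 2 * hQ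
end

section
/- Let L > 0 and let κ : [0,L] → ℝ be twice differentiable with 2κ''(s) = −κ(s)³ for all s ∈ [0,L], and suppose a⁴ := κ'(0)² + κ(0)⁴/4 > 0. Then for all s ∈ [0,L]: sin(∫₀ˢ κ(r) dr) = (κ'(0)·κ(s)² − κ(0)²·κ'(s)) / (2a⁴). -/
/-- If the planar vector `(X, Y)` rotates with angular velocity `k = θ'`, then rotating it back by
the angle `θ` gives a constant vector. -/
theorem rotation_invariants {X Y θ k : ℝ → ℝ} {L : ℝ}
    (hX : ∀ t, HasDerivAt X (k t * Y t) t)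
    (hY : ∀ t ∈ Set.Icc 0 L, HasDerivAt Y (-(k t * X t)) t)
    (hθ : ∀ t, HasDerivAt θ (k t) t) {s : ℝ} (hs : s ∈ Set.Icc 0 L) :
    X s * Real.cos (θ s) - Y s * Real.sin (θ s) = X 0 * Real.cos (θ 0) - Y 0 * Real.sin (θ 0) ∧
    X s * Real.sin (θ s) + Y s * Real.cos (θ s) = X 0 * Real.sin (θ 0) + Y 0 * Real.cos (θ 0) := by
  have constant {f : ℝ → ℝ} (hf : ∀ t ∈ Set.Icc 0 L, HasDerivAt f 0 t) : f s = f 0 :=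
    constant_of_has_deriv_right_zero (fun t ht => (hf t ht).continuousAt.continuousWithinAt)
      (fun t ht => (hf t (Set.Ico_subset_Icc_self ht)).hasDerivWithinAt) s hs
  constructor
  · refine constant (f := fun t => X t * Real.cos (θ t) - Y t * Real.sin (θ t)) fun t ht => ?_
    exact (((hX t).mul (hθ t).cos).sub ((hY t ht).mul (hθ t).sin)).congr_deriv (by ring)
  · refine constant (f := fun t => X t * Real.sin (θ t) + Y t * Real.cos (θ t)) fun t ht => ?_
    exact (((hX t).mul (hθ t).sin).add ((hY t ht).mul (hθ t).cos)).congr_deriv (by ring)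


/-- For a twice differentiable solution `κ` of the Willmore ODE `2κ'' = −κ³` on `[0,L]`
with `a⁴ := κ'(0)² + κ(0)⁴/4 > 0`, one has
`sin(∫₀ˢ κ) = (κ'(0)κ(s)² − κ(0)²κ'(s)) / (2a⁴)` for all `s ∈ [0,L]`. -/
theorem willmore_ode_sin_formula
    (L : ℝ) (hL : 0 < L) (κ : ℝ → ℝ)
    (hκ1 : Differentiable ℝ κ) (hκ2 : Differentiable ℝ (deriv κ))
    (hode : ∀ s ∈ Set.Icc (0 : ℝ) L, 2 * deriv (deriv κ) s = -(κ s) ^ 3)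
    (a : ℝ) (ha : a ^ 4 = deriv κ 0 ^ 2 + κ 0 ^ 4 / 4) (hapos : 0 < a ^ 4) :
    ∀ s ∈ Set.Icc (0 : ℝ) L,
      Real.sin (∫ r in (0 : ℝ)..s, κ r)
        = (deriv κ 0 * κ s ^ 2 - κ 0 ^ 2 * deriv κ s) / (2 * a ^ 4) := by
  intro s hs
  have hθ : ∀ t, HasDerivAt (fun t => ∫ r in (0 : ℝ)..t, κ r) (κ t) t := fun t =>
    hκ1.continuous.integral_hasStrictDerivAt 0 t |>.hasDerivAt
  set θ : ℝ → ℝ := fun t => ∫ r in (0 : ℝ)..t, κ r with hθ_def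
  have hθ0 : θ 0 = 0 := by simp [hθ_def]
  have hX : ∀ t, HasDerivAt (fun t => κ t ^ 2 / 2) (κ t * deriv κ t) t := fun t => by
    refine (((hκ1 t).hasDerivAt.pow 2).div_const 2).congr_deriv ?_
    simp
    ring
  have hY : ∀ t ∈ Set.Icc 0 L, HasDerivAt (deriv κ) (-(κ t * (κ t ^ 2 / 2))) t := fun t ht =>
    (hκ2 t).hasDerivAt.congr_deriv (by linarith [hode t ht])
  obtain ⟨hP, hQ⟩ := rotation_invariants hX hY hθ hs
  simp only [hθ0, Real.cos_zero, Real.sin_zero] at hP hQ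
  have hsc := Real.sin_sq_add_cos_sq (θ s)
  have hX0 : κ 0 ^ 2 = 2 * (κ s ^ 2 / 2 * Real.cos (θ s) - deriv κ s * Real.sin (θ s)) := by
    linarith
  have hY0 : deriv κ 0 = κ s ^ 2 / 2 * Real.sin (θ s) + deriv κ s * Real.cos (θ s) := by
    linarith
  have hE : a ^ 4 = deriv κ s ^ 2 + κ s ^ 4 / 4 := by
    rw [ha, show κ 0 ^ 4 = (κ 0 ^ 2) ^ 2 by ring, hX0, hY0]
    linear_combination (deriv κ s ^ 2 + κ s ^ 4 / 4) * hsc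
  change Real.sin (θ s) = _
  rw [eq_div_iff (by positivity), hE, hX0, hY0]
  ring
end

section
/- Let L > 0 and let γ : [0,L] → ℝ² be a smooth unit-speed curve whose curvature κ(s) := det(γ'(s), γ''(s)) satisfies 2κ''(s) = −κ(s)³ for all s ∈ [0,L]. Then, with W := (1/2)∫₀ᴸ κ(s)² ds, one has W² = (κ'(0)² + κ(0)⁴/4)·‖γ(L) − γ(0)‖² − (κ(L) − κ(0))². -/
/-- The derivative of a coordinate of a differentiable planar curve. -/
theorem hasDerivAt_coord {f : ℝ → EuclideanSpace ℝ (Fin 2)} (hf : Differentiable ℝ f)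
    (i : Fin 2) (s : ℝ) : HasDerivAt (fun t => f t i) (deriv f s i) s :=
  (EuclideanSpace.proj i : EuclideanSpace ℝ (Fin 2) →L[ℝ] ℝ).hasFDerivAt.comp_hasDerivAt s
    (hf s).hasDerivAt

/-- A function with vanishing derivative on `[0, L]` is constant there. -/
theorem eq_left_of_hasDerivAt_zero {L : ℝ} {f f' : ℝ → ℝ}
    (hf : ∀ s, HasDerivAt f (f' s) s) (h0 : ∀ s ∈ Set.Icc (0 : ℝ) L, f' s = 0) :
    ∀ s ∈ Set.Icc (0 : ℝ) L, f s = f 0 := by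
  refine constant_of_has_deriv_right_zero (fun s _ => (hf s).continuousAt.continuousWithinAt)
    fun s hs => ?_
  have h := (hf s).hasDerivWithinAt (s := Set.Ici s)
  rwa [h0 s ⟨hs.1, hs.2.le⟩] at h

/-- The tangent and the second derivative of a unit-speed curve are orthogonal. -/
theorem tangent_orthogonal {L : ℝ} (hL : 0 < L) {a b c d : ℝ → ℝ}
    (ha : ∀ s, HasDerivAt a (c s) s) (hb : ∀ s, HasDerivAt b (d s) s)
    (hu : ∀ s ∈ Set.Icc (0 : ℝ) L, a s ^ 2 + b s ^ 2 = 1) :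
    ∀ s ∈ Set.Icc (0 : ℝ) L, a s * c s + b s * d s = 0 := by
  intro s hs
  have h1 := (((ha s).fun_pow 2).fun_add ((hb s).fun_pow 2)).hasDerivWithinAt
    (s := Set.Icc (0 : ℝ) L)
  have h2 : HasDerivWithinAt (fun t => a t ^ 2 + b t ^ 2) 0 (Set.Icc (0 : ℝ) L) s :=
    (hasDerivWithinAt_const s _ (1 : ℝ)).congr hu (hu s hs)
  have h3 := (uniqueDiffOn_Icc hL s hs).eq_deriv _ h1 h2
  norm_num at h3
  linarith

/-- The energy identity for a planar Willmore curve in coordinates: `(x, y)` is the curve,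
`(a, b)` its tangent, `(c, d)` its second derivative, `κ` its curvature and `k = κ'`. -/
theorem willmore_energy_coord {L : ℝ} (hL : 0 < L) {x y a b c d κ k m : ℝ → ℝ}
    (hx : ∀ s, HasDerivAt x (a s) s) (hy : ∀ s, HasDerivAt y (b s) s)
    (ha : ∀ s, HasDerivAt a (c s) s) (hb : ∀ s, HasDerivAt b (d s) s)
    (hκ : ∀ s, HasDerivAt κ (k s) s) (hk : ∀ s, HasDerivAt k (m s) s)
    (hu : ∀ s ∈ Set.Icc (0 : ℝ) L, a s ^ 2 + b s ^ 2 = 1)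
    (hdet : ∀ s, κ s = a s * d s - b s * c s)
    (hode : ∀ s ∈ Set.Icc (0 : ℝ) L, 2 * m s = -(κ s) ^ 3) :
    ((1 / 2) * ∫ s in (0 : ℝ)..L, κ s ^ 2) ^ 2 =
      (k 0 ^ 2 + κ 0 ^ 4 / 4) * ((x L - x 0) ^ 2 + (y L - y 0) ^ 2) - (κ L - κ 0) ^ 2 := by
  have horth := tangent_orthogonal hL ha hb hu
  have hc : ∀ s ∈ Set.Icc (0 : ℝ) L, c s = -κ s * b s := fun s hs => by
    linear_combination (-c s) * hu s hs + a s * horth s hs + b s * hdet s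
  have hd : ∀ s ∈ Set.Icc (0 : ℝ) L, d s = κ s * a s := fun s hs => by
    linear_combination (-d s) * hu s hs + b s * horth s hs - a s * hdet s
  have hp := eq_left_of_hasDerivAt_zero (L := L)
    (fun s => ((((hκ s).fun_pow 2).div_const 2).fun_mul (ha s)).fun_sub ((hk s).fun_mul (hb s)))
    (fun s hs => by
      rw [hc s hs, hd s hs]
      norm_num
      linear_combination (-b s / 2) * hode s hs)
  have hq := eq_left_of_hasDerivAt_zero (L := L)
    (fun s => ((((hκ s).fun_pow 2).div_const 2).fun_mul (hb s)).fun_add ((hk s).fun_mul (ha s)))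
    (fun s hs => by
      rw [hc s hs, hd s hs]
      norm_num
      linear_combination (a s / 2) * hode s hs)
  set p := κ 0 ^ 2 / 2 * a 0 - k 0 * b 0 with hp0
  set q := κ 0 ^ 2 / 2 * b 0 + k 0 * a 0 with hq0
  have hpq : p ^ 2 + q ^ 2 = k 0 ^ 2 + κ 0 ^ 4 / 4 := by
    rw [hp0, hq0]
    linear_combination (k 0 ^ 2 + κ 0 ^ 4 / 4) * hu 0 ⟨le_rfl, hL.le⟩
  have hW : (∫ s in (0 : ℝ)..L, κ s ^ 2) =
      2 * (p * x L + q * y L) - 2 * (p * x 0 + q * y 0) := by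
    refine intervalIntegral.integral_eq_sub_of_hasDerivAt
      (f := fun s => 2 * (p * x s + q * y s)) (fun s hs => ?_) ?_
    · rw [Set.uIcc_of_le hL.le] at hs
      have h := (((hx s).const_mul p).fun_add ((hy s).const_mul q)).const_mul 2
      refine h.congr_deriv ?_
      linear_combination -2 * a s * hp s hs - 2 * b s * hq s hs + κ s ^ 2 * hu s hs
    · have : Continuous κ := continuous_iff_continuousAt.2 fun s => (hκ s).continuousAt
      exact (this.pow 2).intervalIntegrable _ _
  have hκL := eq_left_of_hasDerivAt_zero (L := L)
    (fun s => ((hκ s).fun_sub ((hx s).const_mul q)).fun_add ((hy s).const_mul p))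
    (fun s hs => by
      linear_combination (-k s) * hu s hs + a s * hq s hs - b s * hp s hs)
    L ⟨hL.le, le_rfl⟩
  have hΔ : κ L - κ 0 = q * (x L - x 0) - p * (y L - y 0) := by linear_combination hκL
  rw [hW, hΔ, ← hpq]
  ring


/-- For a smooth unit-speed planar Willmore curve `γ` on `[0,L]` (i.e. its curvature `κ`
satisfies `2κ'' = −κ³`), the Willmore energy `W = (1/2)∫₀ᴸ κ²` satisfies
`W² = (κ'(0)² + κ(0)⁴/4)·‖γ(L) − γ(0)‖² − (κ(L) − κ(0))²`. -/
theorem willmore_energy_formula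
    (L : ℝ) (hL : 0 < L) (γ : ℝ → EuclideanSpace ℝ (Fin 2))
    (hγ : ContDiff ℝ (⊤ : ℕ∞) γ)
    (hunit : ∀ s ∈ Set.Icc (0 : ℝ) L, ‖deriv γ s‖ = 1)
    (κ : ℝ → ℝ) (hκ : ∀ s, κ s = signedCurvature γ s)
    (hode : ∀ s ∈ Set.Icc (0 : ℝ) L, 2 * deriv (deriv κ) s = -(κ s) ^ 3)
    (W : ℝ) (hW : W = (1 / 2) * ∫ s in (0 : ℝ)..L, κ s ^ 2) :
    W ^ 2 = (deriv κ 0 ^ 2 + κ 0 ^ 4 / 4) * ‖γ L - γ 0‖ ^ 2 - (κ L - κ 0) ^ 2 := by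
  have hγ1 : ContDiff ℝ (⊤ : ℕ∞) (deriv γ) := (contDiff_infty_iff_deriv.1 hγ).2
  have hγ2 : ContDiff ℝ (⊤ : ℕ∞) (deriv (deriv γ)) := (contDiff_infty_iff_deriv.1 hγ1).2
  have hcoord : ∀ {f : ℝ → EuclideanSpace ℝ (Fin 2)}, ContDiff ℝ (⊤ : ℕ∞) f →
      ∀ i, ContDiff ℝ (⊤ : ℕ∞) fun s => f s i := fun hf i =>
    (EuclideanSpace.proj i : EuclideanSpace ℝ (Fin 2) →L[ℝ] ℝ).contDiff.comp hf
  have hκs : ContDiff ℝ (⊤ : ℕ∞) κ := by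
    rw [funext hκ]
    exact ((hcoord hγ1 0).mul (hcoord hγ2 1)).sub ((hcoord hγ1 1).mul (hcoord hγ2 0))
  obtain ⟨hκd, hκ1⟩ := contDiff_infty_iff_deriv.1 hκs
  have hκd1 := (contDiff_infty_iff_deriv.1 hκ1).1
  have hd := (contDiff_infty_iff_deriv.1 hγ).1
  have hd1 := (contDiff_infty_iff_deriv.1 hγ1).1
  have hu : ∀ s ∈ Set.Icc (0 : ℝ) L, deriv γ s 0 ^ 2 + deriv γ s 1 ^ 2 = 1 := fun s hs => by
    have h := EuclideanSpace.real_norm_sq_eq (deriv γ s)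
    rw [hunit s hs, Fin.sum_univ_two] at h
    linarith
  rw [hW, willmore_energy_coord hL (hasDerivAt_coord hd 0) (hasDerivAt_coord hd 1)
    (hasDerivAt_coord hd1 0) (hasDerivAt_coord hd1 1) (fun s => (hκd s).hasDerivAt)
    (fun s => (hκd1 s).hasDerivAt) hu hκ hode, EuclideanSpace.real_norm_sq_eq, Fin.sum_univ_two]
  simp only [PiLp.sub_apply]
end

section
/- Let L > 0 and let γ : [0,L] → ℝ² be a smooth unit-speed curve whose curvature κ(s) := det(γ'(s), γ''(s)) satisfies 2κ''(s) = −κ(s)³ for all s ∈ [0,L]. Then γ(L) ≠ γ(0). In other words, there are no closed Willmore curves in the plane. -/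
open Set Filter Topology

/-- A function that is continuous on `[l, r]` and has zero derivative on `(l, r)` is constant on
`[l, r]`. -/
theorem eq_left_of_hasDerivAt_zero_s6 {f : ℝ → ℝ} {l r : ℝ} (hf : ContinuousOn f (Icc l r))
    (hf' : ∀ x ∈ Ioo l r, HasDerivAt f 0 x) : ∀ x ∈ Icc l r, f x = f l := by
  intro x hx
  rcases hx.1.eq_or_lt with rfl | hlx
  · rfl
  obtain ⟨c, -, hc⟩ := exists_hasDerivAt_eq_slope f (fun _ => 0) hlx
    (hf.mono (Icc_subset_Icc_right hx.2)) fun y hy => hf' y ⟨hy.1, hy.2.trans_le hx.2⟩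
  rw [eq_comm, div_eq_zero_iff] at hc
  rcases hc with hc | hc <;> linarith

/-- A function with nonnegative derivative on `(l, r)` that takes the same value at both ends has
zero derivative on `(l, r)`. -/
theorem deriv_eq_zero_of_nonneg_of_eq {f g : ℝ → ℝ} {l r : ℝ} (hf : ContinuousOn f (Icc l r))
    (hf' : ∀ x ∈ Ioo l r, HasDerivAt f (g x) x) (hg : ∀ x ∈ Ioo l r, 0 ≤ g x)
    (hlr : f r = f l) : ∀ x ∈ Ioo l r, g x = 0 := by
  have hmono : MonotoneOn f (Icc l r) := by
    refine monotoneOn_of_deriv_nonneg (convex_Icc l r) hf ?_ ?_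
    · rw [interior_Icc]
      exact fun x hx => (hf' x hx).differentiableAt.differentiableWithinAt
    · rw [interior_Icc]
      exact fun x hx => (hf' x hx).deriv ▸ hg x hx
  intro x hx
  have hconst : f =ᶠ[𝓝 x] fun _ => f l := by
    filter_upwards [Ioo_mem_nhds hx.1 hx.2] with y hy
    have hle : l ≤ r := (hx.1.trans hx.2).le
    refine le_antisymm ?_ (hmono (left_mem_Icc.2 hle) (Ioo_subset_Icc_self hy) hy.1.le)
    exact hlr ▸ hmono (Ioo_subset_Icc_self hy) (right_mem_Icc.2 hle) hy.2.le
  exact (hf' x hx).unique ((hasDerivAt_const x (f l)).congr_of_eventuallyEq hconst)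

/-- If the unit tangent `(p, q)` of the plane curve `(a, b)` rotates with speed `k` satisfying
`2k'' = -k³`, then the curve is not closed: the vector `k² T + 2k' N` is conserved, and its inner
product with the tangent is `k²`, which forces a closed curve to be straight. -/
theorem not_closed_of_frenet {L : ℝ} (hL : 0 < L) {a b p q k k' : ℝ → ℝ}
    (ha : ∀ s, HasDerivAt a (p s) s) (hb : ∀ s, HasDerivAt b (q s) s)
    (hpc : Continuous p) (hqc : Continuous q) (hk'c : Continuous k')
    (hp : ∀ s ∈ Ioo 0 L, HasDerivAt p (-(k s * q s)) s)
    (hq : ∀ s ∈ Ioo 0 L, HasDerivAt q (k s * p s) s)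
    (hunit : ∀ s ∈ Icc 0 L, p s ^ 2 + q s ^ 2 = 1)
    (hk : ∀ s, HasDerivAt k (k' s) s)
    (hk' : ∀ s ∈ Ioo 0 L, HasDerivAt k' (-(k s) ^ 3 / 2) s) :
    ¬ (a L = a 0 ∧ b L = b 0) := by
  rintro ⟨hab, hbb⟩
  have hac : Continuous a := continuous_iff_continuousAt.2 fun s => (ha s).continuousAt
  have hbc : Continuous b := continuous_iff_continuousAt.2 fun s => (hb s).continuousAt
  have hkc : Continuous k := continuous_iff_continuousAt.2 fun s => (hk s).continuousAt
  have hL' : L ∈ Icc 0 L := right_mem_Icc.2 hL.le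
  have hV := eq_left_of_hasDerivAt_zero_s6 (f := fun s => k s ^ 2 * p s - 2 * k' s * q s)
    (l := 0) (r := L) (by fun_prop) fun s hs => by
      refine ((((hk s).pow 2).mul (hp s hs)).sub
        (((hk' s hs).const_mul 2).mul (hq s hs))).congr_deriv ?_
      simp
      ring
  have hW := eq_left_of_hasDerivAt_zero_s6 (f := fun s => k s ^ 2 * q s + 2 * k' s * p s)
    (l := 0) (r := L) (by fun_prop) fun s hs => by
      refine ((((hk s).pow 2).mul (hq s hs)).add
        (((hk' s hs).const_mul 2).mul (hp s hs))).congr_deriv ?_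
      simp
      ring
  generalize k 0 ^ 2 * p 0 - 2 * k' 0 * q 0 = v at hV
  generalize k 0 ^ 2 * q 0 + 2 * k' 0 * p 0 = w at hW
  have hsq : ∀ s ∈ Ioo 0 L, k s ^ 2 = 0 := by
    refine deriv_eq_zero_of_nonneg_of_eq (f := fun s => v * a s + w * b s) (by fun_prop)
      (fun s hs => ?_) (fun s _ => sq_nonneg _) (by simp only [hab, hbb])
    refine (((ha s).const_mul v).add ((hb s).const_mul w)).congr_deriv ?_
    have hs' := Ioo_subset_Icc_self hs
    rw [← hV s hs', ← hW s hs']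
    linear_combination k s ^ 2 * hunit s hs'
  have hk0 : ∀ s ∈ Ioo 0 L, k s = 0 := fun s hs => pow_eq_zero_iff two_ne_zero |>.1 (hsq s hs)
  have hp0 := eq_left_of_hasDerivAt_zero_s6 (l := 0) (r := L) hpc.continuousOn
    fun s hs => by simpa [hk0 s hs] using hp s hs
  have hq0 := eq_left_of_hasDerivAt_zero_s6 (l := 0) (r := L) hqc.continuousOn
    fun s hs => by simpa [hk0 s hs] using hq s hs
  have hzero : ∀ {f g : ℝ → ℝ}, Continuous f → (∀ s, HasDerivAt f (g s) s) →
      (∀ s ∈ Icc 0 L, g s = g 0) → f L = f 0 → g 0 = 0 := by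
    intro f g hf hfg hg hclosed
    have h := eq_left_of_hasDerivAt_zero_s6 (f := fun s => f s - g 0 * s) (l := 0) (r := L)
      (by fun_prop) (fun s hs => by
        refine ((hfg s).sub ((hasDerivAt_id s).const_mul (g 0))).congr_deriv ?_
        rw [hg s (Ioo_subset_Icc_self hs)]
        ring) L hL'
    simp only [hclosed, mul_zero, sub_zero, sub_eq_self, mul_eq_zero, hL.ne', or_false] at h
    exact h
  have h1 := hunit 0 (left_mem_Icc.2 hL.le)
  rw [hzero hac ha hp0 hab, hzero hbc hb hq0 hbb] at h1
  norm_num at h1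

/-- There are no closed Willmore curves in the plane: a smooth unit-speed curve on `[0,L]`
whose curvature satisfies `2κ'' = −κ³` has `γ(L) ≠ γ(0)`. -/
theorem no_closed_willmore_curves
    (L : ℝ) (hL : 0 < L) (γ : ℝ → EuclideanSpace ℝ (Fin 2))
    (hγ : ContDiff ℝ (⊤ : ℕ∞) γ)
    (hunit : ∀ s ∈ Set.Icc (0 : ℝ) L, ‖deriv γ s‖ = 1)
    (κ : ℝ → ℝ) (hκ : ∀ s, κ s = signedCurvature γ s)
    (hode : ∀ s ∈ Set.Icc (0 : ℝ) L, 2 * deriv (deriv κ) s = -(κ s) ^ 3) :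
    γ L ≠ γ 0 := by
  intro hclosed
  have hγ1 : ContDiff ℝ (⊤ : ℕ∞) (deriv γ) := (contDiff_infty_iff_deriv.1 hγ).2
  have hγ2 : ContDiff ℝ (⊤ : ℕ∞) (deriv (deriv γ)) := (contDiff_infty_iff_deriv.1 hγ1).2
  have hcoord : ∀ {f : ℝ → EuclideanSpace ℝ (Fin 2)}, ContDiff ℝ (⊤ : ℕ∞) f → ∀ i,
      ContDiff ℝ (⊤ : ℕ∞) fun s => f s i := fun hf i => contDiff_euclidean.1 hf i
  have hcoordDeriv : ∀ {f : ℝ → EuclideanSpace ℝ (Fin 2)}, ContDiff ℝ (⊤ : ℕ∞) f → ∀ i s,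
      HasDerivAt (fun s => f s i) (deriv f s i) s := fun {f} hf i s =>
    (EuclideanSpace.proj (𝕜 := ℝ) i).hasFDerivAt.comp_hasDerivAt s
      ((contDiff_infty_iff_deriv.1 hf).1 s).hasDerivAt
  have hκs : ContDiff ℝ (⊤ : ℕ∞) κ := by
    rw [show κ = signedCurvature γ from funext hκ]
    exact ((hcoord hγ1 0).mul (hcoord hγ2 1)).sub ((hcoord hγ1 1).mul (hcoord hγ2 0))
  have hκ1 : ContDiff ℝ (⊤ : ℕ∞) (deriv κ) := (contDiff_infty_iff_deriv.1 hκs).2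
  have hsq : ∀ s ∈ Icc 0 L, deriv γ s 0 ^ 2 + deriv γ s 1 ^ 2 = 1 := by
    intro s hs
    have h := EuclideanSpace.real_norm_sq_eq (deriv γ s)
    rw [hunit s hs, Fin.sum_univ_two] at h
    linarith
  have horth : ∀ s ∈ Ioo 0 L,
      deriv γ s 0 * deriv (deriv γ) s 0 + deriv γ s 1 * deriv (deriv γ) s 1 = 0 := by
    intro s hs
    have hconst : (fun s => deriv γ s 0 ^ 2 + deriv γ s 1 ^ 2) =ᶠ[𝓝 s] fun _ => 1 := by
      filter_upwards [Ioo_mem_nhds hs.1 hs.2] with y hy using hsq y (Ioo_subset_Icc_self hy)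
    have h := (((hcoordDeriv hγ1 0 s).pow 2).add ((hcoordDeriv hγ1 1 s).pow 2)).unique
      ((hasDerivAt_const s (1 : ℝ)).congr_of_eventuallyEq hconst)
    simp at h
    linarith
  refine not_closed_of_frenet hL (k := κ) (k' := deriv κ) (hcoordDeriv hγ 0) (hcoordDeriv hγ 1)
    (hcoord hγ1 0).continuous (hcoord hγ1 1).continuous hκ1.continuous
    (fun s hs => (hcoordDeriv hγ1 0 s).congr_deriv ?_)
    (fun s hs => (hcoordDeriv hγ1 1 s).congr_deriv ?_) hsq
    (fun s => ((contDiff_infty_iff_deriv.1 hκs).1 s).hasDerivAt)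
    (fun s hs => ((contDiff_infty_iff_deriv.1 hκ1).1 s).hasDerivAt.congr_deriv ?_)
    ⟨by rw [hclosed], by rw [hclosed]⟩
  · rw [hκ, signedCurvature]
    linear_combination deriv γ s 0 * horth s hs
      - deriv (deriv γ) s 0 * hsq s (Ioo_subset_Icc_self hs)
  · rw [hκ, signedCurvature]
    linear_combination deriv γ s 1 * horth s hs
      - deriv (deriv γ) s 1 * hsq s (Ioo_subset_Icc_self hs)
  · linarith [hode s (Ioo_subset_Icc_self hs)]
end

section
/- Let y : ℝ → ℝ be twice differentiable with 2y''(s) = −y(s)³ for all s ∈ ℝ and (y(0), y'(0)) ≠ (0,0). Set a := (y'(0)² + y(0)⁴/4)^{1/4} > 0 and T := 4∫₀¹ √(2/(1−t⁴)) dt. Then y is periodic with period T/a, i.e. y(s + T/a) = y(s) for all s ∈ ℝ; moreover sup_{s∈ℝ} y(s) = √2·a and inf_{s∈ℝ} y(s) = −√2·a, and both values are attained. -/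
open Set MeasureTheory

/-- The integrand of the quarter period; it vanishes outside `[-1, 1]`. -/
noncomputable def lemniscateIntegrand (t : ℝ) : ℝ := Real.sqrt (2 / (1 - t ^ 4))

/-- The primitive of `lemniscateIntegrand` vanishing at the origin. -/
noncomputable def lemniscateArc (x : ℝ) : ℝ := ∫ t in (0 : ℝ)..x, lemniscateIntegrand t

lemma lemniscateIntegrand_nonneg (t : ℝ) : 0 ≤ lemniscateIntegrand t := Real.sqrt_nonneg _

lemma measurable_lemniscateIntegrand : Measurable lemniscateIntegrand := by
  unfold lemniscateIntegrand
  fun_prop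

lemma lemniscateIntegrand_le_arcsin_deriv (t : ℝ) :
    lemniscateIntegrand t ≤ Real.sqrt 2 * (1 / Real.sqrt (1 - t ^ 2)) := by
  unfold lemniscateIntegrand
  rw [mul_one_div, ← Real.sqrt_div zero_le_two]
  rcases lt_or_ge (t ^ 2) 1 with h | h
  · apply Real.sqrt_le_sqrt
    apply div_le_div_of_nonneg_left <;> nlinarith [sq_nonneg t]
  · rw [Real.sqrt_eq_zero_of_nonpos]
    · exact Real.sqrt_nonneg _
    · exact div_nonpos_of_nonneg_of_nonpos zero_le_two (by nlinarith)

lemma lemniscateIntegrand_eq_zero {t : ℝ} (h : 1 ≤ t ^ 2) : lemniscateIntegrand t = 0 := by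
  unfold lemniscateIntegrand
  exact Real.sqrt_eq_zero_of_nonpos
    (div_nonpos_of_nonneg_of_nonpos zero_le_two (by nlinarith))

lemma integrable_lemniscateIntegrand : Integrable lemniscateIntegrand := by
  have h1 : IntegrableOn (fun t : ℝ => 1 / Real.sqrt (1 - t ^ 2)) (Ioc (-1) 1) := by
    apply intervalIntegral.integrableOn_deriv_of_nonneg (g := Real.arcsin)
    · exact Real.continuous_arcsin.continuousOn
    · intro x hx
      exact Real.hasDerivAt_arcsin hx.1.ne' hx.2.ne
    · intro x _
      positivity
  have h2 : IntegrableOn lemniscateIntegrand (Ioc (-1) 1) := by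
    refine (h1.const_mul (Real.sqrt 2)).mono'
      measurable_lemniscateIntegrand.aestronglyMeasurable (ae_of_all _ fun t => ?_)
    rw [Real.norm_of_nonneg (lemniscateIntegrand_nonneg t)]
    exact lemniscateIntegrand_le_arcsin_deriv t
  refine (integrableOn_iff_integrable_of_support_subset fun t ht => ?_).1 h2
  by_contra hmem
  refine ht (lemniscateIntegrand_eq_zero ?_)
  by_contra! hlt
  exact hmem ⟨by nlinarith, by nlinarith⟩

lemma continuous_lemniscateArc : Continuous lemniscateArc :=
  integrable_lemniscateIntegrand.continuous_primitive 0

lemma monotone_lemniscateArc : Monotone lemniscateArc := by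
  intro x z hxz
  have h := intervalIntegral.integral_interval_sub_left
    (integrable_lemniscateIntegrand.intervalIntegrable (a := 0) (b := z))
    (integrable_lemniscateIntegrand.intervalIntegrable (a := 0) (b := x))
  have h0 := intervalIntegral.integral_nonneg (μ := volume) hxz
    (fun t _ => lemniscateIntegrand_nonneg t)
  unfold lemniscateArc
  linarith

lemma lemniscateArc_zero : lemniscateArc 0 = 0 := intervalIntegral.integral_same

lemma hasDerivAt_lemniscateArc {x : ℝ} (hx : x ^ 4 < 1) :
    HasDerivAt lemniscateArc (lemniscateIntegrand x) x := by
  refine intervalIntegral.integral_hasDerivAt_right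
    integrable_lemniscateIntegrand.intervalIntegrable
    measurable_lemniscateIntegrand.stronglyMeasurable.stronglyMeasurableAtFilter ?_
  unfold lemniscateIntegrand
  refine Real.continuous_sqrt.continuousAt.comp (ContinuousAt.div (by fun_prop) (by fun_prop) ?_)
  linarith

/-- `u` solves `u'' = -u³` with derivative `v`, on the energy level `u⁴ + 2 v² = 1`. -/
structure IsUnitWillmoreSolution (u v : ℝ → ℝ) : Prop where
  hasDerivAt_fst : ∀ s, HasDerivAt u (v s) s
  hasDerivAt_snd : ∀ s, HasDerivAt v (-(u s) ^ 3) s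
  energy : ∀ s, u s ^ 4 + 2 * v s ^ 2 = 1

namespace IsUnitWillmoreSolution

variable {u v : ℝ → ℝ}

lemma neg (h : IsUnitWillmoreSolution u v) :
    IsUnitWillmoreSolution (fun s => -u s) (fun s => -v s) where
  hasDerivAt_fst s := (h.hasDerivAt_fst s).fun_neg
  hasDerivAt_snd s := (h.hasDerivAt_snd s).fun_neg.congr_deriv (by ring)
  energy s := by linear_combination h.energy s

lemma comp_const_add (h : IsUnitWillmoreSolution u v) (c : ℝ) :
    IsUnitWillmoreSolution (fun s => u (c + s)) (fun s => v (c + s)) where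
  hasDerivAt_fst s := (h.hasDerivAt_fst (c + s)).comp_const_add c s
  hasDerivAt_snd s := (h.hasDerivAt_snd (c + s)).comp_const_add c s
  energy s := h.energy (c + s)

lemma comp_const_sub (h : IsUnitWillmoreSolution u v) (c : ℝ) :
    IsUnitWillmoreSolution (fun s => u (c - s)) (fun s => -v (c - s)) where
  hasDerivAt_fst s := (h.hasDerivAt_fst (c - s)).comp_const_sub c s
  hasDerivAt_snd s := ((h.hasDerivAt_snd (c - s)).comp_const_sub c s).fun_neg.congr_deriv (by ring)
  energy s := by linear_combination h.energy (c - s)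

lemma sq_le_one (h : IsUnitWillmoreSolution u v) (s : ℝ) : u s ^ 2 ≤ 1 := by
  nlinarith [h.energy s, sq_nonneg (v s), sq_nonneg (u s)]

lemma mem_Icc (h : IsUnitWillmoreSolution u v) (s : ℝ) : u s ∈ Icc (-1 : ℝ) 1 :=
  abs_le.1 ((sq_le_one_iff_abs_le_one _).1 (h.sq_le_one s))

lemma continuous_fst (h : IsUnitWillmoreSolution u v) : Continuous u :=
  continuous_iff_continuousAt.2 fun s => (h.hasDerivAt_fst s).continuousAt

lemma continuous_snd (h : IsUnitWillmoreSolution u v) : Continuous v :=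
  continuous_iff_continuousAt.2 fun s => (h.hasDerivAt_snd s).continuousAt

lemma lipschitzOnWith_vectorField :
    LipschitzOnWith 3 (fun p : ℝ × ℝ => (p.2, -p.1 ^ 3)) (Icc (-1 : ℝ) 1 ×ˢ univ) := by
  refine LipschitzOnWith.of_dist_le_mul fun p hp q hq => ?_
  obtain ⟨p1, p2⟩ := p
  obtain ⟨q1, q2⟩ := q
  have hp1 : p1 ∈ Icc (-1 : ℝ) 1 := hp.1
  have hq1 : q1 ∈ Icc (-1 : ℝ) 1 := hq.1
  have h1 : |p1 - q1| ≤ max |p1 - q1| |p2 - q2| := le_max_left _ _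
  have h2 : |p2 - q2| ≤ max |p1 - q1| |p2 - q2| := le_max_right _ _
  have h0 := abs_nonneg (p2 - q2)
  simp only [Prod.dist_eq, Real.dist_eq, NNReal.coe_ofNat]
  refine max_le (by linarith) ?_
  have hfac : -p1 ^ 3 - -q1 ^ 3 = -((p1 ^ 2 + p1 * q1 + q1 ^ 2) * (p1 - q1)) := by ring
  have hquad : |p1 ^ 2 + p1 * q1 + q1 ^ 2| ≤ 3 := by
    rw [abs_le]
    constructor <;> nlinarith [hp1.1, hp1.2, hq1.1, hq1.2, sq_nonneg (p1 + q1), sq_nonneg (p1 - q1)]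
  rw [hfac, abs_neg, abs_mul]
  exact mul_le_mul hquad h1 (abs_nonneg _) (by norm_num)

lemma eq_of_eq_zero {u₁ v₁ : ℝ → ℝ} (h : IsUnitWillmoreSolution u v)
    (h₁ : IsUnitWillmoreSolution u₁ v₁) (hu : u 0 = u₁ 0) (hv : v 0 = v₁ 0) : u = u₁ := by
  have key : (fun s => (u s, v s)) = fun s => (u₁ s, v₁ s) :=
    ODE_solution_unique_univ (v := fun _ p => (p.2, -p.1 ^ 3))
      (s := fun _ => Icc (-1 : ℝ) 1 ×ˢ univ) (K := 3) (t₀ := 0)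
      (fun _ => lipschitzOnWith_vectorField)
      (fun s => ⟨(h.hasDerivAt_fst s).prodMk (h.hasDerivAt_snd s), h.mem_Icc s, mem_univ _⟩)
      (fun s => ⟨(h₁.hasDerivAt_fst s).prodMk (h₁.hasDerivAt_snd s), h₁.mem_Icc s, mem_univ _⟩)
      (by simp [hu, hv])
  funext s
  exact congrArg Prod.fst (congrFun key s)

lemma hasDerivAt_lemniscateArc_comp (h : IsUnitWillmoreSolution u v) {s : ℝ} (hv : v s ≠ 0) :
    HasDerivAt (fun s => lemniscateArc (u s)) (v s / |v s|) s := by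
  have hpos : 0 < v s ^ 2 := by positivity
  have hu : u s ^ 4 < 1 := by linarith [h.energy s]
  refine ((hasDerivAt_lemniscateArc hu).comp s (h.hasDerivAt_fst s)).congr_deriv ?_
  have : 2 / (1 - u s ^ 4) = (|v s|⁻¹) ^ 2 := by
    rw [show 1 - u s ^ 4 = 2 * v s ^ 2 by linarith [h.energy s], inv_pow, sq_abs]
    field_simp
  rw [lemniscateIntegrand, this, Real.sqrt_sq (by positivity)]
  ring

lemma not_forall_snd_pos (h : IsUnitWillmoreSolution u v) : ¬ ∀ s, 0 < v s := by
  intro hpos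
  set B := lemniscateArc 1 - lemniscateArc (-1) with hB
  have hB0 : 0 ≤ B := sub_nonneg.2 (monotone_lemniscateArc (by norm_num))
  obtain ⟨c, -, hc⟩ := exists_hasDerivAt_eq_slope (fun s => lemniscateArc (u s))
    (fun s => v s / |v s|) (a := 0) (b := B + 1) (by linarith)
    (continuous_lemniscateArc.comp h.continuous_fst).continuousOn
    (fun s _ => h.hasDerivAt_lemniscateArc_comp (hpos s).ne')
  rw [abs_of_pos (hpos c), div_self (hpos c).ne', eq_div_iff (by linarith)] at hc
  have h1 := monotone_lemniscateArc (h.mem_Icc (B + 1)).2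
  have h2 := monotone_lemniscateArc (h.mem_Icc 0).1
  linarith

lemma exists_snd_eq_zero (h : IsUnitWillmoreSolution u v) : ∃ s, v s = 0 := by
  obtain ⟨s, hs⟩ := not_forall.1 h.not_forall_snd_pos
  obtain ⟨r, hr⟩ := not_forall.1 h.neg.not_forall_snd_pos
  exact mem_range_of_exists_le_of_exists_ge h.continuous_snd ⟨s, by linarith⟩ ⟨r, by linarith⟩

lemma lemniscateArc_eq_sub (h : IsUnitWillmoreSolution u v) (hu0 : u 0 = 1) (hv0 : v 0 = 0)
    {τ : ℝ} (hτ : 0 < τ) (hpos : ∀ s ∈ Ioo 0 τ, 0 < u s) :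
    lemniscateArc (u τ) = lemniscateArc 1 - τ := by
  have hanti : StrictAntiOn v (Icc 0 τ) := by
    refine strictAntiOn_of_deriv_neg (convex_Icc 0 τ) h.continuous_snd.continuousOn fun s hs => ?_
    rw [interior_Icc] at hs
    rw [(h.hasDerivAt_snd s).deriv]
    have := pow_pos (hpos s hs) 3
    linarith
  have hneg : ∀ s ∈ Ioo 0 τ, v s < 0 := fun s hs =>
    hv0 ▸ hanti (left_mem_Icc.2 hτ.le) (Ioo_subset_Icc_self hs) hs.1
  obtain ⟨c, hcmem, hc⟩ := exists_hasDerivAt_eq_slope (fun s => lemniscateArc (u s))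
    (fun s => v s / |v s|) hτ
    (continuous_lemniscateArc.comp h.continuous_fst).continuousOn
    (fun s hs => h.hasDerivAt_lemniscateArc_comp (hneg s hs).ne)
  rw [abs_of_neg (hneg c hcmem), div_neg, div_self (hneg c hcmem).ne, eq_div_iff (by linarith),
    hu0] at hc
  linarith

lemma fst_quarter_period (h : IsUnitWillmoreSolution u v) (hu0 : u 0 = 1) (hv0 : v 0 = 0) :
    u (lemniscateArc 1) = 0 := by
  have hQ : 0 ≤ lemniscateArc 1 := lemniscateArc_zero ▸ monotone_lemniscateArc zero_le_one
  have hsign : ∀ t, 0 ≤ t → u t ≤ 0 → ∃ r ∈ Icc 0 t, u r = 0 := fun t ht hut =>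
    intermediate_value_Icc' ht h.continuous_fst.continuousOn ⟨hut, hu0 ▸ zero_le_one⟩
  let Z : Set ℝ := Ici 0 ∩ u ⁻¹' {0}
  have hne : Z.Nonempty := by
    by_contra hemp
    have hall : ∀ t, 0 ≤ t → 0 < u t := by
      intro t ht
      by_contra! hut
      obtain ⟨r, hr, hur⟩ := hsign t ht hut
      exact hemp ⟨r, hr.1, hur⟩
    have h1 := h.lemniscateArc_eq_sub hu0 hv0 (τ := lemniscateArc 1 + 1) (by linarith)
      (fun s hs => hall s hs.1.le)
    have h2 := monotone_lemniscateArc (hall (lemniscateArc 1 + 1) (by linarith)).le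
    rw [lemniscateArc_zero] at h2
    linarith
  have hclosed : IsClosed Z := isClosed_Ici.inter (isClosed_singleton.preimage h.continuous_fst)
  have hbdd : BddBelow Z := ⟨0, fun s hs => hs.1⟩
  obtain ⟨hz0, hz⟩ := hclosed.csInf_mem hne hbdd
  have hz : u (sInf Z) = 0 := hz
  have hzpos : 0 < sInf Z := lt_of_le_of_ne hz0 fun he => by
    rw [← he, hu0] at hz
    exact one_ne_zero hz
  have h1 := h.lemniscateArc_eq_sub hu0 hv0 hzpos fun s hs => by
    by_contra! hus
    obtain ⟨r, hr, hur⟩ := hsign s hs.1.le hus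
    have := csInf_le hbdd (show r ∈ Z from ⟨hr.1, hur⟩)
    linarith [hr.2, hs.2]
  rw [hz, lemniscateArc_zero] at h1
  rwa [show lemniscateArc 1 = sInf Z by linarith]

lemma antiperiodic_of_fst_zero (h : IsUnitWillmoreSolution u v) (hu0 : u 0 = 1) (hv0 : v 0 = 0) :
    Function.Antiperiodic u (2 * lemniscateArc 1) := by
  have heven := h.eq_of_eq_zero (h.comp_const_sub 0) (by simp) (by simp [hv0])
  have hodd := (h.comp_const_add (lemniscateArc 1)).eq_of_eq_zero
    (h.comp_const_sub (lemniscateArc 1)).neg (by simp [h.fst_quarter_period hu0 hv0]) (by simp)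
  intro s
  have h1 := congrFun hodd (lemniscateArc 1 + s)
  have h2 := congrFun heven s
  rw [h2, show s + 2 * lemniscateArc 1 = lemniscateArc 1 + (lemniscateArc 1 + s) by ring, h1]
  congr 2
  ring

lemma fst_eq_one_or_neg_one (h : IsUnitWillmoreSolution u v) {c : ℝ} (hc : v c = 0) :
    u c = 1 ∨ u c = -1 := by
  have hE := h.energy c
  rw [hc] at hE
  exact mul_self_eq_one_iff.1 (by nlinarith [mul_self_nonneg (u c)])

lemma antiperiodic (h : IsUnitWillmoreSolution u v) :
    Function.Antiperiodic u (2 * lemniscateArc 1) := by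
  obtain ⟨c, hc⟩ := h.exists_snd_eq_zero
  intro s
  rcases h.fst_eq_one_or_neg_one hc with h1 | h1
  · have := (h.comp_const_add c).antiperiodic_of_fst_zero (by simpa) (by simpa) (s - c)
    simpa [← add_assoc] using this
  · have := (h.comp_const_add c).neg.antiperiodic_of_fst_zero (by simp [h1]) (by simpa) (s - c)
    simpa [← add_assoc, neg_eq_iff_eq_neg] using this

lemma exists_fst_eq_one (h : IsUnitWillmoreSolution u v) : ∃ s, u s = 1 := by
  obtain ⟨c, hc⟩ := h.exists_snd_eq_zero
  rcases h.fst_eq_one_or_neg_one hc with h1 | h1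
  · exact ⟨c, h1⟩
  · exact ⟨c + 2 * lemniscateArc 1, by rw [h.antiperiodic c, h1, neg_neg]⟩

end IsUnitWillmoreSolution

lemma willmore_energy_eq {y : ℝ → ℝ} (hy1 : Differentiable ℝ y)
    (hy2 : Differentiable ℝ (deriv y))
    (hode : ∀ s : ℝ, 2 * deriv (deriv y) s = -(y s) ^ 3) (s : ℝ) :
    deriv y s ^ 2 + y s ^ 4 / 4 = deriv y 0 ^ 2 + y 0 ^ 4 / 4 := by
  have hd : ∀ r, HasDerivAt (fun r => deriv y r ^ 2 + y r ^ 4 / 4) 0 r := fun r => by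
    refine (((hy2 r).hasDerivAt.fun_pow 2).add
      (((hy1 r).hasDerivAt.fun_pow 4).div_const 4)).congr_deriv ?_
    norm_num
    linear_combination deriv y r * hode r
  exact is_const_of_deriv_eq_zero (fun r => (hd r).differentiableAt) (fun r => (hd r).deriv) s 0

lemma isUnitWillmoreSolution_rescale {y : ℝ → ℝ} (hy1 : Differentiable ℝ y)
    (hy2 : Differentiable ℝ (deriv y))
    (hode : ∀ s : ℝ, 2 * deriv (deriv y) s = -(y s) ^ 3) {a : ℝ} (ha : 0 < a)
    (hE : ∀ s, deriv y s ^ 2 + y s ^ 4 / 4 = a ^ 4) :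
    IsUnitWillmoreSolution (fun s => y (s / a) / (Real.sqrt 2 * a))
      (fun s => deriv y (s / a) / (Real.sqrt 2 * a ^ 2)) := by
  have h2 : Real.sqrt 2 ^ 2 = 2 := Real.sq_sqrt zero_le_two
  have h20 : Real.sqrt 2 ≠ 0 := by positivity
  have hdiv : ∀ s, HasDerivAt (fun s : ℝ => s / a) (1 / a) s := fun s =>
    (hasDerivAt_id s).div_const a
  refine ⟨fun s => ?_, fun s => ?_, fun s => ?_⟩
  · refine (((hy1 (s / a)).hasDerivAt.comp s (hdiv s)).div_const _).congr_deriv ?_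
    field_simp
  · refine (((hy2 (s / a)).hasDerivAt.comp s (hdiv s)).div_const _).congr_deriv ?_
    have h3 := hode (s / a)
    field_simp
    rw [h2]
    linarith
  · have h4 : Real.sqrt 2 ^ 4 = 4 := by rw [show 4 = 2 * 2 from rfl, pow_mul, h2]; norm_num
    rw [div_pow, div_pow, mul_pow, mul_pow, h2, h4]
    have h3 := hE (s / a)
    field_simp
    linarith

/-- Every nontrivial solution of the Willmore ODE `2y'' = −y³` on `ℝ` is periodic with
period `T/a`, where `a := (y'(0)² + y(0)⁴/4)^(1/4)` and `T := 4∫₀¹ √(2/(1−t⁴)) dt`;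
moreover its maximal value is `√2·a` and its minimal value is `−√2·a`, both attained. -/
theorem willmore_ode_solutions_periodic
    (y : ℝ → ℝ)
    (hy1 : Differentiable ℝ y) (hy2 : Differentiable ℝ (deriv y))
    (hode : ∀ s : ℝ, 2 * deriv (deriv y) s = -(y s) ^ 3)
    (hnontriv : (y 0, deriv y 0) ≠ (0, 0))
    (a T : ℝ)
    (ha : a = (deriv y 0 ^ 2 + y 0 ^ 4 / 4) ^ ((1 : ℝ) / 4))
    (hT : T = 4 * ∫ t in (0 : ℝ)..1, Real.sqrt (2 / (1 - t ^ 4))) :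
    (∀ s : ℝ, y (s + T / a) = y s) ∧
      IsGreatest (Set.range y) (Real.sqrt 2 * a) ∧
      IsLeast (Set.range y) (-(Real.sqrt 2 * a)) := by
  have hEpos : 0 < deriv y 0 ^ 2 + y 0 ^ 4 / 4 := by
    by_cases h0 : y 0 = 0
    · have h1 : deriv y 0 ≠ 0 := fun h1 => hnontriv (by rw [h0, h1])
      positivity
    · positivity
  have ha0 : 0 < a := ha ▸ Real.rpow_pos_of_pos hEpos _
  have ha4 : a ^ 4 = deriv y 0 ^ 2 + y 0 ^ 4 / 4 := by
    rw [ha, ← Real.rpow_natCast, ← Real.rpow_mul hEpos.le]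
    norm_num
  have hsol := isUnitWillmoreSolution_rescale hy1 hy2 hode ha0
    (fun s => (willmore_energy_eq hy1 hy2 hode s).trans ha4.symm)
  have hc : 0 < Real.sqrt 2 * a := by positivity
  have hy : ∀ s, y s = Real.sqrt 2 * a * (y (a * s / a) / (Real.sqrt 2 * a)) := fun s => by
    rw [mul_div_cancel_left₀ s ha0.ne', mul_div_cancel₀ _ hc.ne']
  have hT' : T = 2 * (2 * lemniscateArc 1) := by
    rw [hT, ← mul_assoc]
    norm_num [lemniscateArc, lemniscateIntegrand]
  refine ⟨fun s => ?_, ⟨?_, ?_⟩, ⟨?_, ?_⟩⟩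
  · have hper := hsol.antiperiodic.periodic_two_mul (a * s)
    simp only [← hT'] at hper
    rw [hy (s + T / a), hy s, ← hper, mul_add, mul_div_cancel₀ T ha0.ne']
  · obtain ⟨s, hs⟩ := hsol.exists_fst_eq_one
    exact ⟨s / a, (div_eq_one_iff_eq hc.ne').1 hs⟩
  · rintro _ ⟨s, rfl⟩
    have := (hsol.mem_Icc (a * s)).2
    rw [hy s]
    nlinarith
  · obtain ⟨s, hs⟩ := hsol.neg.exists_fst_eq_one
    refine ⟨s / a, ?_⟩
    rw [neg_eq_iff_eq_neg, div_eq_iff hc.ne'] at hs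
    linarith
  · rintro _ ⟨s, rfl⟩
    have := (hsol.mem_Icc (a * s)).1
    rw [hy s]
    nlinarith
end

section
/- Let C := ∫₀¹ 4t²/√(1−t⁴) dt and, for each integer k ≥ 0, let M_k := sup_{z ∈ [0,1]} 2z·(kC + 2∫_z¹ t²/√(1−t⁴) dt). Then 2kC < M_k < 2(k+1)C for every integer k ≥ 0; in particular 0 < M₀ < 2C < M₁ < 4C < M₂ < ⋯. -/
open MeasureTheory intervalIntegral

theorem intervalIntegrable_sq_div_sqrt_one_sub_pow_four :
    IntervalIntegrable (fun t : ℝ => t ^ 2 / Real.sqrt (1 - t ^ 4)) volume 0 1 := by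
  have h : IntervalIntegrable (fun t : ℝ => (1 - t) ^ (-(1 / 2) : ℝ)) volume 0 1 := by
    simpa using (((intervalIntegrable_rpow' (a := 0) (b := 1) (r := -(1 / 2))
      (by norm_num)).comp_sub_left 1).symm)
  refine h.mono_fun'
    (Measurable.aestronglyMeasurable (by fun_prop)) ?_
  rw [Set.uIoc_of_le zero_le_one]
  refine (ae_restrict_iff' measurableSet_Ioc).2 (.of_forall fun t ht => ?_)
  obtain ⟨h0, h1⟩ := ht
  dsimp only
  rw [Real.norm_of_nonneg (by positivity)]
  rcases h1.eq_or_lt with rfl | h1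
  · norm_num
  have hs : 0 < 1 - t := sub_pos.2 h1
  have h2 : t ^ 2 ≤ 1 := pow_le_one₀ h0.le h1.le
  have h4 : t ^ 4 ≤ t := pow_le_of_le_one h0.le h1.le (by norm_num)
  rw [Real.rpow_neg hs.le, ← Real.sqrt_eq_rpow, ← one_div]
  have : 0 < Real.sqrt (1 - t) := Real.sqrt_pos.2 hs
  gcongr

theorem intervalIntegrable_sq_div_sqrt_one_sub_pow_four_of_mem {a b : ℝ}
    (ha : a ∈ Set.Icc (0 : ℝ) 1) (hb : b ∈ Set.Icc (0 : ℝ) 1) :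
    IntervalIntegrable (fun t : ℝ => t ^ 2 / Real.sqrt (1 - t ^ 4)) volume a b := by
  refine intervalIntegrable_sq_div_sqrt_one_sub_pow_four.mono_set ?_
  rw [Set.uIcc_of_le zero_le_one]
  exact Set.uIcc_subset_Icc ha hb

theorem integral_sq_div_sqrt_one_sub_pow_four_le {z : ℝ} (hz : z ∈ Set.Icc (0 : ℝ) 1) :
    ∫ t in z..1, t ^ 2 / Real.sqrt (1 - t ^ 4) ≤
      ∫ t in (0 : ℝ)..1, t ^ 2 / Real.sqrt (1 - t ^ 4) :=
  integral_mono_interval hz.1 hz.2 le_rfl (.of_forall fun t => by positivity)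
    intervalIntegrable_sq_div_sqrt_one_sub_pow_four

theorem le_integral_sq_div_sqrt_one_sub_pow_four {d : ℝ} (h0 : 0 < d) (h1 : d ≤ 1) :
    d * (1 - d ^ 2) ^ 2 / 2 ≤ ∫ t in (1 - d ^ 2)..1, t ^ 2 / Real.sqrt (1 - t ^ 4) := by
  have hd : d ^ 2 ≤ 1 := pow_le_one₀ h0.le h1
  have hd' : 0 < d ^ 2 := by positivity
  have key : ∫ _ in (1 - d ^ 2)..1, (1 - d ^ 2) ^ 2 / (2 * d) ≤
      ∫ t in (1 - d ^ 2)..1, t ^ 2 / Real.sqrt (1 - t ^ 4) := by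
    refine integral_mono_on_of_le_Ioo (by linarith) (by simp)
      (intervalIntegrable_sq_div_sqrt_one_sub_pow_four_of_mem
        ⟨by linarith, by linarith⟩ ⟨zero_le_one, le_rfl⟩) fun t ht => ?_
    have ht0 : 0 ≤ t := by linarith [ht.1]
    have h4 : t ^ 4 < 1 := pow_lt_one₀ ht0 ht.2 (by norm_num)
    have hsq : Real.sqrt (1 - t ^ 4) ≤ 2 * d := by
      refine Real.sqrt_le_iff.2 ⟨by positivity, ?_⟩
      have := one_add_mul_le_pow (show (-2 : ℝ) ≤ t - 1 by linarith) 4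
      rw [add_sub_cancel] at this
      push_cast at this
      linarith [ht.1]
    have hpos : 0 < Real.sqrt (1 - t ^ 4) := Real.sqrt_pos.2 (sub_pos.2 h4)
    have := ht.1.le
    have : 0 ≤ 1 - d ^ 2 := by linarith
    gcongr
  refine le_of_eq_of_le ?_ key
  rw [intervalIntegral.integral_const, smul_eq_mul]
  field_simp
  ring


/-- With `C := ∫₀¹ 4t²/√(1−t⁴) dt` and
`M_k := sup_{z∈[0,1]} 2z(kC + 2∫_z¹ t²/√(1−t⁴) dt)`, one has `2kC < M_k < 2(k+1)C`
for every `k ∈ ℕ`; in particular `0 < M₀ < 2C < M₁ < 4C < M₂ < ⋯`. -/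
theorem willmore_constants_interlacing
    (C : ℝ) (hC : C = ∫ t in (0 : ℝ)..1, 4 * t ^ 2 / Real.sqrt (1 - t ^ 4))
    (M : ℕ → ℝ)
    (hM : ∀ k : ℕ, M k = sSup ((fun z : ℝ =>
      2 * z * (k * C + 2 * ∫ t in z..1, t ^ 2 / Real.sqrt (1 - t ^ 4))) ''
        Set.Icc (0 : ℝ) 1)) :
    ∀ k : ℕ, 2 * k * C < M k ∧ M k < 2 * (k + 1) * C := by
  have hCF : C = 4 * ∫ t in (0 : ℝ)..1, t ^ 2 / Real.sqrt (1 - t ^ 4) := by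
    rw [hC, ← intervalIntegral.integral_const_mul]
    simp only [mul_div_assoc]
  have hCpos : 0 < C := by
    have h := le_integral_sq_div_sqrt_one_sub_pow_four (d := 1 / 2) (by norm_num) (by norm_num)
    have h' := integral_sq_div_sqrt_one_sub_pow_four_le (z := 1 - (1 / 2) ^ 2)
      ⟨by norm_num, by norm_num⟩
    norm_num at h h'
    linarith
  intro k
  have hkC : 0 ≤ k * C := by positivity
  have hle : ∀ x ∈ (fun z : ℝ =>
      2 * z * (k * C + 2 * ∫ t in z..1, t ^ 2 / Real.sqrt (1 - t ^ 4))) ''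
        Set.Icc (0 : ℝ) 1, x ≤ (2 * k + 1) * C := by
    rintro _ ⟨z, hz, rfl⟩
    have h := integral_sq_div_sqrt_one_sub_pow_four_le hz
    have hzle : z * (k * C + 2 * ∫ t in z..1, t ^ 2 / Real.sqrt (1 - t ^ 4)) ≤
        z * (k * C + C / 2) := mul_le_mul_of_nonneg_left (by linarith) hz.1
    have hz1 : z * (k * C + C / 2) ≤ k * C + C / 2 :=
      mul_le_of_le_one_left (by positivity) hz.2
    dsimp only
    linarith
  rw [hM k]
  constructor
  · set d : ℝ := 1 / (4 * (1 + k * C)) with hd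
    have hd0 : 0 < d := by positivity
    have hdk : d * (1 + k * C) = 1 / 4 := by rw [hd]; field_simp
    have hd4 : d ≤ 1 / 4 := by nlinarith
    have hz : 3 / 4 ≤ 1 - d ^ 2 := by nlinarith
    have hF := le_integral_sq_div_sqrt_one_sub_pow_four hd0 (by linarith)
    refine lt_of_lt_of_le ?_ (le_csSup ⟨_, hle⟩
      ⟨1 - d ^ 2, ⟨by linarith, by nlinarith⟩, rfl⟩)
    have hcube : (3 / 4 : ℝ) ^ 3 ≤ (1 - d ^ 2) ^ 3 := by gcongr
    have hmul := mul_le_mul_of_nonneg_left hF (show 0 ≤ 1 - d ^ 2 by linarith)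
    have hlt : k * C * d ^ 2 < d * (1 - d ^ 2) ^ 3 := by
      have : k * C * d < (1 - d ^ 2) ^ 3 := by nlinarith
      nlinarith
    dsimp only
    linarith
  · refine (csSup_le (Set.Nonempty.image _ ⟨0, by simp⟩) hle).trans_lt ?_
    linarith
end

section
/- Let M₀ := sup_{z ∈ [0,1]} 4z·∫_z¹ t²/√(1−t⁴) dt and define h : (0,1) → ℝ by h(z) := 4z·∫_z¹ t²/√(1−t⁴) dt. Then for every m > 0 the solution set {z ∈ (0,1) : h(z) = m} has exactly two elements if m < M₀, exactly one element if m = M₀, and is empty if m > M₀. -/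
open Set MeasureTheory

namespace StrictConcaveOn

variable {f : ℝ → ℝ} {a b : ℝ}

/-- Between two points where a strictly concave function is at least `m`, it exceeds `m`. -/
lemma lt_of_mem_Ioo {s : Set ℝ} (hf : StrictConcaveOn ℝ s f) {x y z m : ℝ} (hx : x ∈ s)
    (hz : z ∈ s) (hxy : x < y) (hyz : y < z) (hmx : m ≤ f x) (hmz : m ≤ f z) : m < f y := by
  have hy : y ∈ openSegment ℝ x z := by
    rw [openSegment_eq_Ioo (hxy.trans hyz)]
    exact ⟨hxy, hyz⟩
  exact (le_min hmx hmz).trans_lt (hf.lt_on_openSegment hx hz (hxy.trans hyz).ne hy)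

/-- Below its maximum, a continuous strictly concave function on `[a, b]` takes every value
above its boundary values exactly twice. -/
lemma ncard_levelSet_eq_two (hf : StrictConcaveOn ℝ (Icc a b) f)
    (hc : ContinuousOn f (Icc a b)) {c m : ℝ} (hac : c ∈ Icc a b)
    (ha : f a < m) (hb : f b < m) (hm : m < f c) :
    {z ∈ Ioo a b | f z = m}.ncard = 2 := by
  obtain ⟨p, ⟨hap, hpc⟩, hp⟩ := intermediate_value_Ioo hac.1
    (hc.mono (Icc_subset_Icc_right hac.2)) ⟨ha, hm⟩
  obtain ⟨q, ⟨hcq, hqb⟩, hq⟩ := intermediate_value_Ioo' hac.2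
    (hc.mono (Icc_subset_Icc_left hac.1)) ⟨hb, hm⟩
  have hpI : p ∈ Icc a b := ⟨hap.le, hpc.le.trans hac.2⟩
  have hqI : q ∈ Icc a b := ⟨hac.1.trans hcq.le, hqb.le⟩
  have hpq : p < q := hpc.trans hcq
  rw [Set.ncard_eq_two]
  refine ⟨p, q, hpq.ne, Set.ext fun z => ⟨?_, ?_⟩⟩
  · rintro ⟨hz, hzm⟩
    have hzI := Ioo_subset_Icc_self hz
    rcases lt_trichotomy z p with h1 | h1 | h1
    · exact absurd hp (hf.lt_of_mem_Ioo hzI hqI h1 hpq hzm.ge hq.ge).ne'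
    · exact Or.inl h1
    · rcases lt_trichotomy z q with h2 | h2 | h2
      · exact absurd hzm (hf.lt_of_mem_Ioo hpI hqI h1 h2 hp.ge hq.ge).ne'
      · exact Or.inr h2
      · exact absurd hq (hf.lt_of_mem_Ioo hpI hzI hpq h2 hp.ge hzm.ge).ne'
  · rintro (rfl | rfl)
    · exact ⟨⟨hap, hpc.trans_le hac.2⟩, hp⟩
    · exact ⟨⟨hac.1.trans_lt hcq, hqb⟩, hq⟩

/-- A strictly concave function on `[a, b]` attains an interior maximum exactly once. -/
lemma ncard_levelSet_eq_one (hf : StrictConcaveOn ℝ (Icc a b) f) {c : ℝ} (hc : c ∈ Ioo a b)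
    (hmax : IsMaxOn f (Icc a b) c) : {z ∈ Ioo a b | f z = f c}.ncard = 1 := by
  rw [Set.ncard_eq_one]
  refine ⟨c, Set.ext fun z => ⟨?_, ?_⟩⟩
  · rintro ⟨hz, hzc⟩
    refine hf.eq_of_isMaxOn (fun w hw => ?_) hmax (Ioo_subset_Icc_self hz)
      (Ioo_subset_Icc_self hc)
    exact (hmax hw).trans hzc.ge
  · rintro rfl
    exact ⟨hc, rfl⟩

end StrictConcaveOn

namespace RectangularElastica

lemma one_sub_pow_four_pos {t : ℝ} (h0 : 0 ≤ t) (h1 : t < 1) : 0 < 1 - t ^ 4 :=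
  sub_pos.2 (pow_lt_one₀ h0 h1 (by norm_num))

lemma continuousOn_integrand :
    ContinuousOn (fun t : ℝ => t ^ 2 / Real.sqrt (1 - t ^ 4)) (Ioo 0 1) := by
  refine ContinuousOn.div (by fun_prop) (by fun_prop) fun t ht => ?_
  exact (Real.sqrt_pos.2 (one_sub_pow_four_pos ht.1.le ht.2)).ne'

lemma intervalIntegrable_integrand :
    IntervalIntegrable (fun t : ℝ => t ^ 2 / Real.sqrt (1 - t ^ 4)) volume 0 1 := by
  have hg : IntervalIntegrable (fun t : ℝ => (1 - t) ^ (-(1 / 2) : ℝ)) volume 0 1 := by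
    have := (intervalIntegral.intervalIntegrable_rpow' (a := 0) (b := 1) (r := -(1 / 2))
      (by norm_num)).comp_sub_left 1
    simpa using this.symm
  refine hg.mono_fun
    (by fun_prop : Measurable fun t : ℝ => t ^ 2 / Real.sqrt (1 - t ^ 4)).aestronglyMeasurable ?_
  rw [uIoc_of_le zero_le_one, ← restrict_Ioo_eq_restrict_Ioc]
  filter_upwards [ae_restrict_mem measurableSet_Ioo] with t ht
  have h1 : 0 < 1 - t := sub_pos.2 ht.2
  have h4 : t ^ 4 ≤ t := pow_le_of_le_one ht.1.le ht.2.le (by norm_num)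
  rw [Real.rpow_neg h1.le, ← Real.sqrt_eq_rpow, Real.norm_of_nonneg (by positivity),
    Real.norm_of_nonneg (by positivity), ← one_div]
  have := Real.sqrt_pos.2 h1
  have := ht.1.le
  gcongr
  exact pow_le_one₀ ht.1.le ht.2.le

lemma intervalIntegrable_integrand_of_mem {x y : ℝ} (hx : x ∈ Icc (0 : ℝ) 1)
    (hy : y ∈ Icc (0 : ℝ) 1) :
    IntervalIntegrable (fun t : ℝ => t ^ 2 / Real.sqrt (1 - t ^ 4)) volume x y :=
  intervalIntegrable_integrand.mono_set (by
    rw [uIcc_of_le (zero_le_one' ℝ)]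
    exact uIcc_subset_Icc hx hy)

lemma continuousOn_integral :
    ContinuousOn (fun z : ℝ => ∫ t in z..1, t ^ 2 / Real.sqrt (1 - t ^ 4)) (Icc 0 1) := by
  have h : IntegrableOn (fun t : ℝ => t ^ 2 / Real.sqrt (1 - t ^ 4)) (uIcc 0 1) :=
    (intervalIntegrable_iff' (by simp)).1 intervalIntegrable_integrand
  simpa [uIcc_of_le (zero_le_one' ℝ)] using
    intervalIntegral.continuousOn_primitive_interval_left h

lemma hasDerivAt_integral {z : ℝ} (hz : z ∈ Ioo (0 : ℝ) 1) :
    HasDerivAt (fun z : ℝ => ∫ t in z..1, t ^ 2 / Real.sqrt (1 - t ^ 4))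
      (-(z ^ 2 / Real.sqrt (1 - z ^ 4))) z := by
  refine intervalIntegral.integral_hasDerivAt_left
    (intervalIntegrable_integrand_of_mem (Ioo_subset_Icc_self hz) ⟨zero_le_one, le_rfl⟩) ?_
    (continuousOn_integrand.continuousAt (isOpen_Ioo.mem_nhds hz))
  exact continuousOn_integrand.stronglyMeasurableAtFilter isOpen_Ioo z hz

lemma strictConcaveOn_mul_integral :
    StrictConcaveOn ℝ (Icc 0 1)
      (fun z : ℝ => 4 * z * ∫ t in z..1, t ^ 2 / Real.sqrt (1 - t ^ 4)) := by
  have hderiv : ∀ z ∈ Ioo (0 : ℝ) 1,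
      deriv (fun z : ℝ => 4 * z * ∫ t in z..1, t ^ 2 / Real.sqrt (1 - t ^ 4)) z =
        4 * ((∫ t in z..1, t ^ 2 / Real.sqrt (1 - t ^ 4)) -
          z * (z ^ 2 / Real.sqrt (1 - z ^ 4))) := fun z hz => by
    refine (((hasDerivAt_id' z).const_mul 4).mul (hasDerivAt_integral hz)).deriv.trans ?_
    ring
  refine StrictAntiOn.strictConcaveOn_of_deriv (convex_Icc 0 1)
    ((by fun_prop : ContinuousOn (fun z : ℝ => 4 * z) _).mul continuousOn_integral) ?_
  rw [interior_Icc]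
  intro x hx y hy hxy
  rw [hderiv x hx, hderiv y hy]
  have hsplit := intervalIntegral.integral_add_adjacent_intervals
    (intervalIntegrable_integrand_of_mem (Ioo_subset_Icc_self hx) (Ioo_subset_Icc_self hy))
    (intervalIntegrable_integrand_of_mem (Ioo_subset_Icc_self hy) ⟨zero_le_one, le_rfl⟩)
  have hnonneg : 0 ≤ ∫ t in x..y, t ^ 2 / Real.sqrt (1 - t ^ 4) :=
    intervalIntegral.integral_nonneg hxy.le fun t _ => by positivity
  have hx0 := hx.1
  have hmono : x * (x ^ 2 / Real.sqrt (1 - x ^ 4)) < y * (y ^ 2 / Real.sqrt (1 - y ^ 4)) := by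
    have hsq := Real.sqrt_pos.2 (one_sub_pow_four_pos hy.1.le hy.2)
    have hle : x ^ 2 / Real.sqrt (1 - x ^ 4) ≤ y ^ 2 / Real.sqrt (1 - y ^ 4) := by
      gcongr
    have hpos : 0 < y ^ 2 / Real.sqrt (1 - y ^ 4) := div_pos (pow_pos hy.1 2) hsq
    exact mul_lt_mul hxy hle
      (div_pos (pow_pos hx0 2) (Real.sqrt_pos.2 (one_sub_pow_four_pos hx0.le hx.2))) hy.1.le
  linarith

end RectangularElastica


/-- Let `h(z) := 4z∫_z¹ t²/√(1−t⁴) dt` and `M₀ := sup_{z∈[0,1]} h(z)`. For every `m > 0`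
the equation `h(z) = m` has exactly two solutions in `(0,1)` if `m < M₀`, exactly one if
`m = M₀`, and none if `m > M₀`. -/
theorem willmore_h0_level_sets
    (M₀ : ℝ)
    (hM₀ : M₀ = sSup ((fun z : ℝ =>
      4 * z * ∫ t in z..1, t ^ 2 / Real.sqrt (1 - t ^ 4)) '' Set.Icc (0 : ℝ) 1))
    (h : ℝ → ℝ)
    (hh : ∀ z : ℝ, h z = 4 * z * ∫ t in z..1, t ^ 2 / Real.sqrt (1 - t ^ 4)) :
    ∀ m : ℝ, 0 < m →
      ((m < M₀ → {z ∈ Set.Ioo (0 : ℝ) 1 | h z = m}.ncard = 2) ∧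
       (m = M₀ → {z ∈ Set.Ioo (0 : ℝ) 1 | h z = m}.ncard = 1) ∧
       (M₀ < m → {z ∈ Set.Ioo (0 : ℝ) 1 | h z = m} = ∅)) := by
  obtain rfl : h = fun z => 4 * z * ∫ t in z..1, t ^ 2 / Real.sqrt (1 - t ^ 4) := funext hh
  have hconc := RectangularElastica.strictConcaveOn_mul_integral
  have hcont : ContinuousOn (fun z : ℝ => 4 * z * ∫ t in z..1, t ^ 2 / Real.sqrt (1 - t ^ 4))
      (Icc 0 1) :=
    (by fun_prop : ContinuousOn (fun z : ℝ => 4 * z) _).mul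
      RectangularElastica.continuousOn_integral
  clear hh
  set h : ℝ → ℝ := fun z => 4 * z * ∫ t in z..1, t ^ 2 / Real.sqrt (1 - t ^ 4) with hdef
  have h0 : h 0 = 0 := by simp [hdef]
  have h1 : h 1 = 0 := by simp [hdef]
  obtain ⟨c, hc, hsup, hmax⟩ := isCompact_Icc.exists_sSup_image_eq_and_ge
    (nonempty_Icc.2 (zero_le_one' ℝ)) hcont
  rw [hsup] at hM₀
  subst hM₀
  intro m hm
  refine ⟨fun hlt => hconc.ncard_levelSet_eq_two hcont hc (h0.trans_lt hm) (h1.trans_lt hm) hlt, ?_, ?_⟩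
  · rintro rfl
    refine hconc.ncard_levelSet_eq_one ⟨hc.1.lt_of_ne ?_, hc.2.lt_of_ne ?_⟩ hmax
    · rintro rfl
      exact hm.ne' h0
    · rintro rfl
      exact hm.ne' h1
  · intro hlt
    refine eq_empty_of_forall_notMem fun z hz => ?_
    exact (hmax z (Ioo_subset_Icc_self hz.1)).not_gt (hz.2 ▸ hlt)
end

section
/- Fix an integer k ≥ 1, let C := ∫₀¹ 4t²/√(1−t⁴) dt, and define h_k : [0,1) → ℝ by h_k(z) := 2z·((k−1)C + 2∫_{−z}¹ t²/√(1−t⁴) dt). Then h_k is strictly increasing on [0,1) with h_k(0) = 0 and h_k(z) → 2kC as z → 1⁻; consequently, for every m ≥ 0 the set {z ∈ [0,1) : h_k(z) = m} has exactly one element if 0 ≤ m < 2kC and is empty if m ≥ 2kC. -/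
open MeasureTheory in
/-- The integrand `t² / √(1 - t⁴)`, extended by zero, is dominated by `1 / √(1 - t²)`, the derivative
of `arcsin`. -/
theorem integrable_sq_div_sqrt_one_sub_pow_four :
    Integrable (fun t : ℝ => t ^ 2 / Real.sqrt (1 - t ^ 4)) := by
  have harcsin : IntervalIntegrable (fun t : ℝ => 1 / Real.sqrt (1 - t ^ 2)) volume (-1) 1 := by
    refine intervalIntegral.intervalIntegrable_deriv_of_nonneg (g := Real.arcsin)
      Real.continuous_arcsin.continuousOn ?_ fun t _ => by positivity
    intro t ht
    rw [min_eq_left (by norm_num), max_eq_right (by norm_num)] at ht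
    exact Real.hasDerivAt_arcsin ht.1.ne' ht.2.ne
  rw [intervalIntegrable_iff_integrableOn_Icc_of_le (by norm_num)] at harcsin
  have hmeas : Measurable (fun t : ℝ => t ^ 2 / Real.sqrt (1 - t ^ 4)) := by fun_prop
  have hon : IntegrableOn (fun t : ℝ => t ^ 2 / Real.sqrt (1 - t ^ 4)) (Set.Icc (-1) 1) := by
    refine Integrable.mono' harcsin hmeas.aestronglyMeasurable ?_
    refine (ae_restrict_iff' measurableSet_Icc).2 (Filter.Eventually.of_forall fun t ht => ?_)
    rw [Real.norm_of_nonneg (by positivity)]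
    have ht2 : t ^ 2 ≤ 1 := by nlinarith [ht.1, ht.2]
    rcases ht2.lt_or_eq with hlt | heq
    · have hpos : 0 < Real.sqrt (1 - t ^ 2) := Real.sqrt_pos.2 (by linarith)
      exact div_le_div₀ zero_le_one ht2 hpos (Real.sqrt_le_sqrt (by nlinarith [sq_nonneg t]))
    · have h4 : t ^ 4 = 1 := by
        calc t ^ 4 = (t ^ 2) ^ 2 := by ring
          _ = 1 := by rw [heq]; norm_num
      simp [heq, h4]
  refine hon.integrable_of_forall_notMem_eq_zero fun t ht => ?_
  have h1 : 1 < t ^ 2 := by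
    by_contra! hle
    exact ht (abs_le.1 ((sq_le_one_iff_abs_le_one t).1 hle))
  rw [Real.sqrt_eq_zero_of_nonpos (by nlinarith), div_zero]


/-- Let `k ≥ 1`, `C := ∫₀¹ 4t²/√(1−t⁴) dt`, and
`h_k(z) := 2z((k−1)C + 2∫_{−z}¹ t²/√(1−t⁴) dt)`. Then `h_k` is strictly increasing on
`[0,1)` with `h_k(0) = 0` and `h_k(z) → 2kC` as `z → 1⁻`; consequently for every `m ≥ 0`
the equation `h_k(z) = m` has exactly one solution in `[0,1)` if `0 ≤ m < 2kC` and none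
if `m ≥ 2kC`. -/
theorem willmore_hk_strictly_increasing_level_sets
    (k : ℕ) (hk : 1 ≤ k)
    (C : ℝ) (hC : C = ∫ t in (0 : ℝ)..1, 4 * t ^ 2 / Real.sqrt (1 - t ^ 4))
    (h : ℝ → ℝ)
    (hh : ∀ z : ℝ, h z =
      2 * z * (((k : ℝ) - 1) * C + 2 * ∫ t in (-z)..1, t ^ 2 / Real.sqrt (1 - t ^ 4))) :
    StrictMonoOn h (Set.Ico (0 : ℝ) 1) ∧
      h 0 = 0 ∧
      Filter.Tendsto h (nhdsWithin 1 (Set.Iio 1)) (nhds (2 * k * C)) ∧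
      (∀ m : ℝ, 0 ≤ m → m < 2 * k * C → {z ∈ Set.Ico (0 : ℝ) 1 | h z = m}.ncard = 1) ∧
      (∀ m : ℝ, 2 * k * C ≤ m → {z ∈ Set.Ico (0 : ℝ) 1 | h z = m} = ∅) := by
  set g : ℝ → ℝ := fun t => t ^ 2 / Real.sqrt (1 - t ^ 4) with hg
  have hint : ∀ a b : ℝ, IntervalIntegrable g MeasureTheory.volume a b := fun a b =>
    integrable_sq_div_sqrt_one_sub_pow_four.intervalIntegrable
  have hg0 : ∀ t, 0 ≤ g t := fun t => by positivity
  have hI : 0 < ∫ t in (0 : ℝ)..1, g t := by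
    refine intervalIntegral.intervalIntegral_pos_of_pos_on (hint 0 1) (fun t ht => ?_) one_pos
    have h4 : t ^ 4 < 1 := pow_lt_one₀ ht.1.le ht.2 (by norm_num)
    exact div_pos (pow_pos ht.1 2) (Real.sqrt_pos.2 (by linarith))
  have hCI : C = 4 * ∫ t in (0 : ℝ)..1, g t := by
    rw [hC, ← intervalIntegral.integral_const_mul]
    simp only [hg, mul_div_assoc]
  have hk1 : (0 : ℝ) ≤ (k : ℝ) - 1 := sub_nonneg.2 (by exact_mod_cast hk)
  have hsplit : ∀ a b : ℝ,
      ∫ t in (-b)..1, g t = (∫ t in (-b)..(-a), g t) + ∫ t in (-a)..1, g t := fun a b =>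
    (intervalIntegral.integral_add_adjacent_intervals (hint _ _) (hint _ _)).symm
  have hmonoF : ∀ a b : ℝ, a ≤ b → ∫ t in (-a)..1, g t ≤ ∫ t in (-b)..1, g t := fun a b hab => by
    rw [hsplit a b]
    linarith [intervalIntegral.integral_nonneg_of_forall
      (μ := MeasureTheory.volume) (neg_le_neg hab) hg0]
  have hposF : ∀ a : ℝ, 0 ≤ a → 0 < ∫ t in (-a)..1, g t := fun a ha => by
    have := hmonoF 0 a ha
    rw [neg_zero] at this
    linarith
  have hmono : StrictMonoOn h (Set.Ici 0) := by
    intro a ha b hb hab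
    rw [hh, hh]
    have h1 := hmonoF a b hab.le
    have h2 := hposF b hb
    have h3 : 0 ≤ ((k : ℝ) - 1) * C := mul_nonneg hk1 (by rw [hCI]; positivity)
    have ha' : (0 : ℝ) ≤ a := ha
    refine mul_lt_mul_of_lt_of_le_of_nonneg_of_pos (by linarith) ?_ (by positivity) ?_
    · change _ + 2 * (∫ t in (-a)..1, g t) ≤ _ + 2 * (∫ t in (-b)..1, g t)
      linarith
    · change 0 < _ + 2 * (∫ t in (-b)..1, g t)
      linarith
  have hcont : Continuous h := by
    have hprim : Continuous fun z : ℝ => ∫ t in (1 : ℝ)..z, g t :=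
      intervalIntegral.continuous_primitive hint 1
    have hF : Continuous fun z : ℝ => ∫ t in (-z)..1, g t := by
      simp_rw [intervalIntegral.integral_symm 1]
      exact (hprim.comp continuous_neg).neg
    rw [funext hh]
    exact (continuous_const.mul continuous_id).mul
      (continuous_const.add (continuous_const.mul hF))
  have h0 : h 0 = 0 := by rw [hh]; ring
  have h1 : h 1 = 2 * k * C := by
    have heven : ∫ t in (-1 : ℝ)..0, g t = ∫ t in (0 : ℝ)..1, g t := by
      have := intervalIntegral.integral_comp_neg (a := 0) (b := 1) g
      rw [neg_zero] at this
      rw [← this]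
      simp only [hg, neg_sq, Even.neg_pow (show Even 4 by decide)]
    have := hsplit 0 1
    rw [neg_zero, heven] at this
    rw [hh]
    change 2 * 1 * (((k : ℝ) - 1) * C + 2 * ∫ t in (-1 : ℝ)..1, g t) = _
    rw [this, hCI]
    ring
  have hlt : ∀ z ∈ Set.Ico (0 : ℝ) 1, h z < 2 * k * C := fun z hz =>
    h1 ▸ hmono hz.1 (Set.mem_Ici.2 zero_le_one) hz.2
  have hmono' : StrictMonoOn h (Set.Ico 0 1) := hmono.mono fun z hz => hz.1
  refine ⟨hmono', h0, h1 ▸ (hcont.tendsto 1).mono_left nhdsWithin_le_nhds, ?_, ?_⟩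
  · intro m hm0 hm
    obtain ⟨z, hz, hzm⟩ := intermediate_value_Ico zero_le_one hcont.continuousOn
      (show m ∈ Set.Ico (h 0) (h 1) from ⟨h0.trans_le hm0, hm.trans_eq h1.symm⟩)
    refine Set.ncard_eq_one.2 ⟨z, Set.eq_singleton_iff_unique_mem.2 ⟨⟨hz, hzm⟩, ?_⟩⟩
    rintro w ⟨hw, hwm⟩
    exact hmono'.injOn hw hz (hwm.trans hzm.symm)
  · intro m hm
    refine Set.eq_empty_iff_forall_notMem.2 ?_
    rintro z ⟨hz, hzm⟩
    exact absurd (hlt z hz) (by linarith)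
end

section
/- Let A, B ∈ ℝ² with A ≠ B, let κ₁, κ₂ ∈ ℝ, and let E > 0. Then there exist L > 0 and a smooth unit-speed curve γ : [0,L] → ℝ² whose curvature κ(s) := det(γ'(s), γ''(s)) satisfies −2κ'' = κ³ on [0,L], such that γ(0) = A, γ(L) = B, κ(0) = κ₁, κ(L) = κ₂, and (1/2)∫₀ᴸ κ(s)² ds > E. In particular the Navier problem for planar Willmore curves has infinitely many solutions whose Willmore energies tend to +∞. -/
open Real Set Filter Topology

/-- Solutions of the scalar autonomous equation `w' = f w` with `f` smooth and bounded between
positive constants are global, smooth, and reach every value beyond the initial one. -/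
theorem exists_smooth_solution_autonomous {f : ℝ → ℝ} {m M : ℝ} (hf : ContDiff ℝ (⊤ : ℕ∞) f)
    (hm : 0 < m) (hmf : ∀ x, m ≤ f x) (hfM : ∀ x, f x ≤ M) (a : ℝ) :
    ∃ w : ℝ → ℝ, ContDiff ℝ (⊤ : ℕ∞) w ∧ (∀ s, HasDerivAt w (f (w s)) s) ∧ w 0 = a ∧
      ∀ b, a < b → ∃ L, 0 < L ∧ w L = b := by
  have hpos : ∀ x, 0 < f x := fun x => hm.trans_le (hmf x)
  have hM : 0 < M := (hpos 0).trans_le (hfM 0)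
  have hinv : Continuous fun x => (f x)⁻¹ := hf.continuous.inv₀ fun x => (hpos x).ne'
  set F : ℝ → ℝ := fun u => ∫ x in a..u, (f x)⁻¹ with hF
  have hF' : ∀ u, HasDerivAt F ((f u)⁻¹) u := fun u =>
    intervalIntegral.integral_hasDerivAt_right (hinv.intervalIntegrable _ _)
      (hinv.stronglyMeasurableAtFilter _ _) hinv.continuousAt
  have hFa : F a = 0 := by simp [hF]
  have hFmono : StrictMono F := strictMono_of_deriv_pos fun u => by
    rw [(hF' u).deriv]; exact inv_pos.2 (hpos u)
  have hFcont : Continuous F := continuous_iff_continuousAt.2 fun u => (hF' u).continuousAt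
  have hsub : Monotone fun u => F u - M⁻¹ * u := by
    have hd : ∀ u, HasDerivAt (fun u => F u - M⁻¹ * u) ((f u)⁻¹ - M⁻¹) u := fun u => by
      simpa using! (hF' u).sub ((hasDerivAt_id u).const_mul M⁻¹)
    refine monotone_of_deriv_nonneg (fun u => (hd u).differentiableAt) fun u => ?_
    rw [(hd u).deriv, sub_nonneg]
    exact inv_anti₀ (hpos u) (hfM u)
  have hlin : Tendsto (fun u : ℝ => M⁻¹ * u + (F 0 - M⁻¹ * 0)) atTop atTop :=
    tendsto_atTop_add_const_right _ _ (tendsto_id.const_mul_atTop (inv_pos.2 hM))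
  have hlin' : Tendsto (fun u : ℝ => M⁻¹ * u + (F 0 - M⁻¹ * 0)) atBot atBot :=
    tendsto_atBot_add_const_right _ _ (tendsto_id.const_mul_atBot (inv_pos.2 hM))
  have hFsurj : Function.Surjective F := by
    refine hFcont.surjective (tendsto_atTop_mono' _ ?_ hlin) (tendsto_atBot_mono' _ ?_ hlin')
    · filter_upwards [eventually_ge_atTop 0] with u hu
      have := hsub hu
      simp only at this
      linarith
    · filter_upwards [eventually_le_atBot 0] with u hu
      have := hsub hu
      simp only at this
      linarith
  set e := hFmono.orderIsoOfSurjective F hFsurj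
  have heF : ∀ u, e u = F u := fun u => rfl
  have hw' : ∀ s, HasDerivAt e.symm (f (e.symm s)) s := fun s => by
    simpa using (hF' (e.symm s)).of_local_left_inverse e.symm.continuous.continuousAt
      (inv_ne_zero (hpos _).ne') (Eventually.of_forall fun y => e.apply_symm_apply y)
  have hderiv : deriv e.symm = fun s => f (e.symm s) := funext fun s => (hw' s).deriv
  refine ⟨e.symm, contDiff_infty.2 fun n => ?_, hw', ?_, fun b hb => ⟨F b, ?_, ?_⟩⟩
  · induction n with
    | zero => exact contDiff_zero.2 e.symm.continuous
    | succ n ih =>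
      push_cast
      refine contDiff_succ_iff_deriv.2 ⟨fun s => (hw' s).differentiableAt, by simp, ?_⟩
      rw [hderiv]
      exact (contDiff_infty.1 hf n).comp ih
  · rw [← hFa, ← heF, e.symm_apply_apply]
  · rw [← hFa]; exact hFmono hb
  · rw [← heF, e.symm_apply_apply]

/-- The phase speed of the rectangular elastica `κ = sin w` of unit amplitude, up to a factor `2`:
`2 w' = elasticaSpeed w`. -/
noncomputable def elasticaSpeed (v : ℝ) : ℝ := √(1 + sin v ^ 2)

theorem elasticaSpeed_sq (v : ℝ) : elasticaSpeed v ^ 2 = 1 + sin v ^ 2 :=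
  Real.sq_sqrt (by positivity)

theorem one_le_elasticaSpeed (v : ℝ) : 1 ≤ elasticaSpeed v :=
  Real.one_le_sqrt.2 (by nlinarith [sq_nonneg (sin v)])

theorem elasticaSpeed_le_two (v : ℝ) : elasticaSpeed v ≤ 2 :=
  Real.sqrt_le_iff.2 ⟨by norm_num, by nlinarith [sin_sq_le_one v]⟩

theorem contDiff_elasticaSpeed : ContDiff ℝ (⊤ : ℕ∞) elasticaSpeed :=
  (contDiff_const.add (contDiff_sin.pow 2)).sqrt fun v => by positivity

theorem hasDerivAt_elasticaSpeed (v : ℝ) :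
    HasDerivAt elasticaSpeed (sin v * cos v / elasticaSpeed v) v := by
  have hpos : 0 < 1 + sin v ^ 2 := by positivity
  have h := (((hasDerivAt_sin v).fun_pow 2).const_add 1).sqrt hpos.ne'
  refine h.congr_deriv ?_
  rw [elasticaSpeed]
  push_cast
  rw [pow_one, mul_assoc, mul_div_mul_left _ _ two_ne_zero]

/-- The curvature energy of the unit rectangular elastica per unit of phase. -/
noncomputable def elasticaDensity (v : ℝ) : ℝ := 2 * sin v ^ 2 / elasticaSpeed v

theorem contDiff_elasticaDensity : ContDiff ℝ (⊤ : ℕ∞) elasticaDensity :=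
  (contDiff_const.mul (contDiff_sin.pow 2)).div contDiff_elasticaSpeed
    fun v => (zero_lt_one.trans_le (one_le_elasticaSpeed v)).ne'

theorem sin_sq_le_elasticaDensity (v : ℝ) : sin v ^ 2 ≤ elasticaDensity v := by
  rw [elasticaDensity, le_div_iff₀ (zero_lt_one.trans_le (one_le_elasticaSpeed v))]
  nlinarith [elasticaSpeed_le_two v, sq_nonneg (sin v)]

theorem elasticaDensity_le_two (v : ℝ) : elasticaDensity v ≤ 2 := by
  rw [elasticaDensity, div_le_iff₀ (zero_lt_one.trans_le (one_le_elasticaSpeed v))]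
  nlinarith [one_le_elasticaSpeed v, sin_sq_le_one v]

theorem intervalIntegrable_elasticaDensity (a b : ℝ) :
    IntervalIntegrable elasticaDensity MeasureTheory.volume a b :=
  contDiff_elasticaDensity.continuous.intervalIntegrable a b

theorem hasDerivAt_integral_elasticaDensity (a u : ℝ) :
    HasDerivAt (fun u => ∫ v in a..u, elasticaDensity v) (elasticaDensity u) u :=
  have h := contDiff_elasticaDensity.continuous
  intervalIntegral.integral_hasDerivAt_right (h.intervalIntegrable _ _)
    (h.stronglyMeasurableAtFilter _ _) h.continuousAt

theorem integral_elasticaDensity_lower_bound {a b : ℝ} (hab : a ≤ b) :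
    (b - a) / 2 - 1 ≤ ∫ v in a..b, elasticaDensity v := by
  have h : ∫ v in a..b, sin v ^ 2 ≤ ∫ v in a..b, elasticaDensity v :=
    intervalIntegral.integral_mono_on hab
      ((continuous_sin.pow 2).intervalIntegrable _ _) (intervalIntegrable_elasticaDensity a b)
      fun v _ => sin_sq_le_elasticaDensity v
  rw [integral_sin_sq] at h
  have h₁ : -1 ≤ sin a * cos a := by
    nlinarith [sin_sq_add_cos_sq a, sq_nonneg (sin a + cos a)]
  have h₂ : sin b * cos b ≤ 1 := by
    nlinarith [sin_sq_add_cos_sq b, sq_nonneg (sin b - cos b)]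
  linarith

theorem integral_elasticaDensity_upper_bound {a b : ℝ} (hab : a ≤ b) :
    ∫ v in a..b, elasticaDensity v ≤ 2 * (b - a) := by
  have h := intervalIntegral.integral_mono_on hab (intervalIntegrable_elasticaDensity a b)
    (intervalIntegrable_const (c := (2 : ℝ))) fun v _ => elasticaDensity_le_two v
  simpa [mul_comm] using h

/-- Amplitude and winding of a rectangular elastica can be matched to the distance `d` between the
end points, with arbitrarily large amplitude. -/
theorem exists_amplitude_and_phases {d : ℝ} (hd : 0 < d) (κ₁ κ₂ R : ℝ) :
    ∃ r a b : ℝ, R ≤ r ∧ a < b ∧ r * sin a = κ₁ ∧ r * sin b = κ₂ ∧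
      0 < ∫ v in a..b, elasticaDensity v ∧
      r ^ 2 * (∫ v in a..b, elasticaDensity v) ^ 2 + 4 * (κ₂ - κ₁) ^ 2 = d ^ 2 * r ^ 4 := by
  obtain ⟨r₀, hr₀R, hr₀1, hr₀κ₁, hr₀κ₂⟩ : ∃ r₀ : ℝ, R ≤ r₀ ∧ 1 ≤ r₀ ∧ |κ₁| ≤ r₀ ∧ |κ₂| ≤ r₀ :=
    ⟨max (max R 1) (max |κ₁| |κ₂|), by simp, by simp, by simp, by simp⟩
  obtain ⟨n, hn⟩ := exists_nat_ge (d * r₀ + 3)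
  set a : ℝ → ℝ := fun r => arcsin (κ₁ / r) with ha
  set b : ℝ → ℝ := fun r => arcsin (κ₂ / r) + n * (2 * π) with hb
  have hn3 : (3 : ℝ) ≤ n := by nlinarith
  have hπ := pi_gt_three
  have hlow : ∀ r, 2 * n ≤ b r - a r := fun r => by
    have h₁ := arcsin_le_pi_div_two (κ₁ / r)
    have h₂ := neg_pi_div_two_le_arcsin (κ₂ / r)
    simp only [ha, hb]
    nlinarith
  have hupp : ∀ r, b r - a r ≤ (2 * n + 1) * π := fun r => by
    have h₁ := neg_pi_div_two_le_arcsin (κ₁ / r)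
    have h₂ := arcsin_le_pi_div_two (κ₂ / r)
    simp only [ha, hb]
    nlinarith
  have hab : ∀ r, a r < b r := fun r => by linarith [hlow r]
  set J : ℝ → ℝ := fun r => ∫ v in a r..b r, elasticaDensity v with hJ
  have hJlow : ∀ r, n - 1 ≤ J r := fun r => by
    have := integral_elasticaDensity_lower_bound (hab r).le
    linarith [hlow r]
  have hJupp : ∀ r, J r ≤ 2 * ((2 * n + 1) * π) := fun r => by
    have := integral_elasticaDensity_upper_bound (hab r).le
    linarith [hupp r]
  have hcont : ContinuousOn J (Ici r₀) := by
    have hJ' : J = fun r => (∫ v in (0 : ℝ)..b r, elasticaDensity v) -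
        ∫ v in (0 : ℝ)..a r, elasticaDensity v := funext fun r =>
      (intervalIntegral.integral_interval_sub_left (intervalIntegrable_elasticaDensity _ _)
        (intervalIntegrable_elasticaDensity _ _)).symm
    have hG : Continuous fun u => ∫ v in (0 : ℝ)..u, elasticaDensity v :=
      continuous_iff_continuousAt.2 fun u => (hasDerivAt_integral_elasticaDensity 0 u).continuousAt
    have hdiv : ∀ κ : ℝ, ContinuousOn (fun r => arcsin (κ / r)) (Ici r₀) := fun κ =>
      continuous_arcsin.comp_continuousOn (continuousOn_const.div continuousOn_id fun r hr =>
        (zero_lt_one.trans_le (hr₀1.trans hr)).ne')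
    rw [hJ']
    exact (hG.comp_continuousOn ((hdiv κ₂).add continuousOn_const)).sub
      (hG.comp_continuousOn (hdiv κ₁))
  set Φ : ℝ → ℝ := fun r => r ^ 2 * J r ^ 2 + 4 * (κ₂ - κ₁) ^ 2 - d ^ 2 * r ^ 4 with hΦ
  set C : ℝ := (2 * ((2 * n + 1) * π)) ^ 2 + 4 * (κ₂ - κ₁) ^ 2 with hC
  have hC0 : 0 ≤ C := by positivity
  set r₁ : ℝ := max r₀ (√C / d) with hr₁
  have hr₁0 : r₀ ≤ r₁ := le_max_left _ _
  have hr₁1 : 1 ≤ r₁ := hr₀1.trans hr₁0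
  have hΦ₀ : 0 ≤ Φ r₀ := by
    have h : d * r₀ ≤ J r₀ := by linarith [hJlow r₀]
    have h' : (d * r₀) ^ 2 ≤ J r₀ ^ 2 := pow_le_pow_left₀ (by positivity) h 2
    simp only [hΦ]
    nlinarith [mul_le_mul_of_nonneg_left h' (sq_nonneg r₀), sq_nonneg (κ₂ - κ₁)]
  have hΦ₁ : Φ r₁ ≤ 0 := by
    have h : √C ≤ d * r₁ := by
      rw [← div_le_iff₀' hd]; exact le_max_right _ _
    have h' : C ≤ (d * r₁) ^ 2 := Real.sqrt_le_left (by positivity) |>.1 h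
    have h'' : J r₁ ^ 2 ≤ (2 * ((2 * n + 1) * π)) ^ 2 :=
      pow_le_pow_left₀ (by linarith [hJlow r₁]) (hJupp r₁) 2
    have hsq : 1 ≤ r₁ ^ 2 := one_le_pow₀ hr₁1
    have e₁ := mul_le_mul_of_nonneg_left h' (sq_nonneg r₁)
    have e₂ := mul_le_mul_of_nonneg_left h'' (sq_nonneg r₁)
    have e₃ := mul_le_mul_of_nonneg_right hsq (sq_nonneg (κ₂ - κ₁))
    simp only [hΦ]
    simp only [hC] at e₁
    linarith
  have hΦcont : ContinuousOn Φ (Icc r₀ r₁) := by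
    have := hcont.mono (Icc_subset_Ici_self : Icc r₀ r₁ ⊆ Ici r₀)
    fun_prop
  obtain ⟨r, hr, hr0⟩ := intermediate_value_Icc' hr₁0 hΦcont ⟨hΦ₁, hΦ₀⟩
  have hrpos : 0 < r := zero_lt_one.trans_le (hr₀1.trans hr.1)
  have hsin : ∀ κ : ℝ, |κ| ≤ r₀ → r * sin (arcsin (κ / r)) = κ := fun κ hκ => by
    have h := abs_le.1 (hκ.trans hr.1)
    rw [sin_arcsin, mul_div_cancel₀ _ hrpos.ne']
    · rw [le_div_iff₀ hrpos]; linarith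
    · rw [div_le_one hrpos]; exact h.2
  refine ⟨r, a r, b r, hr₀R.trans hr.1, hab r, hsin κ₁ hr₀κ₁, ?_, ?_, ?_⟩
  · simp only [hb, sin_add_nat_mul_two_pi]
    exact hsin κ₂ hr₀κ₂
  · linarith [hJlow r]
  · simp only [hΦ] at hr0
    linarith

/-- The amplitude relation turns large amplitude into large energy `r * J / 2`. -/
theorem lt_mul_of_amplitude_relation {E d r J δ : ℝ} (hE : 0 ≤ E) (hr : 1 ≤ r)
    (hJ : 0 < J) (hdr : 2 * E + 2 * |δ| < d * r)
    (heq : r ^ 2 * J ^ 2 + 4 * δ ^ 2 = d ^ 2 * r ^ 4) : 2 * E < r * J := by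
  have hsq : (2 * E + 2 * |δ|) ^ 2 < (d * r) ^ 2 := pow_lt_pow_left₀ hdr (by positivity) two_ne_zero
  have hprod : 0 ≤ E * |δ| := by positivity
  have hr2 : (d * r) ^ 2 * 1 ≤ (d * r) ^ 2 * r ^ 2 :=
    mul_le_mul_of_nonneg_left (one_le_pow₀ hr) (sq_nonneg _)
  refine lt_of_pow_lt_pow_left₀ 2 (by positivity) ?_
  rw [← sq_abs δ] at heq
  linarith

/-- A planar vector of the same length as a nonzero one is carried to it by a rotation. -/
theorem exists_rotation {x y p q : ℝ} (h : x ^ 2 + y ^ 2 = p ^ 2 + q ^ 2) (h0 : 0 < p ^ 2 + q ^ 2) :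
    ∃ c s : ℝ, c ^ 2 + s ^ 2 = 1 ∧ c * x - s * y = p ∧ s * x + c * y = q := by
  refine ⟨(x * p + y * q) / (p ^ 2 + q ^ 2), (x * q - y * p) / (p ^ 2 + q ^ 2), ?_, ?_, ?_⟩
  · field_simp
    linear_combination (p ^ 2 + q ^ 2) * h
  · field_simp
    linear_combination p * h
  · field_simp
    linear_combination q * h

theorem hasDerivAt_euclidean_two {x y : ℝ → ℝ} {x' y' s : ℝ} (hx : HasDerivAt x x' s)
    (hy : HasDerivAt y y' s) : HasDerivAt (fun s => !₂[x s, y s]) !₂[x', y'] s := by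
  rw [hasDerivAt_iff_hasFDerivAt, ← hasFDerivWithinAt_univ, hasFDerivWithinAt_euclidean]
  intro i
  fin_cases i
  · simpa using! hx.hasFDerivAt
  · simpa using! hy.hasFDerivAt

/-- The initial value problem for the phase of a rectangular elastica of amplitude `r`. -/
theorem exists_elastica_phase {r : ℝ} (hr : 0 < r) (a : ℝ) :
    ∃ w : ℝ → ℝ, ContDiff ℝ (⊤ : ℕ∞) w ∧
      (∀ s, HasDerivAt w (r / 2 * elasticaSpeed (w s)) s) ∧ w 0 = a ∧
      ∀ b, a < b → ∃ L, 0 < L ∧ w L = b :=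
  exists_smooth_solution_autonomous (f := fun v => r / 2 * elasticaSpeed v) (m := r / 2) (M := r)
    (contDiff_const.mul contDiff_elasticaSpeed) (half_pos hr)
    (fun v => by nlinarith [one_le_elasticaSpeed v])
    (fun v => by nlinarith [elasticaSpeed_le_two v]) a

section ElasticaPhase

variable {r : ℝ} {w : ℝ → ℝ}

theorem hasDerivAt_elastica_abscissa (hr : 0 < r)
    (hw : ∀ s, HasDerivAt w (r / 2 * elasticaSpeed (w s)) s) (a s : ℝ) :
    HasDerivAt (fun s => r⁻¹ * ∫ v in a..w s, elasticaDensity v) (sin (w s) ^ 2) s := by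
  refine (((hasDerivAt_integral_elasticaDensity a (w s)).comp s (hw s)).const_mul r⁻¹).congr_deriv ?_
  have := (zero_lt_one.trans_le (one_le_elasticaSpeed (w s))).ne'
  rw [elasticaDensity]
  field_simp

theorem hasDerivAt_elastica_ordinate (hr : 0 < r)
    (hw : ∀ s, HasDerivAt w (r / 2 * elasticaSpeed (w s)) s) (a s : ℝ) :
    HasDerivAt (fun s => -(2 / r) * (sin (w s) - sin a))
      (-(cos (w s) * elasticaSpeed (w s))) s := by
  refine (((hw s).sin.sub_const (sin a)).const_mul (-(2 / r))).congr_deriv ?_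
  field_simp

theorem hasDerivAt_elastica_abscissa_deriv
    (hw : ∀ s, HasDerivAt w (r / 2 * elasticaSpeed (w s)) s) (s : ℝ) :
    HasDerivAt (fun s => sin (w s) ^ 2)
      (r * (sin (w s) * cos (w s) * elasticaSpeed (w s))) s := by
  refine ((hw s).sin.fun_pow 2).congr_deriv ?_
  push_cast
  ring

theorem hasDerivAt_cos_mul_elasticaSpeed
    (hw : ∀ s, HasDerivAt w (r / 2 * elasticaSpeed (w s)) s) (s : ℝ) :
    HasDerivAt (fun s => cos (w s) * elasticaSpeed (w s)) (-(r * sin (w s) ^ 3)) s := by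
  refine ((hw s).cos.fun_mul ((hasDerivAt_elasticaSpeed (w s)).comp s (hw s))).congr_deriv ?_
  have h := (zero_lt_one.trans_le (one_le_elasticaSpeed (w s))).ne'
  have h2 := elasticaSpeed_sq (w s)
  have h3 := sin_sq_add_cos_sq (w s)
  simp only [Function.comp_apply]
  field_simp
  linear_combination -(r * sin (w s)) * h2 + r * sin (w s) * h3

theorem deriv_deriv_elastica_curvature
    (hw : ∀ s, HasDerivAt w (r / 2 * elasticaSpeed (w s)) s) (s : ℝ) :
    -(2 * deriv (deriv fun s => r * sin (w s)) s) = (r * sin (w s)) ^ 3 := by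
  have h : deriv (fun s => r * sin (w s)) =
      fun s => r ^ 2 / 2 * (cos (w s) * elasticaSpeed (w s)) := funext fun s =>
    (((hw s).sin.const_mul r).congr_deriv (by ring)).deriv
  rw [h, ((hasDerivAt_cos_mul_elasticaSpeed hw s).const_mul _).deriv]
  ring

end ElasticaPhase

/-- A planar curve whose velocity is the rotation by `(c, σ)` of the elastica velocity with phase
`w` has unit speed and curvature `r * sin w`. -/
theorem norm_deriv_eq_one_and_signedCurvature_eq {r c σ : ℝ} {w : ℝ → ℝ}
    {γ : ℝ → EuclideanSpace ℝ (Fin 2)} (hcσ : c ^ 2 + σ ^ 2 = 1)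
    (hw : ∀ s, HasDerivAt w (r / 2 * elasticaSpeed (w s)) s)
    (hγ : ∀ s, HasDerivAt γ
      !₂[c * sin (w s) ^ 2 + σ * (cos (w s) * elasticaSpeed (w s)),
        σ * sin (w s) ^ 2 - c * (cos (w s) * elasticaSpeed (w s))] s) (s : ℝ) :
    ‖deriv γ s‖ = 1 ∧ signedCurvature γ s = r * sin (w s) := by
  have hd : deriv γ = fun s =>
      !₂[c * sin (w s) ^ 2 + σ * (cos (w s) * elasticaSpeed (w s)),
        σ * sin (w s) ^ 2 - c * (cos (w s) * elasticaSpeed (w s))] :=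
    funext fun s => (hγ s).deriv
  have hX := hasDerivAt_elastica_abscissa_deriv hw s
  have hY := hasDerivAt_cos_mul_elasticaSpeed hw s
  have hdd := (hasDerivAt_euclidean_two ((hX.const_mul c).fun_add (hY.const_mul σ))
    ((hX.const_mul σ).fun_sub (hY.const_mul c))).deriv
  have hunit : (sin (w s) ^ 2) ^ 2 + (cos (w s) * elasticaSpeed (w s)) ^ 2 = 1 := by
    rw [mul_pow, elasticaSpeed_sq, cos_sq']
    ring
  constructor
  · rw [hd, EuclideanSpace.norm_eq, Real.sqrt_eq_one]
    simp only [Fin.sum_univ_two, Real.norm_eq_abs, sq_abs, Matrix.cons_val_zero,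
      Matrix.cons_val_one]
    linear_combination (c ^ 2 + σ ^ 2) * hunit + hcσ
  · rw [signedCurvature, hd, hdd]
    simp only [Matrix.cons_val_zero, Matrix.cons_val_one]
    linear_combination r * sin (w s) * (c ^ 2 + σ ^ 2) * hunit + r * sin (w s) * hcσ

theorem dist_sq_euclidean_two_pos {A B : EuclideanSpace ℝ (Fin 2)} (hAB : A ≠ B) :
    0 < (B 0 - A 0) ^ 2 + (B 1 - A 1) ^ 2 := by
  by_contra! h
  refine hAB (PiLp.ext fun i => ?_)
  fin_cases i
  · simp only [Fin.zero_eta]; nlinarith [sq_nonneg (B 0 - A 0), sq_nonneg (B 1 - A 1)]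
  · simp only [Fin.mk_one]; nlinarith [sq_nonneg (B 0 - A 0), sq_nonneg (B 1 - A 1)]

/-- For any `A ≠ B`, any prescribed boundary curvatures `κ₁, κ₂` and any energy level
`E > 0`, the Navier problem admits a Willmore curve solution with Willmore energy
exceeding `E`; in particular it has infinitely many solutions with energies
tending to `+∞`. -/
theorem navier_problem_solutions_with_large_energy
    (A B : EuclideanSpace ℝ (Fin 2)) (hAB : A ≠ B) (κ₁ κ₂ : ℝ) (E : ℝ) (hE : 0 < E) :
    ∃ (L : ℝ) (γ : ℝ → EuclideanSpace ℝ (Fin 2)),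
      0 < L ∧ ContDiff ℝ (⊤ : ℕ∞) γ ∧
      (∀ s ∈ Set.Icc (0 : ℝ) L, ‖deriv γ s‖ = 1) ∧
      (∀ s ∈ Set.Icc (0 : ℝ) L,
        -(2 * deriv (deriv (signedCurvature γ)) s) = (signedCurvature γ s) ^ 3) ∧
      γ 0 = A ∧ γ L = B ∧
      signedCurvature γ 0 = κ₁ ∧ signedCurvature γ L = κ₂ ∧
      (1 / 2) * (∫ s in (0 : ℝ)..L, (signedCurvature γ s) ^ 2) > E := by
  set d : ℝ := √((B 0 - A 0) ^ 2 + (B 1 - A 1) ^ 2) with hd_def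
  have hD := dist_sq_euclidean_two_pos hAB
  have hd : 0 < d := Real.sqrt_pos.2 hD
  have hd2 : d ^ 2 = (B 0 - A 0) ^ 2 + (B 1 - A 1) ^ 2 := Real.sq_sqrt hD.le
  obtain ⟨r, a, b, hRr, hab, hra, hrb, hJ, heq⟩ :=
    exists_amplitude_and_phases hd κ₁ κ₂ (1 + (2 * E + 2 * |κ₂ - κ₁|) / d)
  set J := ∫ v in a..b, elasticaDensity v with hJ_def
  have hfrac : 0 ≤ (2 * E + 2 * |κ₂ - κ₁|) / d := by positivity
  have hr1 : 1 ≤ r := by linarith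
  have hr : 0 < r := by linarith
  obtain ⟨w, hw_smooth, hw, hw0, hwL⟩ := exists_elastica_phase hr a
  obtain ⟨L, hL, hwL⟩ := hwL b hab
  have hend : (r⁻¹ * J) ^ 2 + (-(2 / r) * (sin b - sin a)) ^ 2 =
      (B 0 - A 0) ^ 2 + (B 1 - A 1) ^ 2 := by
    rw [← hd2]
    rw [← hra, ← hrb] at heq
    field_simp
    refine mul_left_cancel₀ (pow_ne_zero 2 hr.ne') ?_
    linear_combination heq
  obtain ⟨c, σ, hcσ, hB0, hB1⟩ := exists_rotation hend hD
  set x : ℝ → ℝ := fun s => r⁻¹ * ∫ v in a..w s, elasticaDensity v with hx_def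
  set y : ℝ → ℝ := fun s => -(2 / r) * (sin (w s) - sin a) with hy_def
  have hx' : ∀ s, HasDerivAt x (sin (w s) ^ 2) s := hasDerivAt_elastica_abscissa hr hw a
  have hy' : ∀ s, HasDerivAt y (-(cos (w s) * elasticaSpeed (w s))) s :=
    hasDerivAt_elastica_ordinate hr hw a
  have hy_smooth : ContDiff ℝ (⊤ : ℕ∞) y :=
    contDiff_const.mul ((contDiff_sin.comp hw_smooth).sub contDiff_const)
  have hx_smooth : ContDiff ℝ (⊤ : ℕ∞) x := by
    refine contDiff_infty_iff_deriv.2 ⟨fun s => (hx' s).differentiableAt, ?_⟩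
    rw [show deriv x = fun s => sin (w s) ^ 2 from funext fun s => (hx' s).deriv]
    exact (contDiff_sin.comp hw_smooth).pow 2
  set γ : ℝ → EuclideanSpace ℝ (Fin 2) := fun s =>
    !₂[A 0 + (c * x s - σ * y s), A 1 + (σ * x s + c * y s)] with hγ_def
  have hγ' : ∀ s, HasDerivAt γ
      !₂[c * sin (w s) ^ 2 + σ * (cos (w s) * elasticaSpeed (w s)),
        σ * sin (w s) ^ 2 - c * (cos (w s) * elasticaSpeed (w s))] s := fun s =>
    hasDerivAt_euclidean_two
      (((((hx' s).const_mul c).fun_sub ((hy' s).const_mul σ)).const_add (A 0)).congr_deriv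
        (by ring))
      (((((hx' s).const_mul σ).fun_add ((hy' s).const_mul c)).const_add (A 1)).congr_deriv
        (by ring))
  have hγ := norm_deriv_eq_one_and_signedCurvature_eq hcσ hw hγ'
  have hκ : signedCurvature γ = fun s => r * sin (w s) := funext fun s => (hγ s).2
  have hx0 : x 0 = 0 := by simp [hx_def, hw0]
  have hy0 : y 0 = 0 := by simp [hy_def, hw0]
  have hxL : x L = r⁻¹ * J := by simp [hx_def, hwL, hJ_def]
  have hyL : y L = -(2 / r) * (sin b - sin a) := by simp only [hy_def, hwL]
  refine ⟨L, γ, hL, ?_, fun s _ => (hγ s).1, fun s _ => ?_, ?_, ?_, ?_, ?_, ?_⟩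
  · refine contDiff_euclidean.2 fun i => ?_
    fin_cases i
    · exact contDiff_const.add ((contDiff_const.mul hx_smooth).sub (contDiff_const.mul hy_smooth))
    · exact contDiff_const.add ((contDiff_const.mul hx_smooth).add (contDiff_const.mul hy_smooth))
  · rw [hκ]
    exact deriv_deriv_elastica_curvature hw s
  · refine PiLp.ext fun i => ?_
    fin_cases i <;> simp [hγ_def, hx0, hy0]
  · refine PiLp.ext fun i => ?_
    fin_cases i
    · simp [hγ_def, hxL, hyL, hB0, -neg_mul]
    · simp [hγ_def, hxL, hyL, hB1, -neg_mul]
  · rw [hκ]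
    simp only [hw0, hra]
  · rw [hκ]
    simp only [hwL, hrb]
  · have hint : ∫ s in (0 : ℝ)..L, signedCurvature γ s ^ 2 = r * J := by
      have hcont : Continuous fun s => r ^ 2 * sin (w s) ^ 2 :=
        continuous_const.mul ((continuous_sin.comp hw_smooth.continuous).pow 2)
      simp only [hκ, mul_pow]
      rw [intervalIntegral.integral_eq_sub_of_hasDerivAt
        (fun s _ => (hx' s).const_mul (r ^ 2)) (hcont.intervalIntegrable _ _), hxL, hx0]
      field_simp
      ring
    rw [hint]
    have hdr : 2 * E + 2 * |κ₂ - κ₁| < d * r := by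
      rw [← div_lt_iff₀' hd]
      linarith
    linarith [lt_mul_of_amplitude_relation hE.le hr1 hJ hdr heq]
end

section
/- Let A, B ∈ ℝ² with A ≠ B. Then there exist L > 0 and a smooth unit-speed curve γ : [0,L] → ℝ² whose curvature κ(s) := det(γ'(s), γ''(s)) satisfies −2κ'' = κ³ on [0,L], such that γ(0) = A, γ(L) = B, κ(0) = 0, κ(L) = 0, and κ is not identically zero on [0,L]. That is, besides the straight segment, the symmetric Navier problem with vanishing boundary curvatures admits a nontrivial Willmore curve solution. -/
open scoped ContDiff

/-- The primitive of a smooth function is smooth. -/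
theorem contDiff_infty_intervalIntegral {f : ℝ → ℝ} (hf : ContDiff ℝ ∞ f) (a : ℝ) :
    ContDiff ℝ ∞ (fun t => ∫ u in a..t, f u) := by
  have h : ∀ t, HasDerivAt (fun t => ∫ u in a..t, f u) (f t) t :=
    fun t => hf.continuous.integral_hasStrictDerivAt a t |>.hasDerivAt
  rw [contDiff_infty_iff_deriv, show deriv (fun t => ∫ u in a..t, f u) = f from
    funext fun t => (h t).deriv]
  exact ⟨fun t => (h t).differentiableAt, hf⟩

/-- If `f` is smooth with `1 ≤ f`, the initial value problem `φ' = 1 / f(φ)`, `φ(0) = 0` has a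
smooth, strictly increasing, surjective solution on the whole line. -/
theorem exists_contDiff_hasDerivAt_inv {f : ℝ → ℝ} (hf : ContDiff ℝ ∞ f) (hf1 : ∀ t, 1 ≤ f t) :
    ∃ φ : ℝ → ℝ, ContDiff ℝ ∞ φ ∧ φ 0 = 0 ∧ StrictMono φ ∧ Function.Surjective φ ∧
      ∀ s, HasDerivAt φ (f (φ s))⁻¹ s := by
  set F : ℝ → ℝ := fun t => ∫ u in (0 : ℝ)..t, f u with hF
  have hF' : ∀ t, HasDerivAt F (f t) t :=
    fun t => hf.continuous.integral_hasStrictDerivAt 0 t |>.hasDerivAt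
  have hpos : ∀ t, 0 < f t := fun t => one_pos.trans_le (hf1 t)
  have hF0 : F 0 = 0 := by simp [hF]
  have hcont : Continuous F := continuous_iff_continuousAt.2 fun t => (hF' t).continuousAt
  have hmono : StrictMono F := strictMono_of_hasDerivAt_pos hF' hpos
  have hsub : Monotone fun t => F t - t :=
    monotone_of_hasDerivAt_nonneg (fun t => (hF' t).sub (hasDerivAt_id t))
      fun t => sub_nonneg.2 (hf1 t)
  have hsurj : Function.Surjective F := by
    refine hcont.surjective ?_ ?_
    · refine Filter.tendsto_atTop_mono' _ ?_ Filter.tendsto_id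
      filter_upwards [Filter.eventually_ge_atTop 0] with t ht
      have := hsub ht
      simp only [hF0] at this
      simp only [id]
      linarith
    · refine Filter.tendsto_atBot_mono' _ ?_ Filter.tendsto_id
      filter_upwards [Filter.eventually_le_atBot 0] with t ht
      have := hsub ht
      simp only [hF0] at this
      simp only [id]
      linarith
  let e : ℝ ≃o ℝ := hmono.orderIsoOfSurjective F hsurj
  have he : ∀ t, e t = F t := fun t => rfl
  have hsmooth : ContDiff ℝ ∞ e.symm :=
    Homeomorph.contDiff_symm_deriv (f := e.toHomeomorph) (fun t => (hpos t).ne') hF'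
      (contDiff_infty_intervalIntegral hf 0)
  refine ⟨e.symm, hsmooth, ?_, e.symm.strictMono, e.symm.surjective, fun s => ?_⟩
  · rw [OrderIso.symm_apply_eq, he, hF0]
  · exact HasDerivAt.of_local_left_inverse e.symm.continuous.continuousAt (hF' _) (hpos _).ne'
      (Filter.Eventually.of_forall fun y => e.apply_symm_apply y)

/-- The rectangular elastica: a smooth unit-speed curve `(x, k)` on the whole line whose curvature
is `-k`, with `k'' = -k³/2`, and whose second coordinate vanishes at `0` and at some `L > 0`. -/
theorem exists_rectangular_elastica :
    ∃ (L : ℝ) (x k k' : ℝ → ℝ), 0 < L ∧ ContDiff ℝ ∞ x ∧ ContDiff ℝ ∞ k ∧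
      (∀ s, HasDerivAt x (k s ^ 2 / 2) s) ∧ (∀ s, HasDerivAt k (k' s) s) ∧
      (∀ s, HasDerivAt k' (-(k s ^ 3 / 2)) s) ∧ (∀ s, k' s ^ 2 + k s ^ 4 / 4 = 1) ∧
      x 0 = 0 ∧ 0 < x L ∧ k 0 = 0 ∧ k L = 0 ∧ ∃ s ∈ Set.Icc 0 L, k s ≠ 0 := by
  have hr : ∀ t : ℝ, 0 < 1 + Real.sin t ^ 2 := fun t => by positivity
  have h2 : √(2 : ℝ) ^ 2 = 2 := Real.sq_sqrt zero_le_two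
  have h2' : √(2 : ℝ) ≠ 0 := by positivity
  have hr2 : ∀ t : ℝ, √(1 + Real.sin t ^ 2) ^ 2 = 1 + Real.sin t ^ 2 :=
    fun t => Real.sq_sqrt (hr t).le
  have hr0 : ∀ t : ℝ, √(1 + Real.sin t ^ 2) ≠ 0 := fun t => (Real.sqrt_pos.2 (hr t)).ne'
  obtain ⟨φ, hφ, hφ0, hmono, hsurj, hφ'⟩ :=
    exists_contDiff_hasDerivAt_inv (f := fun t => √2 / √(1 + Real.sin t ^ 2))
      (contDiff_const.div ((contDiff_const.add (Real.contDiff_sin.pow 2)).sqrt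
        fun t => (hr t).ne') hr0)
      (fun t => by
        rw [one_le_div (Real.sqrt_pos.2 (hr t))]
        exact Real.sqrt_le_sqrt (by linarith [Real.sin_sq_le_one t]))
  obtain ⟨L, hL⟩ := hsurj Real.pi
  obtain ⟨m, hm⟩ := hsurj (Real.pi / 2)
  have hm0 : 0 < m := hmono.lt_iff_lt.1 (by rw [hφ0, hm]; positivity)
  have hmL : m < L := hmono.lt_iff_lt.1 (by rw [hL, hm]; linarith [Real.pi_pos])
  have hk : ContDiff ℝ ∞ fun s => √2 * Real.sin (φ s) :=
    contDiff_const.mul (Real.contDiff_sin.comp hφ)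
  have hkm : √2 * Real.sin (φ m) ≠ 0 := by simp [hm]
  have hsq : ContDiff ℝ ∞ fun s => (√2 * Real.sin (φ s)) ^ 2 / 2 := (hk.pow 2).div_const 2
  refine ⟨L, fun s => ∫ u in (0 : ℝ)..s, (√2 * Real.sin (φ u)) ^ 2 / 2,
    fun s => √2 * Real.sin (φ s), fun s => Real.cos (φ s) * √(1 + Real.sin (φ s) ^ 2),
    hm0.trans hmL, contDiff_infty_intervalIntegral hsq 0, hk,
    fun s => (hsq.continuous.integral_hasStrictDerivAt 0 s).hasDerivAt, fun s => ?_, fun s => ?_,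
    fun s => ?_, by simp, ?_, by simp [hφ0], by simp [hL], m, ⟨hm0.le, hmL.le⟩, hkm⟩
  · refine ((hφ' s).sin.const_mul √2).congr_deriv ?_
    have := hr0 (φ s)
    field_simp
  · refine ((hφ' s).cos.mul ((((hφ' s).sin.pow 2).const_add 1).sqrt
      (hr (φ s)).ne')).congr_deriv ?_
    have h0 := hr0 (φ s)
    have h1 := hr2 (φ s)
    have h3 := Real.sin_sq_add_cos_sq (φ s)
    simp only [Pi.pow_apply]
    generalize √(1 + Real.sin (φ s) ^ 2) = r at *
    generalize Real.sin (φ s) = a at *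
    generalize Real.cos (φ s) = c at *
    generalize √(2 : ℝ) = q at *
    have hc : c ^ 2 = 1 - a ^ 2 := by linarith
    have hq4 : q ^ 4 = 4 := by rw [show q ^ 4 = (q ^ 2) ^ 2 by ring, h2]; norm_num
    field_simp
    ring_nf
    rw [hc, h1, hq4]
    ring
  · have h1 := hr2 (φ s)
    have h3 := Real.cos_sq' (φ s)
    have hq4 : √(2 : ℝ) ^ 4 = 4 := by rw [show √(2 : ℝ) ^ 4 = (√2 ^ 2) ^ 2 by ring, h2]; norm_num
    rw [mul_pow, mul_pow, h1, h3, hq4]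
    ring
  · exact intervalIntegral.integral_pos (hm0.trans hmL) hsq.continuous.continuousOn
      (fun s _ => by positivity) ⟨m, ⟨hm0.le, hmL.le⟩, by positivity⟩


/-- For any `A ≠ B`, besides the straight segment the symmetric Navier problem with
vanishing boundary curvatures admits a nontrivial Willmore curve solution. -/
theorem symmetric_navier_problem_nontrivial_solution
    (A B : EuclideanSpace ℝ (Fin 2)) (hAB : A ≠ B) :
    ∃ (L : ℝ) (γ : ℝ → EuclideanSpace ℝ (Fin 2)),
      0 < L ∧ ContDiff ℝ (⊤ : ℕ∞) γ ∧
      (∀ s ∈ Set.Icc (0 : ℝ) L, ‖deriv γ s‖ = 1) ∧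
      (∀ s ∈ Set.Icc (0 : ℝ) L,
        -(2 * deriv (deriv (signedCurvature γ)) s) = (signedCurvature γ s) ^ 3) ∧
      γ 0 = A ∧ γ L = B ∧
      signedCurvature γ 0 = 0 ∧ signedCurvature γ L = 0 ∧
      (∃ s ∈ Set.Icc (0 : ℝ) L, signedCurvature γ s ≠ 0) := by
  obtain ⟨L, x, k, k', hL, hxs, hks, hx, hk, hk', hunit, hx0, hxL, hk0, hkL, s₀, hs₀, hks₀⟩ :=
    exists_rectangular_elastica
  have hv : B - A ≠ 0 := sub_ne_zero.2 hAB.symm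
  set r : ℝ := ‖B - A‖ / x L with hr
  have hr0 : 0 < r := div_pos (norm_pos_iff.2 hv) hxL
  set v : EuclideanSpace ℝ (Fin 2) := (x L)⁻¹ • (B - A) with hvdef
  set w : EuclideanSpace ℝ (Fin 2) := !₂[-v 1, v 0] with hw
  have hw0 : w 0 = -v 1 := rfl
  have hw1 : w 1 = v 0 := rfl
  have hvr : v 0 ^ 2 + v 1 ^ 2 = r ^ 2 := by
    have : ‖v‖ = r := by
      rw [hvdef, norm_smul, norm_inv, Real.norm_of_nonneg hxL.le, hr, div_eq_inv_mul]
    rw [← this, EuclideanSpace.real_norm_sq_eq, Fin.sum_univ_two]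
  have hscale : ∀ {f : ℝ → ℝ} {f' : ℝ → ℝ}, (∀ s, HasDerivAt f (f' s) s) →
      ∀ s, HasDerivAt (fun s => f (s / r)) (f' (s / r) / r) s := fun {f f'} hf s => by
    exact ((hf (s / r)).comp s ((hasDerivAt_id s).div_const r)).congr_deriv (by ring)
  let γ : ℝ → EuclideanSpace ℝ (Fin 2) := fun s => A + (x (s / r) • v + k (s / r) • w)
  have hγ' : deriv γ = fun s => (k (s / r) ^ 2 / 2 / r) • v + (k' (s / r) / r) • w :=
    funext fun s => ((((hscale hx s).smul_const v).add
      ((hscale hk s).smul_const w)).const_add A).deriv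
  have hγ'' : deriv (deriv γ) = fun s =>
      (k (s / r) * k' (s / r) / r / r) • v + (-(k (s / r) ^ 3 / 2) / r / r) • w := by
    rw [hγ']
    refine funext fun s => HasDerivAt.deriv ?_
    have h1 : ∀ s, HasDerivAt (fun s => k s ^ 2 / 2) (k s * k' s) s := fun s => by
      refine (((hk s).pow 2).div_const 2).congr_deriv ?_
      push_cast
      ring
    exact (((hscale h1 s).div_const r).smul_const v).add
      (((hscale hk' s).div_const r).smul_const w)
  have hcurv : signedCurvature γ = fun s => -k (s / r) / r := by
    funext s
    have h1 := hunit (s / r)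
    rw [signedCurvature, hγ'', hγ']
    simp only [PiLp.add_apply, PiLp.smul_apply, smul_eq_mul, hw0, hw1]
    generalize k (s / r) = a at *
    generalize k' (s / r) = b at *
    generalize v 0 = p at *
    generalize v 1 = q at *
    have : -a / r = -a * (b ^ 2 + a ^ 4 / 4) * (p ^ 2 + q ^ 2) / r ^ 3 := by
      rw [h1, hvr]
      field_simp
    rw [this]
    field_simp
    ring
  have hcurv' : deriv (signedCurvature γ) = fun s => -(k' (s / r) / r) / r := by
    rw [hcurv]
    exact funext fun s => ((hscale hk s).neg.div_const r).deriv
  have hcurv'' : deriv (deriv (signedCurvature γ)) = fun s => k (s / r) ^ 3 / 2 / r ^ 3 := by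
    rw [hcurv']
    refine funext fun s => HasDerivAt.deriv ?_
    refine ((hscale hk' s).div_const r).neg.div_const r |>.congr_deriv ?_
    field_simp
  have hrL : r * L / r = L := mul_div_cancel_left₀ L hr0.ne'
  refine ⟨r * L, γ, mul_pos hr0 hL, ?_, fun s _ => ?_, fun s _ => ?_, ?_, ?_, ?_, ?_, r * s₀,
    ⟨mul_nonneg hr0.le hs₀.1, mul_le_mul_of_nonneg_left hs₀.2 hr0.le⟩, ?_⟩
  · have hd : ContDiff ℝ ∞ fun s : ℝ => s / r := contDiff_id.div_const r
    exact contDiff_const.add (((hxs.comp hd).smul contDiff_const).add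
      ((hks.comp hd).smul contDiff_const))
  · have h1 := hunit (s / r)
    rw [← sq_eq_sq₀ (norm_nonneg _) zero_le_one, EuclideanSpace.real_norm_sq_eq, Fin.sum_univ_two]
    simp only [hγ', PiLp.add_apply, PiLp.smul_apply, smul_eq_mul, hw0, hw1]
    generalize k (s / r) = a at *
    generalize k' (s / r) = b at *
    generalize v 0 = p at *
    generalize v 1 = q at *
    have : (1 : ℝ) ^ 2 = (b ^ 2 + a ^ 4 / 4) * (p ^ 2 + q ^ 2) / r ^ 2 := by
      rw [h1, hvr]
      field_simp
    rw [this]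
    field_simp
    ring
  · rw [hcurv'', hcurv]
    field_simp
  · simp [γ, hx0, hk0]
  · simp only [γ, hrL, hkL, zero_smul, add_zero, hvdef, smul_smul, mul_inv_cancel₀ hxL.ne',
      one_smul, add_sub_cancel]
  · simp [hcurv, hk0]
  · simp [hcurv, hrL, hkL]
  · simp [hcurv, mul_div_cancel_left₀ s₀ hr0.ne', hks₀, hr0.ne']
end

section
/- Let A, B ∈ ℝ² with A ≠ B, let κ ∈ ℝ with κ ≠ 0, and set M₀ := sup_{z∈[0,1]} 4z·∫_z¹ t²/√(1−t⁴) dt. If |κ|·‖B−A‖ < M₀, then there exist two solutions of the symmetric Navier problem with data (A, B, κ) — i.e. two pairs (L₁, γ₁), (L₂, γ₂) where each γᵢ : [0,Lᵢ] → ℝ² is a smooth unit-speed curve with curvature κᵢ := det(γᵢ', γᵢ'') satisfying −2κᵢ'' = κᵢ³, γᵢ(0) = A, γᵢ(Lᵢ) = B, κᵢ(0) = κᵢ(Lᵢ) = κ — whose Willmore energies (1/2)∫₀^{Lᵢ} κᵢ(s)² ds are distinct. -/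
open Real Set MeasureTheory intervalIntegral

/-- The arclength of the rectangular elastica `y = cos φ`, as a function of the amplitude `φ`. -/
noncomputable def elasticaArclength (x : ℝ) : ℝ :=
  ∫ t in (0 : ℝ)..x, (√(1 + cos t ^ 2))⁻¹

/-- The abscissa of the rectangular elastica `y = cos φ`, as a function of the amplitude `φ`. -/
noncomputable def elasticaAbscissa (x : ℝ) : ℝ :=
  ∫ t in (0 : ℝ)..x, cos t ^ 2 * (√(1 + cos t ^ 2))⁻¹

lemma sqrt_one_add_cos_sq_pos (t : ℝ) : 0 < √(1 + cos t ^ 2) :=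
  sqrt_pos.2 (by positivity)

lemma continuous_inv_sqrt_one_add_cos_sq : Continuous fun t : ℝ => (√(1 + cos t ^ 2))⁻¹ :=
  Continuous.inv₀ (by fun_prop) fun t => (sqrt_one_add_cos_sq_pos t).ne'

lemma hasDerivAt_elasticaArclength (x : ℝ) :
    HasDerivAt elasticaArclength (√(1 + cos x ^ 2))⁻¹ x :=
  (continuous_inv_sqrt_one_add_cos_sq.integral_hasStrictDerivAt 0 x).hasDerivAt

lemma continuous_elasticaAbscissa_integrand :
    Continuous fun t : ℝ => cos t ^ 2 * (√(1 + cos t ^ 2))⁻¹ :=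
  (by fun_prop : Continuous fun t : ℝ => cos t ^ 2).mul continuous_inv_sqrt_one_add_cos_sq

lemma hasDerivAt_elasticaAbscissa (x : ℝ) :
    HasDerivAt elasticaAbscissa (cos x ^ 2 * (√(1 + cos x ^ 2))⁻¹) x :=
  (continuous_elasticaAbscissa_integrand.integral_hasStrictDerivAt 0 x).hasDerivAt

lemma elasticaArclength_neg (x : ℝ) : elasticaArclength (-x) = -elasticaArclength x := by
  have h := integral_comp_neg (a := 0) (b := x) fun t : ℝ => (√(1 + cos t ^ 2))⁻¹
  simp only [cos_neg, neg_zero] at h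
  rw [elasticaArclength, elasticaArclength, h, integral_symm]

lemma elasticaAbscissa_neg (x : ℝ) : elasticaAbscissa (-x) = -elasticaAbscissa x := by
  have h := integral_comp_neg (a := 0) (b := x)
    fun t : ℝ => cos t ^ 2 * (√(1 + cos t ^ 2))⁻¹
  simp only [cos_neg, neg_zero] at h
  rw [elasticaAbscissa, elasticaAbscissa, h, integral_symm]

lemma elasticaArclength_zero : elasticaArclength 0 = 0 := integral_same

lemma elasticaAbscissa_zero : elasticaAbscissa 0 = 0 := integral_same

lemma strictMono_elasticaArclength : StrictMono elasticaArclength :=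
  strictMono_of_hasDerivAt_pos hasDerivAt_elasticaArclength fun x =>
    inv_pos.2 (sqrt_one_add_cos_sq_pos x)

lemma continuous_elasticaArclength : Continuous elasticaArclength :=
  continuous_iff_continuousAt.2 fun x => (hasDerivAt_elasticaArclength x).continuousAt

lemma continuous_elasticaAbscissa : Continuous elasticaAbscissa :=
  continuous_iff_continuousAt.2 fun x => (hasDerivAt_elasticaAbscissa x).continuousAt

lemma half_mul_le_elasticaArclength {x : ℝ} (hx : 0 ≤ x) : x / 2 ≤ elasticaArclength x := by
  have h : ∫ _ in (0 : ℝ)..x, (1 / 2 : ℝ) ≤ elasticaArclength x := by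
    refine integral_mono_on hx (by simp)
      (continuous_inv_sqrt_one_add_cos_sq.intervalIntegrable _ _) fun t _ => ?_
    rw [one_div]
    refine inv_anti₀ (sqrt_one_add_cos_sq_pos t) ?_
    rw [sqrt_le_left (by norm_num)]
    nlinarith [cos_sq_le_one t]
  simpa [div_eq_mul_inv] using h

lemma surjective_elasticaArclength : Function.Surjective elasticaArclength := by
  have htop : Filter.Tendsto elasticaArclength Filter.atTop Filter.atTop :=
    Filter.tendsto_atTop_mono' _
      ((Filter.eventually_ge_atTop 0).mono fun _ => half_mul_le_elasticaArclength)
      (Filter.tendsto_id.atTop_div_const two_pos)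
  refine continuous_elasticaArclength.surjective htop ?_
  have h := Filter.tendsto_neg_atTop_atBot.comp (htop.comp Filter.tendsto_neg_atBot_atTop)
  refine h.congr fun x => ?_
  simp [elasticaArclength_neg]

lemma strictMonoOn_elasticaAbscissa : StrictMonoOn elasticaAbscissa (Icc 0 (π / 2)) := by
  refine strictMonoOn_of_deriv_pos (convex_Icc _ _) continuous_elasticaAbscissa.continuousOn
    fun x hx => ?_
  rw [interior_Icc] at hx
  rw [(hasDerivAt_elasticaAbscissa x).deriv]
  have := cos_pos_of_mem_Ioo ⟨by linarith [hx.1, pi_pos], hx.2⟩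
  have := sqrt_one_add_cos_sq_pos x
  positivity

/-- The arclength function has a smooth inverse, which solves `φ' = √(1 + cos² φ)`. -/
lemma exists_elasticaAmplitude : ∃ φ : ℝ → ℝ, (∀ x, φ (elasticaArclength x) = x) ∧
    ContDiff ℝ (⊤ : ℕ∞) φ ∧ ∀ s, HasDerivAt φ (√(1 + cos (φ s) ^ 2)) s := by
  let e := strictMono_elasticaArclength.orderIsoOfSurjective _ surjective_elasticaArclength
  have he : ∀ s, elasticaArclength (e.symm s) = s := e.apply_symm_apply
  have hderiv : ∀ s, HasDerivAt e.symm (√(1 + cos (e.symm s) ^ 2)) s := fun s => by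
    simpa using (hasDerivAt_elasticaArclength (e.symm s)).of_local_left_inverse
      e.symm.continuous.continuousAt (inv_ne_zero (sqrt_one_add_cos_sq_pos _).ne')
      (Filter.Eventually.of_forall he)
  refine ⟨e.symm, e.symm_apply_apply, ?_, hderiv⟩
  refine contDiff_infty.2 fun n => ?_
  induction n with
  | zero => exact contDiff_zero.2 e.symm.continuous
  | succ n ih =>
    push_cast
    refine contDiff_succ_iff_deriv.2 ⟨fun s => (hderiv s).differentiableAt, by simp, ?_⟩
    rw [funext fun s => (hderiv s).deriv]
    exact (contDiff_const.add ((contDiff_cos.comp ih).pow 2)).sqrt fun s => by positivity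

/-- The rectangular elastica `(X, -u)` parametrized by arclength; it has curvature `2 u`. -/
lemma exists_rectangular_elastica_s15 : ∃ X u v : ℝ → ℝ,
    ContDiff ℝ (⊤ : ℕ∞) X ∧ ContDiff ℝ (⊤ : ℕ∞) u ∧
    (∀ s, HasDerivAt X (u s ^ 2) s) ∧ (∀ s, HasDerivAt u (-v s) s) ∧
    (∀ s, HasDerivAt v (2 * u s ^ 3) s) ∧ (∀ s, u s ^ 4 + v s ^ 2 = 1) ∧
    (∀ x, X (elasticaArclength x) = elasticaAbscissa x) ∧
    ∀ x, u (elasticaArclength x) = cos x := by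
  obtain ⟨φ, hφ, hsmooth, hderiv⟩ := exists_elasticaAmplitude
  have hX : ∀ s, HasDerivAt (fun s => elasticaAbscissa (φ s)) (cos (φ s) ^ 2) s := fun s => by
    have h := (hasDerivAt_elasticaAbscissa (φ s)).comp s (hderiv s)
    rwa [mul_assoc, inv_mul_cancel₀ (sqrt_one_add_cos_sq_pos _).ne', mul_one] at h
  have hu : ContDiff ℝ (⊤ : ℕ∞) fun s => cos (φ s) := contDiff_cos.comp hsmooth
  refine ⟨fun s => elasticaAbscissa (φ s), fun s => cos (φ s),
    fun s => sin (φ s) * √(1 + cos (φ s) ^ 2), ?_, hu, hX, fun s => ?_, fun s => ?_,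
    fun s => ?_, fun x => by simp only [hφ], fun x => by simp only [hφ]⟩
  · refine contDiff_infty_iff_deriv.2 ⟨fun s => (hX s).differentiableAt, ?_⟩
    rw [funext fun s => (hX s).deriv]
    exact hu.pow 2
  · simpa using (hderiv s).cos
  · have hne := (sqrt_one_add_cos_sq_pos (φ s)).ne'
    have hsq : √(1 + cos (φ s) ^ 2) ^ 2 = 1 + cos (φ s) ^ 2 := sq_sqrt (by positivity)
    refine ((hderiv s).sin.mul
      (((hderiv s).cos.pow 2).const_add 1 |>.sqrt (by simp; positivity))).congr_deriv ?_
    simp only [Pi.pow_apply]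
    field_simp
    push_cast
    linear_combination 2 * cos (φ s) * hsq - 2 * cos (φ s) * sin_sq_add_cos_sq (φ s)
  · have hsq : √(1 + cos (φ s) ^ 2) ^ 2 = 1 + cos (φ s) ^ 2 := sq_sqrt (by positivity)
    simp only [mul_pow, hsq, sin_sq]
    ring

/-- The threshold integral, written in terms of the amplitude. -/
lemma integral_sq_div_sqrt_eq_elasticaAbscissa {z : ℝ} (hz : z ∈ Icc (0 : ℝ) 1) :
    ∫ t in z..1, t ^ 2 / √(1 - t ^ 4) = elasticaAbscissa (arccos z) := by
  have hπ : arccos z ≤ π := arccos_le_pi z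
  have hanti : StrictAntiOn cos (Ioo 0 (arccos z)) :=
    strictAntiOn_cos.mono fun x hx => ⟨hx.1.le, hx.2.le.trans hπ⟩
  have himage : cos '' Ioo 0 (arccos z) = Ioo z 1 := by
    ext t
    constructor
    · rintro ⟨x, hx, rfl⟩
      refine ⟨?_, ?_⟩
      · have := cos_lt_cos_of_nonneg_of_le_pi hx.1.le hπ hx.2
        rwa [cos_arccos (by linarith [hz.1]) hz.2] at this
      · have := cos_lt_cos_of_nonneg_of_le_pi le_rfl (hx.2.le.trans hπ) hx.1
        rwa [cos_zero] at this
    · rintro ⟨h1, h2⟩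
      have h0 := hz.1
      exact ⟨arccos t, ⟨arccos_pos.2 h2, arccos_lt_arccos (by linarith) h1 h2.le⟩,
        cos_arccos (by linarith) h2.le⟩
  rw [elasticaAbscissa, integral_of_le hz.2, integral_of_le (arccos_nonneg z),
    integral_Ioc_eq_integral_Ioo, integral_Ioc_eq_integral_Ioo, ← himage,
    integral_image_eq_integral_abs_deriv_smul measurableSet_Ioo
      (fun x _ => (hasDerivAt_cos x).hasDerivWithinAt) hanti.injOn]
  refine setIntegral_congr_fun measurableSet_Ioo fun x hx => ?_
  have hsin : 0 < sin x := sin_pos_of_pos_of_lt_pi hx.1 (hx.2.trans_le hπ)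
  have hsqrt : √(1 - cos x ^ 4) = sin x * √(1 + cos x ^ 2) := by
    rw [show 1 - cos x ^ 4 = sin x ^ 2 * (1 + cos x ^ 2) by rw [sin_sq]; ring,
      sqrt_mul (sq_nonneg _), sqrt_sq hsin.le]
  have := sqrt_one_add_cos_sq_pos x
  simp only [abs_neg, abs_of_pos hsin, smul_eq_mul, hsqrt]
  field_simp

lemma hasDerivAt_euclidean {ι : Type*} [Fintype ι] {f : ℝ → EuclideanSpace ℝ ι}
    {f' : EuclideanSpace ℝ ι} {s : ℝ} (h : ∀ i, HasDerivAt (fun s => f s i) (f' i) s) :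
    HasDerivAt f f' s :=
  (PiLp.continuousLinearEquiv 2 ℝ fun _ : ι => ℝ).symm.hasFDerivAt.comp_hasDerivAt s
    (hasDerivAt_pi.2 h)

/-- A rescaled and rotated symmetric arc of the rectangular elastica solves the symmetric Navier
problem as soon as its half amplitude `x` matches the data. -/
lemma exists_symmetric_navier_solution {A B : EuclideanSpace ℝ (Fin 2)} (hAB : A ≠ B)
    {κ x : ℝ} (hcos : 0 < cos x) (hκx : 0 < κ * x)
    (hx : 4 * cos x * elasticaAbscissa x = κ * ‖B - A‖) :
    ∃ (L : ℝ) (γ : ℝ → EuclideanSpace ℝ (Fin 2)),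
      (0 < L ∧ ContDiff ℝ (⊤ : ℕ∞) γ ∧
        (∀ s ∈ Icc (0 : ℝ) L, ‖deriv γ s‖ = 1) ∧
        (∀ s ∈ Icc (0 : ℝ) L,
          -(2 * deriv (deriv (signedCurvature γ)) s) = (signedCurvature γ s) ^ 3) ∧
        γ 0 = A ∧ γ L = B ∧
        signedCurvature γ 0 = κ ∧ signedCurvature γ L = κ) ∧
      (1 / 2) * (∫ s in (0 : ℝ)..L, (signedCurvature γ s) ^ 2) =
        2 * κ * elasticaAbscissa x / cos x := by
  obtain ⟨X, u, v, hXs, hus, hX, hu, hv, huv, hXS, huS⟩ := exists_rectangular_elastica_s15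
  have hκ : κ ≠ 0 := left_ne_zero_of_mul hκx.ne'
  have hd : 0 < ‖B - A‖ := norm_pos_iff.2 (sub_ne_zero.2 hAB.symm)
  set d := ‖B - A‖ with hd_def
  have hd2 : (B 0 - A 0) ^ 2 + (B 1 - A 1) ^ 2 = d ^ 2 := by
    rw [hd_def, EuclideanSpace.norm_sq_eq]
    simp
  obtain ⟨a, ha⟩ : ∃ a, a * d = B 0 - A 0 := ⟨(B 0 - A 0) / d, div_mul_cancel₀ _ hd.ne'⟩
  obtain ⟨b, hb⟩ : ∃ b, b * d = B 1 - A 1 := ⟨(B 1 - A 1) / d, div_mul_cancel₀ _ hd.ne'⟩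
  have hab : a ^ 2 + b ^ 2 = 1 := by
    rw [← ha, ← hb] at hd2
    have : d ^ 2 ≠ 0 := by positivity
    apply mul_right_cancel₀ this
    linear_combination hd2
  obtain ⟨ω, hω⟩ : ∃ ω, ω = κ / (2 * cos x) := ⟨_, rfl⟩
  have hω0 : ω ≠ 0 := by rw [hω]; positivity
  have hωκ : 2 * cos x * ω = κ := by rw [hω]; field_simp
  set S := elasticaArclength x with hS
  have hSneg : elasticaArclength (-x) = -S := elasticaArclength_neg x
  have hXneg : X (-S) = -elasticaAbscissa x := by rw [← hSneg, hXS, elasticaAbscissa_neg]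
  have huneg : u (-S) = cos x := by rw [← hSneg, huS, cos_neg]
  set L := 2 * S / ω with hL
  have hωL : ω * L + -S = S := by rw [hL]; field_simp; ring
  have hLpos : 0 < L := by
    have hSx : 0 < S * x := by
      rcases lt_trichotomy x 0 with h | h | h
      · have := strictMono_elasticaArclength h
        rw [elasticaArclength_zero] at this
        exact mul_pos_of_neg_of_neg this h
      · simp [h] at hκx
      · have := strictMono_elasticaArclength h
        rw [elasticaArclength_zero] at this
        exact mul_pos this h
    have hSω : 0 < S * ω := by
      have : 0 < (S * x) * (κ * x) * (2 * cos x)⁻¹ := by positivity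
      have h2 : (S * x) * (κ * x) * (2 * cos x)⁻¹ = S * ω * x ^ 2 := by rw [hω]; ring
      rw [h2] at this
      exact pos_of_mul_pos_left this (sq_nonneg x)
    rw [hL]
    have : 2 * S / ω = 2 * (S * ω) / ω ^ 2 := by field_simp
    rw [this]
    positivity
  have hσ : ∀ s, HasDerivAt (fun s => ω * s + -S) ω s := fun s => by
    simpa using ((hasDerivAt_id s).const_mul ω).add_const (-S)
  have hX' : ∀ s, HasDerivAt (fun s => X (ω * s + -S)) (u (ω * s + -S) ^ 2 * ω) s :=
    fun s => (hX _).comp s (hσ s)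
  have hu' : ∀ s, HasDerivAt (fun s => u (ω * s + -S)) (-v (ω * s + -S) * ω) s :=
    fun s => (hu _).comp s (hσ s)
  have hv' : ∀ s, HasDerivAt (fun s => v (ω * s + -S)) (2 * u (ω * s + -S) ^ 3 * ω) s :=
    fun s => (hv _).comp s (hσ s)
  let γ : ℝ → EuclideanSpace ℝ (Fin 2) := fun s =>
    !₂[A 0 + (a * (X (ω * s + -S) - X (-S)) + b * (u (ω * s + -S) - u (-S))) / ω,
      A 1 + (b * (X (ω * s + -S) - X (-S)) - a * (u (ω * s + -S) - u (-S))) / ω]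
  have hγ' : ∀ s, HasDerivAt γ
      !₂[a * u (ω * s + -S) ^ 2 - b * v (ω * s + -S),
        b * u (ω * s + -S) ^ 2 + a * v (ω * s + -S)] s := fun s => by
    refine hasDerivAt_euclidean fun i => ?_
    fin_cases i
    · refine (((((hX' s).sub_const _).const_mul a).add
        (((hu' s).sub_const _).const_mul b)).div_const ω |>.const_add _).congr_deriv ?_
      simp
      field_simp
      ring
    · refine (((((hX' s).sub_const _).const_mul b).sub
        (((hu' s).sub_const _).const_mul a)).div_const ω |>.const_add _).congr_deriv ?_
      simp
      field_simp
  have hγ'' : ∀ s, HasDerivAt (deriv γ)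
      !₂[(-2 * a * u (ω * s + -S) * v (ω * s + -S) - 2 * b * u (ω * s + -S) ^ 3) * ω,
        (-2 * b * u (ω * s + -S) * v (ω * s + -S) + 2 * a * u (ω * s + -S) ^ 3) * ω] s :=
    fun s => by
    rw [funext fun s => (hγ' s).deriv]
    refine hasDerivAt_euclidean fun i => ?_
    fin_cases i
    · refine ((((hu' s).pow 2).const_mul a).sub ((hv' s).const_mul b)).congr_deriv ?_
      simp
      ring
    · refine ((((hu' s).pow 2).const_mul b).add ((hv' s).const_mul a)).congr_deriv ?_
      simp
      ring
  have hcurv : signedCurvature γ = fun s => 2 * ω * u (ω * s + -S) := by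
    funext s
    rw [signedCurvature, (hγ' s).deriv, (hγ'' s).deriv]
    simp
    linear_combination (2 * u (ω * s + -S) * ω * (u (ω * s + -S) ^ 4 + v (ω * s + -S) ^ 2)) * hab
      + 2 * u (ω * s + -S) * ω * huv (ω * s + -S)
  refine ⟨L, γ, ⟨hLpos, ?_, fun s _ => ?_, fun s _ => ?_, ?_, ?_, ?_, ?_⟩, ?_⟩
  · rw [contDiff_euclidean]
    have hσs : ContDiff ℝ (⊤ : ℕ∞) fun s : ℝ => ω * s + -S := by fun_prop
    have h1 := hXs.comp hσs
    have h2 := hus.comp hσs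
    simp only [Function.comp_def] at h1 h2
    intro i
    fin_cases i <;> simp [γ] <;> fun_prop
  · rw [(hγ' s).deriv, EuclideanSpace.norm_eq]
    simp
    linear_combination (u (ω * s + -S) ^ 4 + v (ω * s + -S) ^ 2) * hab + huv (ω * s + -S)
  · have h1 : deriv (fun s => 2 * ω * u (ω * s + -S)) =
        fun s => 2 * ω * (-v (ω * s + -S) * ω) :=
      funext fun s => ((hu' s).const_mul (2 * ω)).deriv
    have h2 := (((hv' s).neg.mul_const ω).const_mul (2 * ω)).deriv
    simp only [Pi.neg_apply] at h2
    rw [hcurv, h1, h2]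
    ring
  · ext i
    fin_cases i <;> simp [γ]
  · have key : (X (ω * L + -S) - X (-S)) / ω = d := by
      rw [hωL, hXS, hXneg, div_eq_iff hω0]
      apply mul_left_cancel₀ (by positivity : 2 * cos x ≠ 0)
      linear_combination hx - d * hωκ
    have hu0 : u (ω * L + -S) - u (-S) = 0 := by rw [hωL, huS, huneg, sub_self]
    ext i
    fin_cases i
    · simp only [γ, hu0]
      simp
      rw [mul_div_assoc, key, ha]
      ring
    · simp only [γ, hu0]
      simp
      rw [mul_div_assoc, key, hb]
      ring
  · simp only [hcurv, mul_zero, zero_add, huneg]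
    linear_combination hωκ
  · simp only [hcurv, hωL, S, huS]
    linear_combination hωκ
  · rw [hcurv]
    have hint := integral_eq_sub_of_hasDerivAt (a := 0) (b := L)
      (f := fun s => 4 * ω * X (ω * s + -S)) (f' := fun s => (2 * ω * u (ω * s + -S)) ^ 2)
      (fun s _ => ((hX' s).const_mul (4 * ω)).congr_deriv (by ring))
      (Continuous.intervalIntegrable (by have := hus.continuous; fun_prop) _ _)
    rw [hint]
    simp only [mul_zero, zero_add, hωL, hXS, hXneg, S]
    rw [hω]
    field_simp
    ring

/-- Below the threshold, the matching condition for the half amplitude has two solutions. -/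
lemma exists_two_amplitudes {m z : ℝ} (hm : 0 < m) (hz : z ∈ Icc (0 : ℝ) 1)
    (hlt : m < 4 * z * elasticaAbscissa (arccos z)) :
    ∃ x y : ℝ, 0 < x ∧ x < y ∧ y < π / 2 ∧
      4 * cos x * elasticaAbscissa x = m ∧ 4 * cos y * elasticaAbscissa y = m := by
  set p := arccos z
  have hp0 : 0 ≤ p := arccos_nonneg z
  have hp : p ≤ π / 2 := arccos_le_pi_div_two.2 hz.1
  have hcos : cos p = z := cos_arccos (by linarith [hz.1]) hz.2
  let f : ℝ → ℝ := fun x => 4 * cos x * elasticaAbscissa x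
  have hf : Continuous f := by
    have := continuous_elasticaAbscissa
    fun_prop
  have hfp : m < f p := by simpa only [f, hcos] using hlt
  obtain ⟨x, hx, hxm⟩ := intermediate_value_Ioo hp0 hf.continuousOn
    ⟨by simpa [f, elasticaAbscissa_zero] using hm, hfp⟩
  obtain ⟨y, hy, hym⟩ := intermediate_value_Ioo' hp hf.continuousOn
    ⟨by simpa [f] using hm, hfp⟩
  exact ⟨x, y, hx.1, hx.2.trans hy.1, hy.2, hxm, hym⟩

/-- The symmetric Navier problem is solvable from any matching half amplitude in `(0, π / 2)`. -/
lemma exists_symmetric_navier_solution_of_abs {A B : EuclideanSpace ℝ (Fin 2)} (hAB : A ≠ B)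
    {κ x : ℝ} (hκ : κ ≠ 0) (hx0 : 0 < x) (hxπ : x < π / 2)
    (hx : 4 * cos x * elasticaAbscissa x = |κ| * ‖B - A‖) :
    ∃ (L : ℝ) (γ : ℝ → EuclideanSpace ℝ (Fin 2)),
      (0 < L ∧ ContDiff ℝ (⊤ : ℕ∞) γ ∧
        (∀ s ∈ Icc (0 : ℝ) L, ‖deriv γ s‖ = 1) ∧
        (∀ s ∈ Icc (0 : ℝ) L,
          -(2 * deriv (deriv (signedCurvature γ)) s) = (signedCurvature γ s) ^ 3) ∧
        γ 0 = A ∧ γ L = B ∧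
        signedCurvature γ 0 = κ ∧ signedCurvature γ L = κ) ∧
      (1 / 2) * (∫ s in (0 : ℝ)..L, (signedCurvature γ s) ^ 2) =
        2 * |κ| * elasticaAbscissa x / cos x := by
  have hcos : 0 < cos x := cos_pos_of_mem_Ioo ⟨by linarith [pi_pos], hxπ⟩
  rcases hκ.lt_or_gt with h | h
  · rw [abs_of_neg h] at hx ⊢
    have := exists_symmetric_navier_solution hAB (κ := κ) (x := -x) (by rwa [cos_neg])
      (mul_pos_of_neg_of_neg h (by linarith))
      (by rw [cos_neg, elasticaAbscissa_neg]; linear_combination -hx)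
    rw [cos_neg, elasticaAbscissa_neg] at this
    convert this using 6
    ring
  · rw [abs_of_pos h] at hx ⊢
    exact exists_symmetric_navier_solution hAB hcos (mul_pos h hx0) hx

/-- If `A ≠ B`, `κ ≠ 0` and `|κ|·‖B−A‖ < M₀` where
`M₀ := sup_{z∈[0,1]} 4z∫_z¹ t²/√(1−t⁴) dt`, then the symmetric Navier problem with data
`(A, B, κ)` admits two solutions with distinct Willmore energies. -/
theorem symmetric_navier_two_solutions_below_threshold
    (A B : EuclideanSpace ℝ (Fin 2)) (hAB : A ≠ B) (κ : ℝ) (hκ : κ ≠ 0)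
    (M₀ : ℝ)
    (hM₀ : M₀ = sSup ((fun z : ℝ =>
      4 * z * ∫ t in z..1, t ^ 2 / Real.sqrt (1 - t ^ 4)) '' Set.Icc (0 : ℝ) 1))
    (hsmall : |κ| * ‖B - A‖ < M₀) :
    ∃ (L₁ L₂ : ℝ) (γ₁ γ₂ : ℝ → EuclideanSpace ℝ (Fin 2)),
      (0 < L₁ ∧ ContDiff ℝ (⊤ : ℕ∞) γ₁ ∧
        (∀ s ∈ Set.Icc (0 : ℝ) L₁, ‖deriv γ₁ s‖ = 1) ∧
        (∀ s ∈ Set.Icc (0 : ℝ) L₁,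
          -(2 * deriv (deriv (signedCurvature γ₁)) s) = (signedCurvature γ₁ s) ^ 3) ∧
        γ₁ 0 = A ∧ γ₁ L₁ = B ∧
        signedCurvature γ₁ 0 = κ ∧ signedCurvature γ₁ L₁ = κ) ∧
      (0 < L₂ ∧ ContDiff ℝ (⊤ : ℕ∞) γ₂ ∧
        (∀ s ∈ Set.Icc (0 : ℝ) L₂, ‖deriv γ₂ s‖ = 1) ∧
        (∀ s ∈ Set.Icc (0 : ℝ) L₂,
          -(2 * deriv (deriv (signedCurvature γ₂)) s) = (signedCurvature γ₂ s) ^ 3) ∧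
        γ₂ 0 = A ∧ γ₂ L₂ = B ∧
        signedCurvature γ₂ 0 = κ ∧ signedCurvature γ₂ L₂ = κ) ∧
      (1 / 2) * (∫ s in (0 : ℝ)..L₁, (signedCurvature γ₁ s) ^ 2) ≠
        (1 / 2) * (∫ s in (0 : ℝ)..L₂, (signedCurvature γ₂ s) ^ 2) := by
  have hκ' : 0 < |κ| := abs_pos.2 hκ
  have hm : 0 < |κ| * ‖B - A‖ := mul_pos hκ' (norm_pos_iff.2 (sub_ne_zero.2 hAB.symm))
  rw [hM₀] at hsmall
  obtain ⟨_, ⟨z, hz, rfl⟩, hlt⟩ :=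
    exists_lt_of_lt_csSup ((nonempty_Icc.2 zero_le_one).image _) hsmall
  simp only [integral_sq_div_sqrt_eq_elasticaAbscissa hz] at hlt
  obtain ⟨x, y, hx0, hxy, hyπ, hx, hy⟩ := exists_two_amplitudes hm hz hlt
  obtain ⟨L₁, γ₁, h₁, hE₁⟩ :=
    exists_symmetric_navier_solution_of_abs hAB hκ hx0 (hxy.trans hyπ) hx
  obtain ⟨L₂, γ₂, h₂, hE₂⟩ :=
    exists_symmetric_navier_solution_of_abs hAB hκ (hx0.trans hxy) hyπ hy
  refine ⟨L₁, L₂, γ₁, γ₂, h₁, h₂, ?_⟩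
  rw [hE₁, hE₂]
  refine ne_of_lt ?_
  have hJ := strictMonoOn_elasticaAbscissa ⟨hx0.le, (hxy.trans hyπ).le⟩
    ⟨(hx0.trans hxy).le, hyπ.le⟩ hxy
  have hcosy : 0 < cos y := cos_pos_of_mem_Ioo ⟨by linarith [pi_pos], hyπ⟩
  have hcos : cos y < cos x :=
    cos_lt_cos_of_nonneg_of_le_pi_div_two hx0.le hyπ.le hxy
  have hJx : 0 < elasticaAbscissa x := by
    rw [← hx] at hm
    exact pos_of_mul_pos_right hm (by linarith)
  have hJy := hJx.trans hJ
  gcongr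
end

section
/- Let A, B ∈ ℝ², κ ∈ ℝ, L > 0, and let γ : [0,L] → ℝ² be a smooth unit-speed curve whose curvature κ_γ(s) := det(γ'(s), γ''(s)) satisfies −2κ_γ'' = κ_γ³ on [0,L], together with γ(0) = A, γ(L) = B and κ_γ(0) = κ_γ(L) = κ. Then the Willmore energy satisfies (1/2)∫₀ᴸ κ_γ(s)² ds ≥ (κ²/2)·‖B−A‖. -/
open intervalIntegral in
/-- Componentwise form of the bound: `(u, v)` is the unit tangent, `k` the curvature and `p = k'`.
The vector `k² T + 2 k' N` is conserved, and it is parallel to the chord `(∫ u, ∫ v)` because `k`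
agrees at the two endpoints. -/
theorem sq_mul_sqrt_le_integral_sq {L : ℝ} (hL : 0 < L) {u v k p : ℝ → ℝ}
    (hu : ∀ s ∈ Set.Icc 0 L, HasDerivAt u (-(k s * v s)) s)
    (hv : ∀ s ∈ Set.Icc 0 L, HasDerivAt v (k s * u s) s)
    (hk : ∀ s ∈ Set.Icc 0 L, HasDerivAt k (p s) s)
    (hp : ∀ s ∈ Set.Icc 0 L, HasDerivAt p (-(k s ^ 3 / 2)) s)
    (huv : ∀ s ∈ Set.Icc 0 L, u s ^ 2 + v s ^ 2 = 1) (hkL : k L = k 0) :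
    k 0 ^ 2 * √((∫ s in (0 : ℝ)..L, u s) ^ 2 + (∫ s in (0 : ℝ)..L, v s) ^ 2) ≤
      ∫ s in (0 : ℝ)..L, k s ^ 2 := by
  have hIcc : Set.uIcc 0 L = Set.Icc 0 L := Set.uIcc_of_le hL.le
  have cont {f f' : ℝ → ℝ} (h : ∀ s ∈ Set.Icc 0 L, HasDerivAt f (f' s) s) :
      ContinuousOn f (Set.Icc 0 L) := fun s hs => (h s hs).continuousAt.continuousWithinAt
  have int {f f' : ℝ → ℝ} (h : ∀ s ∈ Set.Icc 0 L, HasDerivAt f (f' s) s) :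
      IntervalIntegrable f MeasureTheory.volume 0 L := (hIcc ▸ cont h).intervalIntegrable
  have const {f : ℝ → ℝ} (h : ∀ s ∈ Set.Icc 0 L, HasDerivAt f 0 s) :
      ∀ s ∈ Set.Icc 0 L, f s = f 0 :=
    constant_of_has_deriv_right_zero (cont (f' := fun _ => 0) h)
      fun s hs => (h s ⟨hs.1, hs.2.le⟩).hasDerivWithinAt
  have ha := const (f := fun s => k s ^ 2 * u s - 2 * p s * v s) fun s hs => by
    refine ((((hk s hs).pow 2).mul (hu s hs)).sub
      (((hp s hs).const_mul 2).mul (hv s hs))).congr_deriv ?_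
    simp
    ring
  have hb := const (f := fun s => k s ^ 2 * v s + 2 * p s * u s) fun s hs => by
    refine ((((hk s hs).pow 2).mul (hv s hs)).add
      (((hp s hs).const_mul 2).mul (hu s hs))).congr_deriv ?_
    simp
    ring
  have h0 := huv 0 ⟨le_rfl, hL.le⟩
  set a := k 0 ^ 2 * u 0 - 2 * p 0 * v 0 with ha0
  set b := k 0 ^ 2 * v 0 + 2 * p 0 * u 0 with hb0
  set X := ∫ s in (0 : ℝ)..L, u s
  set Y := ∫ s in (0 : ℝ)..L, v s
  have hI : ∫ s in (0 : ℝ)..L, k s ^ 2 = a * X + b * Y := by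
    rw [← integral_const_mul, ← integral_const_mul,
      ← integral_add ((int hu).const_mul a) ((int hv).const_mul b)]
    refine integral_congr fun s hs => ?_
    rw [hIcc] at hs
    simp only [← ha s hs, ← hb s hs]
    linear_combination (-(k s ^ 2)) * huv s hs
  have hpar : b * X - a * Y = 0 := by
    have h2 : ∫ s in (0 : ℝ)..L, p s = 0 := by
      rw [integral_eq_sub_of_hasDerivAt (hIcc ▸ hk) (int hp), hkL, sub_self]
    have h3 : ∫ s in (0 : ℝ)..L, 2 * p s = b * X - a * Y := by
      rw [← integral_const_mul, ← integral_const_mul,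
        ← integral_sub ((int hu).const_mul b) ((int hv).const_mul a)]
      refine integral_congr fun s hs => ?_
      rw [hIcc] at hs
      simp only [← ha s hs, ← hb s hs]
      linear_combination (-(2 * p s)) * huv s hs
    rw [← h3, integral_const_mul, h2, mul_zero]
  have hnn : 0 ≤ ∫ s in (0 : ℝ)..L, k s ^ 2 :=
    integral_nonneg hL.le fun s _ => sq_nonneg _
  have hab : a ^ 2 + b ^ 2 = k 0 ^ 4 + 4 * p 0 ^ 2 := by
    rw [ha0, hb0]
    linear_combination (k 0 ^ 4 + 4 * p 0 ^ 2) * h0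
  refine le_of_sq_le_sq ?_ hnn
  rw [mul_pow, Real.sq_sqrt (by positivity), hI]
  have key : (a * X + b * Y) ^ 2 = (k 0 ^ 4 + 4 * p 0 ^ 2) * (X ^ 2 + Y ^ 2) := by
    linear_combination (X ^ 2 + Y ^ 2) * hab - (b * X - a * Y) * hpar
  rw [key]
  have : 0 ≤ 4 * p 0 ^ 2 * (X ^ 2 + Y ^ 2) := by positivity
  linarith

/-- Any solution of the symmetric Navier problem with data `(A, B, κ)` has Willmore
energy at least `(κ²/2)·‖B−A‖`. -/
theorem symmetric_navier_energy_lower_bound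
    (A B : EuclideanSpace ℝ (Fin 2)) (κ : ℝ) (L : ℝ) (hL : 0 < L)
    (γ : ℝ → EuclideanSpace ℝ (Fin 2)) (hγ : ContDiff ℝ (⊤ : ℕ∞) γ)
    (hunit : ∀ s ∈ Set.Icc (0 : ℝ) L, ‖deriv γ s‖ = 1)
    (hode : ∀ s ∈ Set.Icc (0 : ℝ) L,
      -(2 * deriv (deriv (signedCurvature γ)) s) = (signedCurvature γ s) ^ 3)
    (h0 : γ 0 = A) (h1 : γ L = B)
    (hκ0 : signedCurvature γ 0 = κ) (hκ1 : signedCurvature γ L = κ) :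
    (1 / 2) * (∫ s in (0 : ℝ)..L, (signedCurvature γ s) ^ 2) ≥ κ ^ 2 / 2 * ‖B - A‖ := by
  have coord (f : ℝ → EuclideanSpace ℝ (Fin 2)) (hf : ContDiff ℝ (⊤ : ℕ∞) f) (i : Fin 2) (s : ℝ) :
      HasDerivAt (fun t => f t i) (deriv f s i) s :=
    (EuclideanSpace.proj (𝕜 := ℝ) i).hasFDerivAt.comp_hasDerivAt s
      ((hf.differentiable (by simp)) s).hasDerivAt
  have hγ' : ContDiff ℝ (⊤ : ℕ∞) (deriv γ) := (contDiff_infty_iff_deriv.1 hγ).2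
  have hγ'' : ContDiff ℝ (⊤ : ℕ∞) (deriv (deriv γ)) := (contDiff_infty_iff_deriv.1 hγ').2
  have hk : ContDiff ℝ (⊤ : ℕ∞) (signedCurvature γ) := by
    have h1 := contDiff_euclidean.1 hγ'
    have h2 := contDiff_euclidean.1 hγ''
    exact ((h1 0).mul (h2 1)).sub ((h1 1).mul (h2 0))
  have hk' : ContDiff ℝ (⊤ : ℕ∞) (deriv (signedCurvature γ)) := (contDiff_infty_iff_deriv.1 hk).2
  have huv : ∀ s ∈ Set.Icc 0 L, deriv γ s 0 ^ 2 + deriv γ s 1 ^ 2 = 1 := fun s hs => by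
    have h := EuclideanSpace.norm_sq_eq (deriv γ s)
    rw [hunit s hs] at h
    simpa using h.symm
  have horth : ∀ s ∈ Set.Icc 0 L,
      deriv γ s 0 * deriv (deriv γ) s 0 + deriv γ s 1 * deriv (deriv γ) s 1 = 0 := fun s hs => by
    have h1 := (((coord _ hγ' 0 s).pow 2).add ((coord _ hγ' 1 s).pow 2)).hasDerivWithinAt
      (s := Set.Icc 0 L)
    have h2 := (hasDerivWithinAt_const s (Set.Icc 0 L) (1 : ℝ)).congr_of_mem
      (fun t ht => huv t ht) hs
    have h := (uniqueDiffOn_Icc hL s hs).eq_deriv _ h1 h2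
    simp at h
    linarith
  have hchord (i : Fin 2) : ∫ s in (0 : ℝ)..L, deriv γ s i = (B - A) i := by
    rw [intervalIntegral.integral_eq_sub_of_hasDerivAt (fun s _ => coord γ hγ i s)
      (((contDiff_euclidean.1 hγ' i).continuous).intervalIntegrable _ _), h0, h1]
    simp
  have main := sq_mul_sqrt_le_integral_sq hL (u := fun s => deriv γ s 0)
    (v := fun s => deriv γ s 1) (k := signedCurvature γ) (p := deriv (signedCurvature γ))
    (fun s hs => (coord _ hγ' 0 s).congr_deriv (by
      simp only [signedCurvature]
      linear_combination (-deriv (deriv γ) s 0) * huv s hs + deriv γ s 0 * horth s hs))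
    (fun s hs => (coord _ hγ' 1 s).congr_deriv (by
      simp only [signedCurvature]
      linear_combination (-deriv (deriv γ) s 1) * huv s hs + deriv γ s 1 * horth s hs))
    (fun s _ => ((hk.differentiable (by simp)) s).hasDerivAt)
    (fun s hs => ((hk'.differentiable (by simp)) s).hasDerivAt.congr_deriv (by
      linarith [hode s hs]))
    huv (hκ1.trans hκ0.symm)
  have hnorm : ‖B - A‖ = √((B - A) 0 ^ 2 + (B - A) 1 ^ 2) := by
    simp [EuclideanSpace.norm_eq]
  rw [hchord 0, hchord 1, ← hnorm, hκ0] at main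
  linarith
end
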